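/- (Oleinik) Let u₀ belong to the class 𝒦 and let p be smooth. Then there exists X > 0 such that the steady Prandtl system admits a solution (u,v) on [0,X)×[0,∞) with u(0,·) = u₀ and the following properties: (1) u is bounded and continuous on [0,X]×[0,∞); ∂_y u and ∂²_y u are bounded and continuous on [0,X)×[0,∞); v, ∂_y v, ∂ₓ u are locally bounded and continuous on [0,X)×[0,∞); (2) u(x,y) > 0 on [0,X)×(0,∞), and for every x̄ < X there exist y₀ > 0 and m > 0 with ∂_y u(x,y) ≥ m on [0,x̄]×[0,y₀]; (3) if p'(x) ≤ 0 for all x ≥ 0, the solution exists globally, i.e. one may take any X > 0. -/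

import Mathlib

set_option linter.all false

open Set

/-- Iterated partial derivative `∂ₓ^k ∂_y^m` of a function of two real variables. -/
noncomputable def pd (k m : ℕ) (w : ℝ → ℝ → ℝ) (x y : ℝ) : ℝ :=
  iteratedDeriv k (fun x' => iteratedDeriv m (w x') y) x

/-- The class `𝒦` of admissible initial data: `u₀ ∈ C^{2,α}_b([0,∞))` for some
`α > 0`, `u₀(0) = 0`, `u₀'(0) > 0`, `u₀ > 0` on `(0,∞)`, `u₀(y) → U(0) > 0` as
`y → ∞`, and `u₀''(y) - p'(0) = O(y²)` as `y → 0`.  Here `U0 = U(0)` and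
`p'0 = p'(0)`. -/
structure InClassK (U0 p'0 : ℝ) (u₀ : ℝ → ℝ) : Prop where
  reg : ∃ α > (0 : ℝ), ∃ K > (0 : ℝ),
    ContDiffOn ℝ 2 u₀ (Set.Ici 0) ∧
    (∀ y ∈ Set.Ici (0 : ℝ),
      |u₀ y| ≤ K ∧ |deriv u₀ y| ≤ K ∧ |iteratedDeriv 2 u₀ y| ≤ K) ∧
    (∀ y ∈ Set.Ici (0 : ℝ), ∀ z ∈ Set.Ici (0 : ℝ),
      |iteratedDeriv 2 u₀ y - iteratedDeriv 2 u₀ z| ≤ K * |y - z| ^ α)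
  init : u₀ 0 = 0
  slope : 0 < deriv u₀ 0
  pos : ∀ y ∈ Set.Ioi (0 : ℝ), 0 < u₀ y
  outer : Filter.Tendsto u₀ Filter.atTop (nhds U0)
  hU0 : 0 < U0
  compat : ∃ C > (0 : ℝ), ∃ r > (0 : ℝ), ∀ y ∈ Set.Icc (0 : ℝ) r,
    |iteratedDeriv 2 u₀ y - p'0| ≤ C * y ^ 2

/-- Oleinik's solution of the steady Prandtl system on `[0,X) × [0,∞)` with
initial data `u₀` and outer flow `(U, p)`, with the regularity, boundary and
non-degeneracy properties of Theorem 2.1.1 of Oleinik. -/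
structure PrandtlOnInterval (U p u₀ : ℝ → ℝ) (X : ℝ) (u v : ℝ → ℝ → ℝ) : Prop where
  init : ∀ y ∈ Set.Ici (0 : ℝ), u 0 y = u₀ y
  -- u is bounded and continuous in [0,X] × [0,∞)
  cont_u : ContinuousOn (fun z : ℝ × ℝ => u z.1 z.2) (Set.Icc 0 X ×ˢ Set.Ici 0)
  bdd_u : ∃ K : ℝ, ∀ x ∈ Set.Icc (0 : ℝ) X, ∀ y ∈ Set.Ici (0 : ℝ), |u x y| ≤ K
  -- ∂_y u, ∂²_y u are bounded and continuous in [0,X) × [0,∞)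
  cont_uy : ContinuousOn (fun z : ℝ × ℝ => pd 0 1 u z.1 z.2) (Set.Ico 0 X ×ˢ Set.Ici 0)
  bdd_uy : ∃ K : ℝ, ∀ x ∈ Set.Ico (0 : ℝ) X, ∀ y ∈ Set.Ici (0 : ℝ), |pd 0 1 u x y| ≤ K
  cont_uyy : ContinuousOn (fun z : ℝ × ℝ => pd 0 2 u z.1 z.2) (Set.Ico 0 X ×ˢ Set.Ici 0)
  bdd_uyy : ∃ K : ℝ, ∀ x ∈ Set.Ico (0 : ℝ) X, ∀ y ∈ Set.Ici (0 : ℝ), |pd 0 2 u x y| ≤ K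
  -- v, ∂_y v, ∂ₓ u are locally bounded and continuous in [0,X) × [0,∞)
  cont_v : ContinuousOn (fun z : ℝ × ℝ => v z.1 z.2) (Set.Ico 0 X ×ˢ Set.Ici 0)
  cont_vy : ContinuousOn (fun z : ℝ × ℝ => pd 0 1 v z.1 z.2) (Set.Ico 0 X ×ˢ Set.Ici 0)
  cont_ux : ContinuousOn (fun z : ℝ × ℝ => pd 1 0 u z.1 z.2) (Set.Ico 0 X ×ˢ Set.Ici 0)
  locbdd_v : ∀ z ∈ Set.Ico (0 : ℝ) X ×ˢ Set.Ici (0 : ℝ), ∃ s ∈ nhdsWithin z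
      (Set.Ico (0 : ℝ) X ×ˢ Set.Ici (0 : ℝ)), ∃ K : ℝ, ∀ z' ∈ s,
      |v z'.1 z'.2| ≤ K ∧ |pd 0 1 v z'.1 z'.2| ≤ K ∧ |pd 1 0 u z'.1 z'.2| ≤ K
  -- the equations
  eqn : ∀ x ∈ Set.Ioo (0 : ℝ) X, ∀ y ∈ Set.Ioi (0 : ℝ),
    u x y * pd 1 0 u x y + v x y * pd 0 1 u x y - pd 0 2 u x y = -(deriv p x)
  div : ∀ x ∈ Set.Ioo (0 : ℝ) X, ∀ y ∈ Set.Ioi (0 : ℝ),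
    pd 1 0 u x y + pd 0 1 v x y = 0
  -- boundary conditions
  bc_u : ∀ x ∈ Set.Ico (0 : ℝ) X, u x 0 = 0
  bc_v : ∀ x ∈ Set.Ico (0 : ℝ) X, v x 0 = 0
  outer : ∀ x ∈ Set.Ico (0 : ℝ) X, Filter.Tendsto (u x) Filter.atTop (nhds (U x))
  -- non-degeneracy
  pos : ∀ x ∈ Set.Ico (0 : ℝ) X, ∀ y ∈ Set.Ioi (0 : ℝ), 0 < u x y
  nondeg : ∀ xb ∈ Set.Ico (0 : ℝ) X, ∃ y₀ > (0 : ℝ), ∃ m > (0 : ℝ),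
    ∀ x ∈ Set.Icc (0 : ℝ) xb, ∀ y ∈ Set.Icc (0 : ℝ) y₀, m ≤ pd 0 1 u x y

open Filter Topology MeasureTheory
open Real (exp)

notation "p!" => by positivity
notation "l!" => by linarith
lemma mll {a b c : ℝ} (h : b ≤ c) (k : 0 ≤ a) : a*b ≤ a*c := mul_le_mul_of_nonneg_left h k
lemma mlr {a b c : ℝ} (h : b ≤ c) (k : 0 ≤ a) : b*a ≤ c*a := mul_le_mul_of_nonneg_right h k
lemma sqp {x : ℝ} (h : 0 < x) : 0 < √x := Real.sqrt_pos.2 h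
lemma sqs {x : ℝ} (h : 0 ≤ x) : √x^2 = x := Real.sq_sqrt h
lemma sqm {x y : ℝ} (h : x ≤ y) : √x ≤ √y := Real.sqrt_le_sqrt h
lemma abp {x : ℝ} (h : 0 < x) : |x| = x := abs_of_pos h
lemma abn {x : ℝ} (h : 0 ≤ x) : |x| = x := abs_of_nonneg h
lemma abc (x y : ℝ) : |x-y| = |y-x| := abs_sub_comm x y
lemma aal (x y : ℝ) : |x+y| ≤ |x|+|y| := abs_add_le x y
lemma dli {a b c : ℝ} (h : 0 < c) : a/c ≤ b ↔ a ≤ b*c := div_le_iff₀ h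
lemma ldi {a b c : ℝ} (h : 0 < c) : a ≤ b/c ↔ a*c ≤ b := le_div_iff₀ h
lemma sbn {a b : ℝ} (h : b ≤ a) : 0 ≤ a-b := sub_nonneg.2 h
lemma ml1 {a b : ℝ} (k : 0 ≤ a) (h : b ≤ 1) : a*b ≤ a := mul_le_of_le_one_right k h
lemma exr {T : Type} (a : T) : ∃ x, x = a := ⟨_, rfl⟩

/-- cut-off weight -/
noncomputable def mu (t : ℝ) : ℝ := min t 1

/-- the explicit scheme -/
structure Sch (A τ : ℝ) (f : ℕ → ℝ) (W : ℕ → ℕ → ℝ) : Prop where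
  hA : 1 ≤ A
  hτ : 0 < τ
  b : ∀ n, W (n+1) 0 = W n 0
  s : ∀ n j, W (n+1) (j+1) = W n (j+1)
    + √(W n (j+1))/(4*A)*(W n (j+2) - 2*W n (j+1) + W n j) - 2*τ*f n

/-- discrete `x`-derivative -/
noncomputable def qq (W : ℕ → ℕ → ℝ) (τ : ℝ) (n j : ℕ) : ℝ := (W (n+1) j - W n j)/τ

lemma Sch.q0 {A τ f W} (S : Sch A τ f W) (n) : qq W τ n 0 = 0 := by simp [qq, S.b n]

lemma Sch.Wq {A τ f W} (S : Sch A τ f W) (n j) : W (n+1) j = W n j + τ * qq W τ n j := by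
  have := S.hτ.ne'
  unfold qq; field_simp; ring

lemma Sch.lap {A τ f W} (S : Sch A τ f W) (n j) (h : 0 < W n (j+1)) :
    W n (j+2) - 2*W n (j+1) + W n j = 4*A*τ*((qq W τ n (j+1) + 2*f n)/√(W n (j+1))) := by
  have h1 := S.hτ.ne'
  have h2 : A ≠ 0 := by linarith [S.hA]
  have h3 : √(W n (j+1)) ≠ 0 := (sqp h).ne'
  unfold qq; rw [S.s n j]; field_simp; ring

lemma Sch.qeq {A τ f W} (S : Sch A τ f W) (n j) (h : 0 < W n (j+1)) (h' : 0 < W (n+1) (j+1)) :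
    qq W τ (n+1) (j+1) = qq W τ n (j+1)
     + √(W (n+1) (j+1))/(4*A)*(qq W τ n (j+2) - 2*qq W τ n (j+1) + qq W τ n j)
     + τ*(qq W τ n (j+1)*(qq W τ n (j+1) + 2*f n)
        /(√(W n (j+1))*(√(W (n+1) (j+1)) + √(W n (j+1))))) - 2*(f (n+1) - f n) := by
  have hτ := S.hτ.ne'
  have hA : A ≠ 0 := by linarith [S.hA]
  have l1 := S.lap n j h
  have l2 := S.lap (n+1) j h'
  have e0 := S.Wq n j
  have e1 := S.Wq n (j+1)
  have e2 := S.Wq n (j+2)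
  have a1 := sqp h
  have a2 := sqp h'
  have s1 := sqs h.le
  have s2 := sqs h'.le
  rw [e0, e1, e2] at l2
  rw [← e1] at l2
  generalize √(W n (j+1)) = a, √(W (n+1) (j+1)) = a', qq W τ (n+1) (j+1) = Q', qq W τ n (j+1) = Q, qq W τ n j = Q0, qq W τ n (j+2) = Q2 at *
  have k : (a' - a)*(a'+a) = τ*Q := by linarith only [s1,s2,e1]
  have l3 : W n (j+2) + τ*Q2 - 2*(W n (j+1) + τ*Q) + (W n j + τ*Q0)
     = 4*A*τ*((Q+2*f n)/a) + τ*(Q2-2*Q+Q0) := by rw [← l1]; ring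
  rw [e1] at l2
  rw [l3] at l2
  have l4 : a' * (4*A*((Q+2*f n)/a) + (Q2-2*Q+Q0)) = 4*A*(Q'+2*f (n+1)) := by
    have : τ * (a' * (4*A*((Q+2*f n)/a) + (Q2-2*Q+Q0))) = τ*(4*A*(Q'+2*f (n+1))) := by
      calc _ = a' * (4*A*τ*((Q+2*f n)/a) + τ*(Q2-2*Q+Q0)) := by ring
        _ = _ := by rw [l2]; field_simp
    exact mul_left_cancel₀ hτ this
  have l5 : τ*(Q*(Q+2*f n)/(a*(a'+a))) = (a'-a)*(Q+2*f n)/a := by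
    rw [show τ*(Q*(Q+2*f n)/(a*(a'+a))) = (τ*Q)*(Q+2*f n)/(a*(a'+a)) by ring, ← k]
    field_simp
  rw [l5]
  have l6 : Q' = a'/(4*A) * (4*A*((Q+2*f n)/a) + (Q2-2*Q+Q0)) - 2*f (n+1) := by
    rw [div_mul_eq_mul_div, l4]; field_simp; ring
  rw [l6]; field_simp; ring

/-- barrier step -/
lemma Sch.stepB {A τ f W} (S : Sch A τ f W) {n j : ℕ} {b : ℕ → ℝ} {K c R Fz F' Λ : ℝ}
    (hK : 1 ≤ K) (hc : 0 < c) (hb : ∀ j, 0 < b j) (hF' : 0 ≤ F')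
    (hq : ∀ j, |qq W τ n j| ≤ K * b j)
    (hW : c * b (j+1) ≤ W n (j+1)) (hW' : 0 < W (n+1) (j+1)) (hA' : W (n+1) (j+1) ≤ A^2)
    (hqf : |qq W τ n (j+1) + 2*f n| ≤ R * b (j+1) + Fz) (hf : |f (n+1) - f n| ≤ F' * τ)
    (hcv : √(W (n+1) (j+1))/(4*A)*(b (j+2) - 2*b (j+1) + b j) + τ*(Fz/c + 2*F') ≤ τ*Λ*b (j+1)) :
    |qq W τ (n+1) (j+1)| ≤ K*(1+(R/c+Λ)*τ) * b (j+1) := by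
  have hA := S.hA
  have hτ := S.hτ
  have hWp : 0 < W n (j+1) := lt_of_lt_of_le (mul_pos hc (hb _)) hW
  rw [S.qeq n j hWp hW']
  have a1 := sqp hWp
  have a2 := sqp hW'
  have s1 := sqs hWp.le
  have a3 : √(W (n+1) (j+1)) ≤ A := Real.sqrt_le_iff.2 ⟨l!, hA'⟩
  have q0 := hq j
  have q1 := hq (j+1)
  have q2 := hq (j+2)
  have b1 := hb (j+1)
  generalize √(W n (j+1)) = a, √(W (n+1) (j+1)) = a', qq W τ n (j+1) = Q, qq W τ n j = Q0, qq W τ n (j+2) = Q2 at *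
  set r := a'/(4*A) with hr
  have r0 : 0 ≤ r := p!
  have r1 : r ≤ 1/4 := by rw [hr, dli l!]; linarith
  have src : |Q*(Q+2*f n)/(a*(a'+a))| ≤ (K/c)*(R*b (j+1)+Fz) := by
    rw [abs_div, abs_mul, abp (p! : 0 < a*(a'+a)), dli p!]
    have h1 : c * b (j+1) ≤ a*(a'+a) := by linarith only [hW,s1,mul_pos a1 a2]
    have h2 : 0 ≤ R*b (j+1)+Fz := le_trans (abs_nonneg _) hqf
    calc |Q| * |Q+2*f n| ≤ (K*b (j+1))*(R*b (j+1)+Fz) := by gcongr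
      _ = (K/c)*(R*b (j+1)+Fz)*(c*b (j+1)) := by field_simp
      _ ≤ _ := by gcongr
  have key : |Q + r*(Q2-2*Q+Q0)| ≤ K*b (j+1) + K*(r*(b (j+2) - 2*b (j+1) + b j)) := by
    have e : Q + r*(Q2-2*Q+Q0) = (1-2*r)*Q + r*Q2 + r*Q0 := by ring
    rw [e]
    calc |(1-2*r)*Q + r*Q2 + r*Q0| ≤ |(1-2*r)*Q| + |r*Q2| + |r*Q0| := abs_add_three _ _ _
      _ = (1-2*r) * |Q| + r * |Q2| + r * |Q0| := by
        rw [abs_mul, abs_mul, abs_mul, abn r0, abn (l! : 0 ≤ 1-2*r)]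
      _ ≤ (1-2*r)*(K*b (j+1)) + r*(K*b (j+2)) + r*(K*b j) := by
        gcongr; linarith
      _ = _ := by ring
  calc _ ≤ |Q + r*(Q2-2*Q+Q0)| + |τ*(Q*(Q+2*f n)/(a*(a'+a)))| + |2*(f (n+1) - f n)| := by
        refine (abs_sub _ _).trans ?_
        gcongr; exact aal _ _
    _ ≤ (K*b (j+1) + K*(r*(b (j+2) - 2*b (j+1) + b j))) + τ*((K/c)*(R*b (j+1)+Fz)) + 2*(F'*τ) := by
        rw [abs_mul τ, abp hτ, abs_mul 2, abp (by norm_num : (0:ℝ)<2)]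
        gcongr
    _ ≤ (K*b (j+1) + K*(r*(b (j+2) - 2*b (j+1) + b j))) + τ*((K/c)*(R*b (j+1)+Fz)) + K*(2*(F'*τ)) := by
        have : 0 ≤ 2*(F'*τ) := p!
        linarith only [mlr hK this]
    _ = K*(b (j+1) + τ*(R/c)*b (j+1) + (r*(b (j+2) - 2*b (j+1) + b j) + τ*(Fz/c+2*F'))) := by
        field_simp; ring
    _ ≤ K*(b (j+1) + τ*(R/c)*b (j+1) + τ*Λ*b (j+1)) := by gcongr
    _ = _ := by ring

/-- concave barrier -/
noncomputable def bet (L t : ℝ) : ℝ := if t ≤ 1/(4*L^2) then t - L*t*√t else 1/(8*L^2)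

lemma bet_small {L t : ℝ} (hL : 1 ≤ L) (ht : t ≤ 1/(4*L^2)) : L*√t ≤ 1/2 := by
  have : √t ≤ 1/(2*L) := by
    rw [Real.sqrt_le_iff]; refine ⟨p!, ?_⟩
    calc t ≤ _ := ht
      _ = _ := by field_simp; norm_num
  calc L*√t ≤ L*(1/(2*L)) := by gcongr
    _ = 1/2 := by field_simp

lemma bet_facts {L t : ℝ} (hL : 1 ≤ L) (h0 : 0 ≤ t) :
    bet L t ≤ mu t ∧ mu t ≤ 8*L^2*bet L t ∧ bet L t ≤ 1/(8*L^2) := by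
  have hL2 : 1 ≤ L^2 := by nlinarith
  unfold bet mu
  split_ifs with ht
  · have h1 := bet_small hL ht
    have h2 := Real.sqrt_nonneg t
    have h3 := sqs h0
    have h4 : 1/(4*L^2) ≤ 1 := by rw [div_le_one p!]; nlinarith
    have h5 : t - L*t*√t ≥ t/2 := by linarith only [mll h1 h0]
    refine ⟨le_min ?_ ?_, (min_le_left _ _).trans ?_, ?_⟩
    · have : 0 ≤ L*t*√t := p!
      linarith
    · have : 0 ≤ L*t*√t := p!
      linarith
    · nlinarith only [h5,hL2,h0]
    · rw [ldi p!]
      set r := L*√t with hr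
      have : t*L^2 = r^2 := by rw [hr, mul_pow, h3]; ring
      have e : (t - L*t*√t)*(8*L^2) = 8*(r^2 - r^3) := by
        rw [hr]; have : √t^3 = t*√t := by rw [pow_succ, h3]
        rw [mul_pow, mul_pow, h3, this]; ring
      rw [e]
      have r0 : 0 ≤ r := p!
      nlinarith only [r0,h1,mul_nonneg r0 (sbn h1), mul_nonneg (mul_nonneg r0 r0) (sbn h1), mul_nonneg (sbn h1) (sbn h1)]
  · push Not at ht
    have h1 : 1/(8*L^2) = (1/2)*(1/(4*L^2)) := by field_simp; norm_num
    have h2 : 1/(8*L^2) ≤ 1 := by rw [div_le_one p!]; nlinarith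
    refine ⟨le_min ?_ h2, (min_le_right _ _).trans ?_, le_rfl⟩
    · have : 0 ≤ 1/(4*L^2) := p!
      linarith
    · field_simp; norm_num

lemma mu_pos {t : ℝ} (h : 0 < t) : 0 < mu t := lt_min h one_pos

lemma bet_pos {L t : ℝ} (hL : 1 ≤ L) (h0 : 0 < t) : 0 < bet L t := by
  have h1 := (bet_facts hL h0.le).2.1
  have := mu_pos h0
  by_contra hh
  push Not at hh
  have : 8*L^2*bet L t ≤ 0 := mul_nonpos_of_nonneg_of_nonpos p! hh
  linarith

lemma pow32 {t h : ℝ} (hh : 0 < h) (ht : h ≤ t) :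
    h^2/(4*√t) ≤ (t+h)*√(t+h) - 2*(t*√t) + (t-h)*√(t-h) := by
  have hC : 0 < √t := sqp l!
  have c2 := sqs (l! : 0 ≤ t)
  have a2 := sqs (l! : 0 ≤ t+h)
  have b2 := sqs (l! : 0 ≤ t-h)
  have hB : 0 ≤ √(t-h) := Real.sqrt_nonneg _
  have hAC : √t ≤ √(t+h) := sqm l!
  have hBC : √(t-h) ≤ √t := sqm l!
  generalize √(t+h) = a, √(t-h) = b, √t = s at *
  have e : (t+h)*a - 2*(t*s) + (t-h)*b = (a-s)^2*(a+s/2) + (b-s)^2*(b+s/2) := by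
    have ht' : t = s^2 := c2.symm
    have hh' : h = a^2 - s^2 := l!
    have hb' : b^2 = 2*s^2 - a^2 := l!
    have : (a-s)^2*(a+s/2) + (b-s)^2*(b+s/2) = a*a^2 - 3/2*s*(a^2+b^2) + s^3 + b*b^2 := by ring
    rw [this, hb', ht', hh']; ring
  rw [e, dli p!]
  have k1 : h = (a-s)*(a+s) := by linarith only [a2,c2]
  have k2 : h = (s-b)*(s+b) := by linarith only [b2,c2]
  have k3 : a ≤ 3/2*s := by
    have : a^2 ≤ 2*s^2 := by linarith only [a2,c2,ht]
    nlinarith only [this, hC, hAC]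
  have m1 : (a+s)^2 ≤ 25/4*s^2 := by nlinarith only [k3,hC,hAC]
  have m2 : (s+b)^2 ≤ 4*s^2 := by nlinarith only [hB,hC,hBC]
  have n1 : h^2 = (a-s)^2*(a+s)^2 := by rw [k1]; ring
  have n2 : h^2 = (b-s)^2*(s+b)^2 := by rw [k2]; ring
  have p1 : 6*(a-s)^2*s^2 ≥ 24/25*h^2 := by linarith only [n1, mll m1 (sq_nonneg (a-s))]
  have p2 : 2*(b-s)^2*s^2 ≥ 1/2*h^2 := by linarith only [n2, mll m2 (sq_nonneg (b-s))]
  have p3 : (a-s)^2*(a+s/2)*(4*s) ≥ 6*(a-s)^2*s^2 := by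
    have : 0 ≤ (a-s)^2*s := p!
    linarith only [mll hAC this]
  have p4 : (b-s)^2*(b+s/2)*(4*s) ≥ 2*(b-s)^2*s^2 := by
    have : 0 ≤ (b-s)^2*s := p!
    linarith only [mul_nonneg this hB]
  linarith only [p1,p2,p3,p4,sq_nonneg h]

lemma bet_curv {L t h : ℝ} (hL : 1 ≤ L) (hh : 0 < h) (ht : h ≤ t) (hs : 8*L^2*h ≤ 1) :
    (t ≤ 1/(4*L^2) → bet L (t+h) - 2*bet L t + bet L (t-h) ≤ -(L/4*h^2/√t)) ∧
    (1/(4*L^2) < t → bet L (t+h) - 2*bet L t + bet L (t-h) ≤ 0) := by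
  constructor
  · intro h1
    have u1 : bet L (t+h) ≤ (t+h) - L*(t+h)*√(t+h) := by
      unfold bet; split_ifs with h2
      · rfl
      · push Not at h2
        have h3 := sqs (l! : 0 ≤ t+h)
        set r := L*√(t+h) with hr
        have r0 : 0 ≤ r := p!
        have e1 : r^2 = L^2*(t+h) := by rw [hr, mul_pow, h3]
        have e2 : 1/4 ≤ r^2 := by
          rw [e1]; rw [div_lt_iff₀ p!] at h2; linarith
        have e3 : r^2 ≤ 3/8 := by
          rw [e1]; rw [ldi p!] at h1; linarith
        rw [dli p!]
        have e : ((t+h) - L*(t+h)*√(t+h))*(8*L^2) = 8*(r^2 - r^3) := by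
          rw [hr]; have : √(t+h)^3 = (t+h)*√(t+h) := by rw [pow_succ, h3]
          rw [mul_pow, mul_pow, h3, this]; ring
        rw [e]
        have e4 : 1/2 ≤ r := by nlinarith only [e2,r0]
        have e5 : r ≤ 0.7 := by nlinarith only [e3,r0]
        nlinarith only [e4,e5,r0,mul_nonneg (sbn e4) (sbn e5), mul_nonneg r0 (mul_nonneg (sbn e4) (sbn e5))]
    have u2 : bet L t = t - L*t*√t := by unfold bet; rw [if_pos h1]
    have u3 : bet L (t-h) = (t-h) - L*(t-h)*√(t-h) := by unfold bet; rw [if_pos l!]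
    have := pow32 hh ht
    rw [u2, u3]
    have e : L/4*h^2/√t = L*(h^2/(4*√t)) := by
      field_simp
    rw [e]
    linarith only [u1, mll this (by linarith only [hL] : 0 ≤ L)]
  · intro h1
    have u2 : bet L t = 1/(8*L^2) := by unfold bet; rw [if_neg l!]
    have := (bet_facts hL (l! : 0 ≤ t+h)).2.2
    have := (bet_facts hL (l! : 0 ≤ t-h)).2.2
    linarith

lemma curvB {A τ h c L D Λ t w : ℝ} (hA : 1 ≤ A) (hτ : h^2 = 4*A*τ) (hL : 1 ≤ L) (hh : 0 < h)
    (ht : h ≤ t) (hs : 8*L^2*h ≤ 1) (hc : 0 < c) (hw : c*mu t ≤ w) (hD : 0 ≤ D)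
    (h1 : D ≤ √c*L/4) (h2 : 8*L^2*D ≤ Λ) :
    √w/(4*A)*(bet L (t+h) - 2*bet L t + bet L (t-h)) + τ*D ≤ τ*Λ*bet L t := by
  have ht0 : 0 < t := l!
  have hb := bet_pos hL ht0
  have hτ0 : 0 < τ := by
    have : 0 < A*τ := by nlinarith only [hτ, pow_pos hh 2]
    exact pos_of_mul_pos_right this l!
  have hL2 : 1 ≤ L^2 := by nlinarith only [hL]
  have hΛ : 0 ≤ Λ := le_trans p! h2
  rcases le_or_gt t (1/(4*L^2)) with h3 | h3
  · have k := (bet_curv hL hh ht hs).1 h3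
    have t1 : t ≤ 1 := h3.trans (by rw [div_le_one p!]; linarith)
    have e : mu t = t := min_eq_left t1
    rw [e] at hw
    have s1 : √c*√t ≤ √w := by rw [← Real.sqrt_mul hc.le]; exact sqm hw
    have st := sqp ht0
    have : √w/(4*A)*(bet L (t+h) - 2*bet L t + bet L (t-h)) ≤ -(τ*D) := by
      calc _ ≤ √w/(4*A)*(-(L/4*h^2/√t)) := by gcongr
        _ = -((√w/√t)*(L/4)*τ) := by rw [hτ]; field_simp
        _ ≤ -(√c*(L/4)*τ) := by
          gcongr; rwa [ldi st]
        _ ≤ _ := by nlinarith only [mlr h1 hτ0.le]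
    have : 0 ≤ τ*Λ*bet L t := p!
    linarith
  · have k := (bet_curv hL hh ht hs).2 h3
    have e : bet L t = 1/(8*L^2) := by unfold bet; rw [if_neg l!]
    have : √w/(4*A)*(bet L (t+h) - 2*bet L t + bet L (t-h)) ≤ 0 :=
      mul_nonpos_of_nonneg_of_nonpos p! k
    rw [e]
    have : τ*D ≤ τ*Λ*(1/(8*L^2)) := by
      rw [mul_assoc]; gcongr
      rw [mul_one_div, ldi p!]; linarith
    rw [e] at *
    linarith

/-- uniform bounds for the scheme -/
def Bd (W : ℕ → ℕ → ℝ) (τ X c M K ε h : ℝ) : Prop :=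
  ∀ n : ℕ, n*τ ≤ X → ∀ j : ℕ, c*mu (ε+j*h) ≤ W n j ∧ W n j ≤ M ∧ |qq W τ n j| ≤ K*mu (ε+j*h)

lemma pow_le_exp' {x : ℝ} (hx : 0 ≤ x) (n : ℕ) : (1+x)^n ≤ exp (n*x) := by
  rw [Real.exp_nat_mul]
  have := Real.add_one_le_exp x
  gcongr; linarith

theorem short_bd {cr Mo Kq F F' : ℝ} (hco : 0 < cr) (hM : 0 ≤ Mo) (hKq : 1 ≤ Kq) (hF : 0 ≤ F)
    (hF' : 0 ≤ F') : ∃ X > 0, X ≤ 1 ∧ ∃ c > 0, ∃ M K A h₀ : ℝ, 1 ≤ A ∧ 0 < h₀ ∧ M ≤ A^2 ∧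
    ∀ ε > 0, ∀ h > 0, h < h₀ → ∀ W f, Sch A (h^2/(4*A)) f W →
    (∀ j : ℕ, cr*mu (ε+j*h) ≤ W 0 j ∧ W 0 j ≤ Mo ∧ |qq W (h^2/(4*A)) 0 j| ≤ Kq*mu (ε+j*h)) →
    (∀ n : ℕ, n*(h^2/(4*A)) ≤ 1 → |f n| ≤ F ∧ |f (n+1) - f n| ≤ F'*(h^2/(4*A))) →
    Bd W (h^2/(4*A)) X c M K ε h := by
  set c := cr/2 with hc
  have hcp : 0 < c := p!
  set D := 2*F/c + 2*F' with hD
  have hDp : 0 ≤ D := p!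
  set L := 1 + 4*D/√c with hL
  have hL1 : 1 ≤ L := by have : 0 ≤ 4*D/√c := p!
                         linarith
  have hL2 : 1 ≤ L^2 := by nlinarith only [hL1]
  have hDL : D ≤ √c*L/4 := by
    have : 0 < √c := p!
    have e : √c*L/4 = √c/4 + D := by rw [hL]; field_simp
    rw [e]; linarith
  set Ko := 8*L^2*Kq with hKo
  have hK1 : 1 ≤ Ko := by nlinarith only [hKo, hL2, hKq]
  set Λ := 2*Ko/c + 8*L^2*D with hΛ
  have hΛp : 0 < Λ := p!
  clear_value c D L Ko Λ
  obtain ⟨X, hX0, hX1, hX2, hX3⟩ : ∃ X > 0, X ≤ 1 ∧ X*Λ ≤ 1/2 ∧ X*(2*Ko) ≤ min c 1 := by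
    refine ⟨min 1 (min (1/(2*Λ)) (min c 1/(2*Ko))), p!, min_le_left _ _, ?_, ?_⟩
    · calc _ ≤ 1/(2*Λ)*Λ := by gcongr; exact (min_le_right _ _).trans (min_le_left _ _)
        _ = _ := by field_simp
    · calc _ ≤ min c 1/(2*Ko)*(2*Ko) := by gcongr; exact (min_le_right _ _).trans (min_le_right _ _)
        _ = _ := by field_simp
  refine ⟨X, hX0, hX1, c, hcp, Mo+1, 2*Ko, Mo+2, 1/(8*L^2), l!, p!,
    by nlinarith only [hM], ?_⟩
  intro ε hε h hh hh0 W f S H0 Hf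
  set A := Mo+2 with hA
  have hA1 : 1 ≤ A := l!
  have hMA : Mo+1 ≤ A^2 := by nlinarith only [hM, hA]
  set τ := h^2/(4*A) with hτ
  have hτ0 : 0 < τ := p!
  have hhτ : h^2 = 4*A*τ := by rw [hτ]; field_simp
  clear_value A τ
  have hs : 8*L^2*h ≤ 1 := by
    rw [lt_div_iff₀ p!] at hh0; linarith
  set b : ℕ → ℝ := fun j => bet L (ε+j*h) with hb
  have tp : ∀ j : ℕ, 0 < ε + j*h := fun j => p!
  have bp : ∀ j, 0 < b j := fun j => bet_pos hL1 (tp j)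
  have bm : ∀ j, b j ≤ mu (ε+j*h) := fun j => (bet_facts hL1 (tp j).le).1
  have mb : ∀ j : ℕ, mu (ε+j*h) ≤ 8*L^2*b j := fun j => (bet_facts hL1 (tp j).le).2.1
  have m1 : ∀ j : ℕ, mu (ε+j*h) ≤ 1 := fun j => min_le_right _ _
  have pw : ∀ n : ℕ, n*τ ≤ X → (1+Λ*τ)^n ≤ 2 := by
    intro n hn
    refine (pow_le_exp' p! n).trans ?_
    have : (n:ℝ)*(Λ*τ) ≤ 1/2 := by
      calc _ = (n*τ)*Λ := by ring
        _ ≤ X*Λ := by gcongr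
        _ ≤ _ := hX2
    have h5 := Real.exp_bound_div_one_sub_of_interval (show (0:ℝ) ≤ 1/2 by norm_num) (by norm_num)
    calc _ ≤ exp (1/2) := Real.exp_le_exp.2 this
      _ ≤ 1/(1-1/2) := h5
      _ = 2 := by norm_num
  -- consequence of the second induction claim
  have cons : ∀ n : ℕ, n*τ ≤ X → (∀ j, |W n j - W 0 j| ≤ n*τ*(2*Ko)*b j) →
      ∀ j : ℕ, c*mu (ε+j*h) ≤ W n j ∧ W n j ≤ Mo+1 := by
    intro n hn hw j
    have h1 := abs_le.1 (hw j)
    have h2 : n*τ*(2*Ko)*b j ≤ min c 1 * mu (ε+j*h) := by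
      have := bm j; have := (bp j).le
      calc n*τ*(2*Ko)*b j ≤ X*(2*Ko)*b j := by gcongr
        _ ≤ _ := by gcongr
    have h3 : min c 1 * mu (ε+j*h) ≤ c*mu (ε+j*h) :=
      mlr (min_le_left _ _) (mu_pos (tp j)).le
    have h4 : min c 1 * mu (ε+j*h) ≤ 1 * 1 :=
      mul_le_mul (min_le_right _ _) (m1 j) (mu_pos (tp j)).le zero_le_one
    have h5 := H0 j
    have h6 : cr*mu (ε+j*h) = 2*(c*mu (ε+j*h)) := by rw [hc]; ring
    constructor <;> linarith
  have main : ∀ n : ℕ, n*τ ≤ X → (∀ j, |qq W τ n j| ≤ Ko*(1+Λ*τ)^n*b j) ∧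
      (∀ j, |W n j - W 0 j| ≤ n*τ*(2*Ko)*b j) := by
    intro n
    induction n with
    | zero =>
      intro _
      refine ⟨fun j => ?_, fun j => by simp⟩
      calc _ ≤ Kq*mu (ε+j*h) := (H0 j).2.2
        _ ≤ Kq*(8*L^2*b j) := by gcongr; exact mb j
        _ = _ := by rw [hKo]; ring
    | succ n ih =>
      intro hn
      push_cast at hn
      have hn' : n*τ ≤ X := l!
      obtain ⟨i1, i2⟩ := ih hn'
      have p2 := pw n hn'
      have p1 : 1 ≤ (1+Λ*τ)^n := one_le_pow₀ (by have : 0 ≤ Λ*τ := p!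
                                                 linarith)
      have i3 : ∀ j, |qq W τ n j| ≤ 2*Ko*b j := fun j => (i1 j).trans (by
        have := bp j
        have e : Ko*(1+Λ*τ)^n ≤ 2*Ko := by rw [mul_comm 2]; gcongr
        gcongr)
      have i4 : ∀ j, |W (n+1) j - W 0 j| ≤ (n+1)*τ*(2*Ko)*b j := fun j => by
        rw [S.Wq n j, show W n j + τ*qq W τ n j - W 0 j = (W n j - W 0 j) + τ*qq W τ n j by ring]
        refine (aal _ _).trans ?_
        rw [abs_mul, abp hτ0]
        have := mll (i3 j) hτ0.le
        linarith [i2 j]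
      have c1 := cons n hn' i2
      have c2 := cons (n+1) (by push_cast; linarith) (by push_cast; exact i4)
      refine ⟨fun j => ?_, by push_cast; exact i4⟩
      have K1 : 1 ≤ Ko*(1+Λ*τ)^n := one_le_mul_of_one_le_of_one_le hK1 p1
      rcases j with _ | j
      · rw [S.q0]; simp only [abs_zero]; have := bp 0; positivity
      · have hf := Hf n l!
        have st := S.stepB (n := n) (j := j) (b := b) (K := Ko*(1+Λ*τ)^n) (c := c) (R := 2*Ko)
          (Fz := 2*F) (F' := F') (Λ := 8*L^2*D) K1 hcp bp hF' i1
          (le_trans (by gcongr; exact bm (j+1)) (c1 (j+1)).1)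
          (lt_of_lt_of_le (mul_pos hcp (mu_pos (tp _))) (c2 (j+1)).1)
          ((c2 (j+1)).2.trans hMA)
          ((aal _ _).trans (by
            rw [abs_mul 2, abp (by norm_num : (0:ℝ)<2)]; linarith [i3 (j+1), hf.1])) hf.2
          (by
            have := curvB (t := ε+(j+1:ℕ)*h) (w := W (n+1) (j+1)) hA1 hhτ hL1 hh
              (by push_cast; nlinarith only [hε, hh, mul_nonneg (Nat.cast_nonneg (α := ℝ) j) hh.le]) hs hcp (c2 (j+1)).1 hDp hDL
              (le_refl (8*L^2*D))
            have e1 : ε+(j+1:ℕ)*h+h = ε+(j+2:ℕ)*h := by push_cast; ring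
            have e2 : ε+(j+1:ℕ)*h-h = ε+(j:ℕ)*h := by push_cast; ring
            rw [e1, e2] at this
            rw [← hD]; exact this)
        calc _ ≤ _ := st
          _ = _ := by rw [pow_succ, hΛ]; ring
  intro n hn j
  obtain ⟨h1, h2⟩ := main n hn
  refine ⟨(cons n hn h2 j).1, (cons n hn h2 j).2, (h1 j).trans ?_⟩
  have := pw n hn
  have := bm j; have := (bp j).le
  calc _ ≤ Ko*2*mu (ε+j*h) := by gcongr
    _ = _ := by ring

/-- abstract discrete heat inequality -/
structure Ht (q r : ℕ → ℕ → ℝ) (N0 : ℕ) (Ci τ : ℝ) : Prop where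
  hr : ∀ n < N0, ∀ j, 0 ≤ r n j ∧ r n j ≤ 1/4
  hq : ∀ n < N0, ∀ j, |q (n+1) (j+1) - (q n (j+1) + r n j*(q n (j+2) - 2*q n (j+1) + q n j))| ≤ Ci*τ
  q0 : ∀ n ≤ N0, q n 0 = 0

lemma Ht.neg {q r N0 Ci τ} (H : Ht q r N0 Ci τ) : Ht (fun n j => -q n j) r N0 Ci τ where
  hr := H.hr
  hq n hn j := by
    rw [← abs_neg]; convert H.hq n hn j using 2; ring
  q0 n hn := by simp [H.q0 n hn]

lemma sqrt_conc {s h : ℝ} (hh : 0 < h) (hs : h ≤ s) :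
    √(s+h) + √(s-h) - 2*√s ≤ -(h^2/(4*(s*√s))) := by
  have t0 : 0 < √s := sqp l!
  have t2 := sqs (l! : 0 ≤ s)
  have a2 := sqs (l! : 0 ≤ s+h)
  have b2 := sqs (l! : 0 ≤ s-h)
  have a0 : 0 < √(s+h) := sqp l!
  have b0 := Real.sqrt_nonneg (s-h)
  generalize √(s+h) = a, √(s-h) = b, √s = t at *
  have hab : a + b ≤ 2*t := by nlinarith only [t2,a2,b2,t0,sq_nonneg (a-b)]
  have e : a + b - 2*t = -(2*h^2/((a+b)*((a+t)*(t+b)))) := by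
    field_simp
    have e1 : (a-t)*(a+t) = h := by linarith only [a2,t2]
    have e2 : (t-b)*(t+b) = h := by linarith only [b2,t2]
    have e3 : (a-b)*(a+b) = 2*h := by linarith only [b2,a2]
    have : (a+b-2*t)*(a+t)*(t+b) = h*(b-a) := by
      calc _ = ((a-t)*(a+t))*(t+b) - ((t-b)*(t+b))*(a+t) := by ring
        _ = _ := by rw [e1,e2]; ring
    calc _ = (a+b)*((a+b-2*t)*(a+t)*(t+b)) := by ring
      _ = -(h*((a-b)*(a+b))) := by rw [this]; ring
      _ = _ := by rw [e3]; ring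
  rw [e]
  have d1 : (a+t)*(t+b) ≤ 4*t^2 := by nlinarith only [hab,t0,a0,b0,sq_nonneg (a-b)]
  have d2 : (a+b)*((a+t)*(t+b)) ≤ 2*t*(4*t^2) := by gcongr
  have : h^2/(4*(s*t)) = 2*h^2/(2*t*(4*t^2)) := by rw [← t2]; field_simp
  rw [this]
  gcongr

lemma mu_le_one (t : ℝ) : mu t ≤ 1 := min_le_right _ _
lemma mu_le (t : ℝ) : mu t ≤ t := min_le_left _ _

lemma Ht.space1 {q r N0 Ci τ} (H : Ht q r N0 Ci τ) {ε h c K δ N : ℝ} (hτ : 0 < τ) (hh : 0 < h) (hε : 0 < ε)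
    (hc : 0 < c) (hK : 0 ≤ K) (hC : 0 ≤ Ci)
    (hb : ∀ n ≤ N0, ∀ j : ℕ, |q n j| ≤ K*mu (ε+j*h))
    (hrl : ∀ n < N0, ∀ j : ℕ, √c*√(mu (ε+(j+1:ℕ)*h))*τ ≤ r n j*h^2)
    (hε' : K*ε ≤ δ) (hN : 2*K ≤ N) (hN' : 8*Ci ≤ N*√c)
    (h0 : ∀ k i : ℕ, q 0 (k+i) - q 0 k ≤ δ + N*√(i*h)) :
    ∀ n ≤ N0, ∀ k i : ℕ, q n (k+i) - q n k ≤ δ + N*√(i*h) := by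
  have δ0 : 0 ≤ δ := le_trans p! hε'
  have N0' : 0 ≤ N := l!
  intro n
  induction n with
  | zero => exact fun _ => h0
  | succ n ih =>
    intro hn k i
    have hn' : n < N0 := hn
    have ih := ih hn'.le
    rcases i with _ | i
    · simp [δ0]
    have ip : 0 < ((i+1:ℕ):ℝ) := p!
    rcases le_or_gt (((i+1:ℕ):ℝ)*h) 1 with s1 | s1
    swap
    · have b1 := (abs_le.1 ((hb (n+1) hn (k+(i+1))).trans (ml1 hK (mu_le_one _)))).2
      have b2 := (abs_le.1 ((hb (n+1) hn k).trans (ml1 hK (mu_le_one _)))).1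
      have : 1 ≤ √(((i+1:ℕ):ℝ)*h) := Real.one_le_sqrt.2 s1.le
      have := mul_le_mul hN this zero_le_one N0'
      linarith
    rcases k with _ | k
    · rw [H.q0 _ hn, zero_add, sub_zero]
      have b1 := (abs_le.1 (hb (n+1) hn (i+1))).2
      have : mu (ε+(i+1:ℕ)*h) ≤ ε+(i+1:ℕ)*h := mu_le _
      have s2 : ((i+1:ℕ):ℝ)*h ≤ √(((i+1:ℕ):ℝ)*h) := Real.le_sqrt_of_sq_le (by
        rw [sq]; exact mul_le_of_le_one_left p! s1)
      have m1 := mll this hK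
      have m2 := mll s2 hK
      have m3 := mlr (l! : K ≤ N) (Real.sqrt_nonneg (((i+1:ℕ):ℝ)*h))
      linarith
    · have hj := abs_le.1 (H.hq n hn' (k+1+i))
      have hk := abs_le.1 (H.hq n hn' k)
      have rj := H.hr n hn' (k+1+i)
      have rk := H.hr n hn' k
      have rl := hrl n hn' (k+1+i)
      have p1 := ih (k+1) (i+1)
      have p2 := ih (k+1) (i+2)
      have p3 := ih (k+1) i
      have p4 := ih (k+2) i
      have p5 := ih k (i+2)
      rw [show k+1+(i+1) = k+1+i+1 by ring] at p1 ⊢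
      rw [show k+1+(i+2) = k+1+i+2 by ring] at p2
      rw [show k+2+i = k+1+i+1 by ring] at p4
      rw [show k+(i+2) = k+1+i+1 by ring] at p5
      have hs : h ≤ ((i+1:ℕ):ℝ)*h := by push_cast; nlinarith only [mul_nonneg (Nat.cast_nonneg (α := ℝ) i) hh.le]
      have cc := sqrt_conc hh hs
      rw [show ((i+1:ℕ):ℝ)*h+h = ((i+2:ℕ):ℝ)*h by push_cast; ring,
        show ((i+1:ℕ):ℝ)*h-h = (i:ℝ)*h by push_cast; ring] at cc
      have mm : ((i+1:ℕ):ℝ)*h ≤ mu (ε+((k+1+i+1:ℕ):ℝ)*h) := by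
        refine le_min ?_ s1
        have : ((i+1:ℕ):ℝ)*h ≤ ((k+1+i+1:ℕ):ℝ)*h := by gcongr; omega
        linarith
      have sp : 0 < ((i+1:ℕ):ℝ)*h := p!
      have e1 := sqm mm
      generalize √(((i+2:ℕ):ℝ)*h) = f2, √((i:ℝ)*h) = f0, ((i+1:ℕ):ℝ)*h = s at *
      have sq : 0 < √s := sqp sp
      generalize √(mu (ε+((k+1+i+1:ℕ):ℝ)*h)) = m, r n (k+1+i) = R, r n k = R' at *
      -- gain
      have gain : (R+R')*(N*(f2+f0-2*√s)) ≤ -(2*Ci*τ) := by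
        have g0 : f2+f0-2*√s ≤ 0 := cc.trans (by simp; positivity)
        have g1 : (R+R')*(N*(f2+f0-2*√s)) ≤ R*(N*(f2+f0-2*√s)) := by
          have : R'*(N*(f2+f0-2*√s)) ≤ 0 :=
            mul_nonpos_of_nonneg_of_nonpos rk.1 (mul_nonpos_of_nonneg_of_nonpos N0' g0)
          linarith
        have g2 : √c*√s*τ ≤ R*h^2 := le_trans (by gcongr) rl
        calc _ ≤ _ := g1
          _ ≤ R*(N*(-(h^2/(4*(s*√s))))) := by have := rj.1; gcongr
          _ = -(N*(R*h^2)/(4*(s*√s))) := by field_simp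
          _ ≤ -(N*(√c*√s*τ)/(4*(s*√s))) := by gcongr
          _ = -(N*√c*τ/(4*s)) := by field_simp
          _ ≤ -(N*√c*τ/4) := by gcongr; linarith
          _ ≤ _ := by have := mlr hN' hτ.le; linarith
      have w1 := mll p1 (l! : 0 ≤ 1-2*R-2*R')
      have w2 := mll p2 rj.1
      have w3 := mll p3 rj.1
      have w4 := mll p4 rk.1
      have w5 := mll p5 rk.1
      rw [show k+1+i+1 = k+1+i+1 from rfl] at *
      linarith only [w1,w2,w3,w4,w5,gain,hj.2,hk.1]

lemma Ht.space {q r N0 Ci τ} (H : Ht q r N0 Ci τ) {ε h c K δ N : ℝ} (hτ : 0 < τ) (hh : 0 < h) (hε : 0 < ε)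
    (hc : 0 < c) (hK : 0 ≤ K) (hC : 0 ≤ Ci)
    (hb : ∀ n ≤ N0, ∀ j : ℕ, |q n j| ≤ K*mu (ε+j*h))
    (hrl : ∀ n < N0, ∀ j : ℕ, √c*√(mu (ε+(j+1:ℕ)*h))*τ ≤ r n j*h^2)
    (hε' : K*ε ≤ δ) (hN : 2*K ≤ N) (hN' : 8*Ci ≤ N*√c)
    (h0 : ∀ k i : ℕ, |q 0 (k+i) - q 0 k| ≤ δ + N*√(i*h)) :
    ∀ n ≤ N0, ∀ k i : ℕ, |q n (k+i) - q n k| ≤ δ + N*√(i*h) := by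
  intro n hn k i
  have h1 := H.space1 hτ hh hε hc hK hC hb hrl hε' hN hN' (fun k i => (abs_le.1 (h0 k i)).2) n hn k i
  have h2 := H.neg.space1 hτ hh hε hc hK hC (by simpa using hb) hrl hε' hN hN'
    (fun k i => by linarith [(abs_le.1 (h0 k i)).1]) n hn k i
  rw [abs_le]; constructor <;> linarith

lemma sq_absorb {δ N s : ℝ} (hδ : 0 < δ) (hN : 0 < N) (hs : 0 ≤ s) :
    N*√s ≤ δ + N*(N/δ)^3*s^2 := by
  rcases le_or_gt (N*√s) δ with h | h
  · have : 0 ≤ N*(N/δ)^3*s^2 := p!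
    linarith
  · have h1 : 1 ≤ (N/δ)*√s := by rw [div_mul_eq_mul_div, ldi hδ]; linarith
    have h2 : 1 ≤ ((N/δ)*√s)^3 := one_le_pow₀ h1
    have e : N*(N/δ)^3*s^2 = N*√s*((N/δ)*√s)^3 := by
      nth_rewrite 1 [← sqs hs]; ring
    rw [e]
    have := mll h2 (p! : 0 ≤ N*√s)
    linarith

lemma Ht.time1 {q r N0 Ci τ} (H : Ht q r N0 Ci τ) {A h δ N : ℝ} (hτ : 0 < τ) (hh : 0 < h)
    (hA : h^2 = 4*A*τ) (hδ : 0 < δ) (hN : 0 < N) (hC : 0 ≤ Ci)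
    (hs : ∀ n ≤ N0, ∀ k i : ℕ, |q n (k+i) - q n k| ≤ δ + N*√(i*h)) (n j : ℕ) :
    ∀ i, n+i ≤ N0 → ∀ k : ℕ,
      q (n+i) k ≤ q n j + 2*δ + N*(N/δ)^3*(((k:ℝ)-j)*h)^2 + i*(2*A*(N*(N/δ)^3)+Ci)*τ := by
  obtain ⟨N', hN'⟩ := exr (N*(N/δ)^3)
  have N0' : 0 < N' := by rw [hN']; positivity
  have A0 : 0 < A := by
    have : 0 < A*τ := by nlinarith only [hA, pow_pos hh 2]
    exact pos_of_mul_pos_left this hτ.le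
  rw [← hN']
  have base : n ≤ N0 → ∀ k : ℕ, q n k ≤ q n j + 2*δ + N'*(((k:ℝ)-j)*h)^2 := by
    intro hn k
    rcases le_total j k with hjk | hjk
    · obtain ⟨i, rfl⟩ := Nat.exists_eq_add_of_le hjk
      have h1 := (abs_le.1 (hs n hn j i)).2
      have h2 := sq_absorb hδ hN (p! : 0 ≤ (i:ℝ)*h)
      rw [← hN'] at h2
      rw [show (((j+i:ℕ):ℝ)-j)*h = i*h by push_cast; ring]
      linarith
    · obtain ⟨i, rfl⟩ := Nat.exists_eq_add_of_le hjk
      have h1 := (abs_le.1 (hs n hn k i)).1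
      have h2 := sq_absorb hδ hN (p! : 0 ≤ (i:ℝ)*h)
      rw [← hN'] at h2
      rw [show ((k:ℝ)-((k+i:ℕ):ℝ))*h = -(i*h) by push_cast; ring, neg_sq]
      linarith
  intro i
  induction i with
  | zero => intro hn k; have := base hn k; simp only [Nat.cast_zero, add_zero]; linarith
  | succ i ih =>
    intro hn k
    have hn' : n+i < N0 := by omega
    have ih := ih hn'.le
    rcases k with _ | k
    · rw [H.q0 _ hn, ← H.q0 n (by omega)]
      have := base (by omega) 0
      have : 0 ≤ ((i+1:ℕ):ℝ)*(2*A*N'+Ci)*τ := p!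
      linarith
    · have hk := (abs_le.1 (H.hq _ hn' k)).2
      have rk := H.hr _ hn' k
      have i0 := ih k
      have i1 := ih (k+1)
      have i2 := ih (k+2)
      rw [show n+(i+1) = n+i+1 by ring]
      generalize r (n+i) k = R at *
      have w0 := mll i0 rk.1
      have w1 := mll i1 (l! : 0 ≤ 1-2*R)
      have w2 := mll i2 rk.1
      have w3 : R*N'*h^2 ≤ 1/4*N'*(4*A*τ) := by rw [hA]; have := rk.2; gcongr
      push_cast at w0 w1 w2 w3 ⊢
      linarith only [w0,w1,w2,hk,w3]

lemma Ht.time {q r N0 Ci τ} (H : Ht q r N0 Ci τ) {A h δ N : ℝ} (hτ : 0 < τ) (hh : 0 < h)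
    (hA : h^2 = 4*A*τ) (hδ : 0 < δ) (hN : 0 < N) (hC : 0 ≤ Ci)
    (hs : ∀ n ≤ N0, ∀ k i : ℕ, |q n (k+i) - q n k| ≤ δ + N*√(i*h)) (n i j : ℕ) (hn : n+i ≤ N0) :
    |q (n+i) j - q n j| ≤ 2*δ + (2*A*(N*(N/δ)^3)+Ci)*(i*τ) := by
  have h1 := H.time1 hτ hh hA hδ hN hC hs n j i hn j
  have h2 := H.neg.time1 hτ hh hA hδ hN hC (by
    intro n hn k i
    rw [← abs_neg]; convert hs n hn k i using 2; ring) n j i hn j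
  rw [sub_self, zero_mul] at h1 h2
  rw [abs_le]; constructor <;> linarith only [h1, h2]

section
/-- context for the core estimates -/
structure Ctx (W : ℕ → ℕ → ℝ) (f : ℕ → ℝ) (A τ X c M K ε h F F' : ℝ) : Prop where
  S : Sch A τ f W
  B : Bd W τ X c M K ε h
  hM : M ≤ A^2
  hc : 0 < c
  hK : 1 ≤ K
  hε : 0 < ε
  hε1 : ε ≤ 1
  hh : 0 < h
  hh1 : h ≤ 1
  hτ : h^2 = 4*A*τ
  hF : 0 ≤ F
  hF' : 0 ≤ F'
  f1 : ∀ n : ℕ, n*τ ≤ X → |f n| ≤ F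
  f2 : ∀ n : ℕ, n*τ ≤ X → |f (n+1) - f n| ≤ F'*τ

variable {W : ℕ → ℕ → ℝ} {f : ℕ → ℝ} {A τ X c M K ε h F F' : ℝ}

lemma Ctx.tp (C : Ctx W f A τ X c M K ε h F F') (j : ℕ) : 0 < ε+j*h := by
  have := C.hε; have := C.hh; positivity

lemma Ctx.Wp (C : Ctx W f A τ X c M K ε h F F') {n : ℕ} (hn : n*τ ≤ X) (j : ℕ) : 0 < W n j :=
  lt_of_lt_of_le (mul_pos C.hc (mu_pos (C.tp j))) (C.B n hn j).1

lemma Ctx.heat (C : Ctx W f A τ X c M K ε h F F') {N0 : ℕ} (hN : N0*τ ≤ X) :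
    Ht (qq W τ) (fun n j => √(W (n+1) (j+1))/(4*A)) N0 (K*(K+2*F)/c+2*F') τ ∧
    ∀ n < N0, ∀ j : ℕ, √c*√(mu (ε+(j+1:ℕ)*h))*τ ≤ (fun n j => √(W (n+1) (j+1))/(4*A)) n j*h^2 := by
  have hA := C.S.hA
  have hτ := C.S.hτ
  have lt : ∀ n < N0, ((n+1:ℕ):ℝ)*τ ≤ X ∧ (n:ℝ)*τ ≤ X := fun n hn => by
    have h1 : ((n+1:ℕ):ℝ)*τ ≤ N0*τ := by gcongr; omega
    have h2 : (n:ℝ)*τ ≤ N0*τ := by gcongr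
    exact ⟨h1.trans hN, h2.trans hN⟩
  refine ⟨⟨fun n hn j => ⟨p!, ?_⟩, fun n hn j => ?_, fun n _ => C.S.q0 n⟩, fun n hn j => ?_⟩
  · rw [dli p!]
    have : √(W (n+1) (j+1)) ≤ A := Real.sqrt_le_iff.2 ⟨l!, ((C.B _ (lt n hn).1 _).2.1).trans C.hM⟩
    linarith
  · have p1 := C.Wp (lt n hn).2 (j+1)
    have p2 := C.Wp (lt n hn).1 (j+1)
    rw [C.S.qeq n j p1 p2]
    obtain ⟨b1, _, b3⟩ := C.B n (lt n hn).2 (j+1)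
    have m0 := mu_pos (C.tp (j+1))
    have m1 := mu_le_one (ε+(j+1:ℕ)*h)
    have a1 := sqp p1
    have a2 := sqp p2
    have s1 := sqs p1.le
    have ff := C.f1 n (lt n hn).2
    have ff' := C.f2 n (lt n hn).2
    have K0 := C.hK; have c0 := C.hc; have F0 := C.hF
    generalize √(W n (j+1)) = a, √(W (n+1) (j+1)) = a', qq W τ n (j+1) = Q, mu (ε+(j+1:ℕ)*h) = m at *
    have src : |Q*(Q+2*f n)/(a*(a'+a))| ≤ K*(K+2*F)/c := by
      rw [abs_div, abs_mul, abp (p! : 0 < a*(a'+a)), dli p!]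
      have h1 : c*m ≤ a*(a'+a) := by linarith only [b1,s1,mul_pos a1 a2]
      have h2 : |Q+2*f n| ≤ K+2*F := by
        refine (aal _ _).trans ?_
        rw [abs_mul 2, abp (by norm_num : (0:ℝ)<2)]
        have : K*m ≤ K := ml1 l! m1
        linarith
      calc |Q| * |Q+2*f n| ≤ (K*m)*(K+2*F) := by gcongr
        _ = K*(K+2*F)/c*(c*m) := by field_simp
        _ ≤ _ := by gcongr
    have e : ∀ x y : ℝ, Q + x + τ*y - 2*(f (n+1) - f n) - (Q + x) = τ*y - 2*(f (n+1)-f n) := fun x y => by ring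
    rw [e]
    refine (abs_sub _ _).trans ?_
    rw [abs_mul, abs_mul, abp hτ, abp (by norm_num : (0:ℝ)<2)]
    have := mll src hτ.le
    linarith
  · have b := (C.B _ (lt n hn).1 (j+1)).1
    have : √c*√(mu (ε+(j+1:ℕ)*h)) ≤ √(W (n+1) (j+1)) := by
      rw [← Real.sqrt_mul C.hc.le]; exact sqm b
    show _ ≤ √(W (n+1) (j+1))/(4*A)*h^2
    rw [C.hτ, show √(W (n+1) (j+1))/(4*A)*(4*A*τ) = √(W (n+1) (j+1))*τ by field_simp]
    gcongr

/-- moduli of continuity of the discrete `q` -/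
theorem Ctx.modQ {A X c K F F' δ No : ℝ} (hA : 1 ≤ A) (hc : 0 < c) (hK : 1 ≤ K) (hF : 0 ≤ F)
    (hF' : 0 ≤ F') (hδ : 0 < δ) : ∃ N > 0, ∀ W f τ M ε h, Ctx W f A τ X c M K ε h F F' →
    K*ε ≤ δ → (∀ k i : ℕ, |qq W τ 0 (k+i) - qq W τ 0 k| ≤ δ + No*√(i*h)) →
    ∀ n : ℕ, n*τ ≤ X → ∀ j i : ℕ, |qq W τ n (j+i) - qq W τ n j| ≤ δ + N*√(i*h) ∧
      ((n+i:ℕ)*τ ≤ X → |qq W τ (n+i) j - qq W τ n j| ≤ 2*δ + N*(i*τ)) := by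
  obtain ⟨Ci, hCi⟩ := exr (K*(K+2*F)/c+2*F')
  have C0 : 0 ≤ Ci := by rw [hCi]; positivity
  obtain ⟨N, hN⟩ := exr (max (max No (2*K)) (8*Ci/√c))
  have sc : 0 < √c := sqp hc
  have n1 : No ≤ N := by rw [hN]; exact (le_max_left _ _).trans (le_max_left _ _)
  have n2 : 2*K ≤ N := by rw [hN]; exact (le_max_right _ _).trans (le_max_left _ _)
  have n3 : 8*Ci ≤ N*√c := by rw [← dli sc, hN]; exact le_max_right _ _
  have N0 : 0 < N := l!
  obtain ⟨N2, hN2⟩ := exr (2*A*(N*(N/δ)^3)+Ci)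
  have N20 : 0 ≤ N2 := by rw [hN2]; positivity
  refine ⟨N + N2, p!, ?_⟩
  intro W f τ M ε h C hε h0 n hn j i
  have hτ := C.S.hτ
  have hh := C.hh
  have key : ∀ N1 : ℕ, N1*τ ≤ X → ∀ n ≤ N1, ∀ k i : ℕ, |qq W τ n (k+i) - qq W τ n k| ≤ δ + N*√(i*h) := by
    intro N1 hN1
    obtain ⟨H, hr⟩ := C.heat hN1
    rw [← hCi] at H
    refine H.space hτ hh C.hε hc l! C0 (fun n hn j => (C.B n ?_ j).2.2) hr hε n2 n3 ?_
    · refine le_trans ?_ hN1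
      gcongr
    · intro k i
      refine (h0 k i).trans ?_
      gcongr
  refine ⟨(key n hn n le_rfl j i).trans ?_, fun hni => ?_⟩
  · have : 0 ≤ N2*√(i*h) := p!
    linarith
  · obtain ⟨H, -⟩ := C.heat hni
    rw [← hCi] at H
    have := H.time hτ hh C.hτ hδ N0 C0 (key _ hni) n i j le_rfl
    rw [← hN2] at this
    have : 0 ≤ N*(i*τ) := p!
    linarith

/-- behaviour at infinity -/
theorem Ctx.inf (C : Ctx W f A τ X c M K ε h F F') {U2 δ D : ℝ} (hX : 0 ≤ X) (hδ : 0 ≤ δ)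
    (hD : (M + |U2| + 2*(F*X))*exp 1 ≤ D)
    (h0 : ∀ j : ℕ, |W 0 j - U2| ≤ δ + D*exp (-(ε+j*h))) :
    ∀ n : ℕ, n*τ ≤ X → ∀ j : ℕ, |W n j - U2 + 2*(τ*∑ i ∈ Finset.range n, f i)|
      ≤ δ + D*(1+2*A*τ)^n*exp (-(ε+j*h)) := by
  have hA := C.S.hA
  have hτ := C.S.hτ
  have F0 := C.hF
  have M0 : 0 < M := (C.Wp (n := 0) (by simpa using hX) 0).trans_le (C.B 0 (by simpa using hX) 0).2.1
  have D0 : 0 ≤ D := le_trans p! hD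
  have sm : ∀ n : ℕ, n*τ ≤ X → |τ*∑ i ∈ Finset.range n, f i| ≤ F*X := by
    intro n hn
    have h1 : |∑ i ∈ Finset.range n, f i| ≤ n*F := by
      refine (Finset.abs_sum_le_sum_abs _ _).trans ?_
      refine (Finset.sum_le_card_nsmul _ _ F ?_).trans (by simp)
      intro i hi
      refine C.f1 i (le_trans ?_ hn)
      have := Finset.mem_range.1 hi
      gcongr
    rw [abs_mul, abp hτ]
    calc τ * |∑ i ∈ Finset.range n, f i| ≤ τ*(n*F) := by gcongr
      _ = F*(n*τ) := by ring
      _ ≤ _ := by gcongr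
  intro n
  induction n with
  | zero => intro _ j; simpa using h0 j
  | succ n ih =>
    intro hn j
    have hn' : n*τ ≤ X := by push_cast at hn; linarith
    have ih := ih hn'
    have P1 : 1 ≤ (1+2*A*τ)^(n+1) := one_le_pow₀ (by have : 0 ≤ 2*A*τ := p!
                                                     linarith)
    rcases j with _ | j
    · have b := (C.B (n+1) hn 0)
      have w := C.Wp hn 0
      have e1 : exp (-1) ≤ exp (-(ε+(0:ℕ)*h)) := Real.exp_le_exp.2 (by simpa using C.hε1)
      have e2 : M + |U2| + 2*(F*X) ≤ D*exp (-1) := by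
        rw [Real.exp_neg, ← div_eq_mul_inv, ldi (Real.exp_pos _)]; exact hD
      have e3 : D*exp (-1) ≤ D*(1+2*A*τ)^(n+1)*exp (-(ε+(0:ℕ)*h)) := by
        gcongr; exact le_mul_of_one_le_right D0 P1
      have e4 := abs_le.1 (sm _ hn)
      have e5 := abs_le.1 (le_refl |U2|)
      rw [abs_le]; constructor <;> linarith
    · have w := C.Wp hn' (j+1)
      have i0 := ih j
      have i1 := ih (j+1)
      have i2 := ih (j+2)
      have hr : √(W n (j+1)) ≤ A := Real.sqrt_le_iff.2 ⟨l!, ((C.B _ hn' _).2.1).trans C.hM⟩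
      have r0 : 0 ≤ √(W n (j+1))/(4*A) := p!
      have r1 : √(W n (j+1))/(4*A) ≤ 1/4 := by rw [dli p!]; linarith
      rw [C.S.s n j, Finset.sum_range_succ]
      generalize √(W n (j+1))/(4*A) = r, ∑ i ∈ Finset.range n, f i = s at *
      have E0 : exp (-(ε+j*h)) = exp (-(ε+(j+1:ℕ)*h))*exp h := by
        rw [← Real.exp_add]; congr 1; push_cast; ring
      have E2 : exp (-(ε+(j+2:ℕ)*h)) = exp (-(ε+(j+1:ℕ)*h))*exp (-h) := by
        rw [← Real.exp_add]; congr 1; push_cast; ring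
      have hh := C.hh; have hh1 := C.hh1
      have x1 := (abs_le.1 (Real.abs_exp_sub_one_sub_id_le (x := h) (by rw [abp hh]; exact hh1))).2
      have x2 := (abs_le.1 (Real.abs_exp_sub_one_sub_id_le (x := -h) (by rw [abs_neg, abp hh]; exact hh1))).2
      rw [E0] at i0
      rw [E2] at i2
      have Ep := Real.exp_pos (-(ε+(j+1:ℕ)*h))
      generalize exp (-(ε+(j+1:ℕ)*h)) = E at *
      have PP : 0 ≤ D*(1+2*A*τ)^n := p!
      rw [pow_succ]
      rw [show D*((1+2*A*τ)^n*(1+2*A*τ))*E = D*(1+2*A*τ)^n*(1+2*A*τ)*E by ring]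
      generalize D*(1+2*A*τ)^n = P at *
      have e : W n (j+1) + r*(W n (j+2) - 2*W n (j+1) + W n j) - 2*τ*f n - U2 + 2*(τ*(s+f n))
        = (1-2*r)*(W n (j+1) - U2 + 2*(τ*s)) + r*(W n (j+2) - U2 + 2*(τ*s)) + r*(W n j - U2 + 2*(τ*s)) := by ring
      rw [e]
      refine (abs_add_three _ _ _).trans ?_
      rw [abs_mul, abs_mul r, abs_mul r, abn r0, abn (l! : 0 ≤ 1-2*r)]
      have w0 := mll i0 r0
      have w1 := mll i1 (l! : 0 ≤ 1-2*r)
      have w2 := mll i2 r0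
      have w3 : r*(P*E)*(exp h + exp (-h) - 2 - 2*h^2) ≤ 0 :=
        mul_nonpos_of_nonneg_of_nonpos p! l!
      have w4 : r*(P*E)*(2*h^2) ≤ 1/4*(P*E)*(2*(4*A*τ)) := by rw [C.hτ]; gcongr
      linarith only [w0,w1,w2,w3,w4]

/-- discrete `ψ`-derivative -/
noncomputable def zz (W : ℕ → ℕ → ℝ) (h : ℝ) (n j : ℕ) : ℝ := (W n (j+1) - W n j)/h

noncomputable def Phi (t : ℝ) : ℝ := 2*√t + t

lemma Ctx.zstep (C : Ctx W f A τ X c M K ε h F F') {n : ℕ} (hn : n*τ ≤ X) (j : ℕ) :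
    zz W h n (j+1) - zz W h n j = h*((qq W τ n (j+1) + 2*f n)/√(W n (j+1))) := by
  have := C.S.lap n j (C.Wp hn _)
  have hh := C.hh.ne'
  rw [← C.hτ] at this
  unfold zz
  rw [← sub_div, div_eq_iff hh]
  linear_combination this

lemma mu_sqrt {t : ℝ} (ht : 0 < t) : 1/√(mu t) ≤ 1/√t + 1 := by
  have := sqp ht
  unfold mu
  rcases le_total t 1 with h | h
  · rw [min_eq_left h]; linarith
  · rw [min_eq_right h]; simp

lemma Ctx.zmod1 (C : Ctx W f A τ X c M K ε h F F') {n : ℕ} (hn : n*τ ≤ X) (j : ℕ) :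
    |zz W h n (j+1) - zz W h n j| ≤ (K+2*F)/√c*(Phi (ε+(j+1:ℕ)*h) - Phi (ε+j*h)) := by
  have hh := C.hh
  have hc := C.hc
  have F0 := C.hF
  have K0 := C.hK
  have tp := C.tp (j+1)
  have tp0 := C.tp j
  obtain ⟨b1, -, b3⟩ := C.B n hn (j+1)
  have q1 : |qq W τ n (j+1) + 2*f n| ≤ K+2*F := by
    refine (aal _ _).trans ?_
    rw [abs_mul 2, abp (by norm_num : (0:ℝ)<2)]
    have := ml1 (l! : 0 ≤ K) (mu_le_one (ε+(j+1:ℕ)*h))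
    linarith [C.f1 n hn]
  have s1 : √c*√(mu (ε+(j+1:ℕ)*h)) ≤ √(W n (j+1)) := by
    rw [← Real.sqrt_mul hc.le]; exact sqm b1
  have sm := sqp (mu_pos tp)
  have sc := sqp hc
  rw [C.zstep hn, abs_mul, abp hh, abs_div, abn (Real.sqrt_nonneg _)]
  calc _ ≤ h*((K+2*F)/(√c*√(mu (ε+(j+1:ℕ)*h)))) := by gcongr
    _ = (K+2*F)/√c*(h*(1/√(mu (ε+(j+1:ℕ)*h)))) := by field_simp
    _ ≤ (K+2*F)/√c*(h*(1/√(ε+(j+1:ℕ)*h) + 1)) := by gcongr; exact mu_sqrt tp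
    _ ≤ _ := by
      gcongr
      have e : ε+(j+1:ℕ)*h = ε+j*h + h := by push_cast; ring
      unfold Phi
      have a2 := sqs tp.le
      have b2 := sqs tp0.le
      have a0 := sqp tp
      have le : √(ε+j*h) ≤ √(ε+(j+1:ℕ)*h) := sqm l!
      have : h*(1/√(ε+(j+1:ℕ)*h)) ≤ 2*√(ε+(j+1:ℕ)*h) - 2*√(ε+j*h) := by
        rw [mul_one_div, dli a0]
        rw [e] at *
        generalize √(ε+j*h+h) = a, √(ε+j*h) = b at *
        nlinarith only [a2,b2,a0,le,sq_nonneg (a-b)]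
      linarith

lemma Ctx.zmod (C : Ctx W f A τ X c M K ε h F F') {n : ℕ} (hn : n*τ ≤ X) (j i : ℕ) :
    |zz W h n (j+i) - zz W h n j| ≤ (K+2*F)/√c*(Phi (ε+(j+i:ℕ)*h) - Phi (ε+j*h)) := by
  induction i with
  | zero => simp
  | succ i ih =>
    have := C.zmod1 hn (j+i)
    rw [show j+(i+1) = j+i+1 by ring]
    calc _ = |(zz W h n (j+i+1) - zz W h n (j+i)) + (zz W h n (j+i) - zz W h n j)| := by ring_nf
      _ ≤ _ := aal _ _
      _ ≤ _ := l!

lemma Ctx.zbd (C : Ctx W f A τ X c M K ε h F F') {n : ℕ} (hn : n*τ ≤ X) (j : ℕ) :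
    |zz W h n j| ≤ M + 5*((K+2*F)/√c) := by
  have hh := C.hh
  have F0 := C.hF
  have K0 := C.hK
  have sc := sqp C.hc
  obtain ⟨D, hD⟩ := exr ((K+2*F)/√c)
  have D0 : 0 ≤ D := by rw [hD]; positivity
  obtain ⟨m, hm⟩ := exr (⌈1/h⌉₊)
  have m1 : 1 ≤ m*h := by rw [← dli hh, hm]; exact Nat.le_ceil _
  have m2 : m*h ≤ 2 := by
    have := Nat.ceil_lt_add_one (p! : 0 ≤ 1/h)
    rw [← hm] at this
    have := mlr this.le hh.le
    rw [add_mul, div_mul_cancel₀ _ hh.ne'] at this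
    linarith [C.hh1]
  have sm : ∑ i ∈ Finset.range m, zz W h n (j+i)*h = W n (j+m) - W n j := by
    refine Eq.trans ?_ (Finset.sum_range_sub (fun i => W n (j+i)) m)
    refine Finset.sum_congr rfl fun i _ => ?_
    unfold zz; rw [div_mul_cancel₀ _ hh.ne']; rfl
  have dif : |∑ i ∈ Finset.range m, (zz W h n (j+i) - zz W h n j)*h| ≤ m*(5*D*h) := by
    refine (Finset.abs_sum_le_sum_abs _ _).trans ?_
    refine (Finset.sum_le_card_nsmul _ _ (5*D*h) ?_).trans (by simp)
    intro i hi
    rw [abs_mul, abp hh]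
    gcongr
    have z1 := C.zmod hn j i
    rw [← hD] at z1
    refine z1.trans ?_
    rw [mul_comm 5]
    gcongr
    have tp := C.tp j
    have ih : (i:ℝ)*h ≤ 2 := le_trans (by have := Finset.mem_range.1 hi; gcongr) m2
    have e : ε+(j+i:ℕ)*h = ε+j*h+i*h := by push_cast; ring
    rw [e]; unfold Phi
    have s1 : √(ε+j*h+i*h) ≤ √(ε+j*h) + √(i*h) := by
      rw [Real.sqrt_le_iff]
      refine ⟨p!, ?_⟩
      have := sqs tp.le
      have := sqs (p! : 0 ≤ (i:ℝ)*h)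
      have : 0 ≤ √(ε+j*h)*√(i*h) := p!
      linarith
    have s2 : √(i*h) ≤ 3/2 := Real.sqrt_le_iff.2 ⟨by norm_num, l!⟩
    linarith
  have b1 := C.B n hn (j+m)
  have b2 := C.B n hn j
  have p1 := C.Wp hn (j+m)
  have p2 := C.Wp hn j
  have e : ∑ i ∈ Finset.range m, (zz W h n (j+i) - zz W h n j)*h = W n (j+m) - W n j - m*h*zz W h n j := by
    rw [← sm]; simp only [sub_mul, Finset.sum_sub_distrib]; simp; ring
  rw [e] at dif
  rw [← hD]
  have hd := abs_le.1 dif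
  have M0 : 0 < M := p2.trans_le b2.2.1
  generalize zz W h n j = z at *
  have k1 : (m*h)*(z - 5*D) ≤ M := l!
  have k2 : (m*h)*(-z - 5*D) ≤ M := l!
  have gen : ∀ y, (m*h)*y ≤ M → y ≤ M := fun y hy => by
    by_contra hc
    push Not at hc
    have := mlr m1 (l! : 0 ≤ y)
    linarith
  rw [abs_le]; constructor <;> linarith [gen _ k1, gen _ k2]
end

lemma hj1 {h : ℝ} (hh : 0 < h) (j : ℕ) : h ≤ (j+1:ℕ)*h := by
  push_cast; nlinarith only [mul_nonneg (Nat.cast_nonneg (α := ℝ) j) hh.le]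

noncomputable def Ts (t : ℝ) : ℝ := Real.sin (min t (Real.pi/2))

lemma Ts_le {t : ℝ} (h : 0 ≤ t) : Ts t ≤ mu t ∧ mu t/2 ≤ Ts t := by
  have p1 := Real.pi_gt_three
  have p2 := Real.pi_le_four
  have m0 : 0 ≤ min t (Real.pi/2) := le_min h p!
  refine ⟨le_min ?_ (Real.sin_le_one _), ?_⟩
  · exact (Real.sin_le m0).trans (min_le_left _ _)
  · have := Real.mul_le_sin m0 (min_le_right _ _)
    refine le_trans ?_ this
    have h2 : 1/2 ≤ 2/Real.pi := by rw [div_le_div_iff₀ (by norm_num) p!]; linarith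
    have : mu t ≤ min t (Real.pi/2) := min_le_min_left _ l!
    calc mu t/2 = 1/2*mu t := by ring
      _ ≤ _ := by have : 0 ≤ mu t := le_min h zero_le_one
                  gcongr

lemma Ts_curv {t h : ℝ} (hh : 0 < h) (ht : h ≤ t) (h1 : h ≤ 1) : -(h^2*Ts t) ≤ Ts (t+h) - 2*Ts t + Ts (t-h) := by
  have p1 := Real.pi_gt_three
  unfold Ts
  rcases le_or_gt t (Real.pi/2) with h2 | h2
  · rw [min_eq_left h2, min_eq_left (l! : t-h ≤ Real.pi/2)]
    have h3 : Real.sin (t+h) ≤ Real.sin (min (t+h) (Real.pi/2)) := by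
      rcases le_total (t+h) (Real.pi/2) with h4 | h4
      · rw [min_eq_left h4]
      · rw [min_eq_right h4, Real.sin_pi_div_two]; exact Real.sin_le_one _
    have h5 := Real.one_sub_sq_div_two_le_cos (x := h)
    have h6 := Real.sin_nonneg_of_nonneg_of_le_pi (l! : 0 ≤ t) l!
    rw [Real.sin_sub]
    rw [Real.sin_add] at h3
    nlinarith only [mll h5 h6, h3]
  · rw [min_eq_right h2.le, min_eq_right (l! : Real.pi/2 ≤ t+h), Real.sin_pi_div_two]
    have : 1 - h^2/2 ≤ Real.sin (min (t-h) (Real.pi/2)) := by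
      rcases le_total (t-h) (Real.pi/2) with h4 | h4
      · rw [min_eq_left h4, ← Real.cos_pi_div_two_sub]
        refine le_trans ?_ (Real.one_sub_sq_div_two_le_cos (x := _))
        nlinarith only [h4, h2, hh]
      · rw [min_eq_right h4, Real.sin_pi_div_two]; nlinarith only [hh]
    nlinarith only [this, hh]

/-- basic global bounds -/
structure GB (W : ℕ → ℕ → ℝ) (f : ℕ → ℝ) (A τ h X w0 c M F F' : ℝ) : Prop where
  S : Sch A τ f W
  hτ : h^2 = 4*A*τ
  hh : 0 < h
  hh1 : 8*h ≤ 1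
  w0p : 0 < w0
  b0 : ∀ n, W n 0 = w0
  c0 : 0 < c
  lo : ∀ n : ℕ, n*τ ≤ X → ∀ j : ℕ, w0 + c*mu (j*h) ≤ W n j
  hi : ∀ n : ℕ, n*τ ≤ X → ∀ j : ℕ, W n j ≤ M
  hM : M ≤ A^2
  F0 : 0 ≤ F
  F0' : 0 ≤ F'
  fn : ∀ n : ℕ, n*τ ≤ X → f n ≤ 0
  f1 : ∀ n : ℕ, n*τ ≤ X → -F ≤ f n
  f2 : ∀ n : ℕ, n*τ ≤ X → |f (n+1) - f n| ≤ F'*τ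

section
variable {W : ℕ → ℕ → ℝ} {f : ℕ → ℝ} {A τ h X w0 c M F F' : ℝ}

theorem mk_GB {m Mo : ℝ} (S : Sch A τ f W) (hτ : h^2 = 4*A*τ) (hh : 0 < h) (hh1 : 8*h ≤ 1) (w0p : 0 < w0)
    (b0 : W 0 0 = w0) (m0 : 0 < m) (hm : ∀ j : ℕ, w0 + m*mu (j*h) ≤ W 0 j) (hM : ∀ j, W 0 j ≤ Mo)
    (hMA : Mo + 2*F*X ≤ A^2) (F0 : 0 ≤ F) (F0' : 0 ≤ F') (hAτ : 2*(A*τ) ≤ 1)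
    (fn : ∀ n : ℕ, n*τ ≤ X → f n ≤ 0) (f1 : ∀ n : ℕ, n*τ ≤ X → -F ≤ f n)
    (f2 : ∀ n : ℕ, n*τ ≤ X → |f (n+1) - f n| ≤ F'*τ) :
    GB W f A τ h X w0 (m*exp (-(2*A*X))/2) (Mo+2*F*X) F F' := by
  have hA := S.hA
  have tp := S.hτ
  have T0 : ∀ j : ℕ, 0 ≤ Ts (j*h) := fun j => by
    have := (Ts_le (t := j*h) p!).2
    have : 0 ≤ mu (j*h) := le_min p! zero_le_one
    linarith
  have b0' : ∀ n, W n 0 = w0 := fun n => by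
    induction n with
    | zero => exact b0
    | succ n ih => rw [S.b, ih]
  have main : ∀ n : ℕ, n*τ ≤ X → ∀ j : ℕ, w0 + m*exp (-(2*A*(n*τ)))*Ts (j*h) ≤ W n j ∧ W n j ≤ Mo + 2*F*(n*τ) := by
    intro n
    induction n with
    | zero =>
      intro _ j
      refine ⟨?_, by simpa using hM j⟩
      refine le_trans ?_ (hm j)
      have := (Ts_le (t := j*h) p!).1
      simp only [Nat.cast_zero, zero_mul, mul_zero, neg_zero, Real.exp_zero, mul_one]
      gcongr
    | succ n ih =>
      intro hn
      push_cast at hn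
      have hn' : n*τ ≤ X := l!
      have ih := ih hn'
      intro j
      cases j with
      | zero =>
        have := hM 0
        have := b0' (n+1)
        refine ⟨?_, ?_⟩
        · rw [this]; simp [Ts, min_eq_left (p! : (0:ℝ) ≤ Real.pi/2)]
        · rw [this, ← b0]; have : 0 ≤ 2*F*((n+1:ℕ)*τ) := p!
          linarith
      | succ j =>
        obtain ⟨l0, u0⟩ := ih j
        obtain ⟨l1, u1⟩ := ih (j+1)
        obtain ⟨l2, u2⟩ := ih (j+2)
        have cv := Ts_curv (t := (j+1:ℕ)*h) hh (hj1 hh j) l!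
        rw [show ((j+1:ℕ):ℝ)*h+h = (j+2:ℕ)*h by push_cast; ring,
          show ((j+1:ℕ):ℝ)*h-h = (j:ℕ)*h by push_cast; ring] at cv
        have t1 := T0 (j+1)
        have hW : W n (j+1) ≤ A^2 := u1.trans (le_trans (by gcongr) hMA)
        have sa : √(W n (j+1)) ≤ A := Real.sqrt_le_iff.2 ⟨l!, hW⟩
        rw [S.s]
        obtain ⟨r, hr⟩ := exr (√(W n (j+1))/(4*A))
        have r0 : 0 ≤ r := by rw [hr]; positivity
        have r1 : r ≤ 1/4 := by rw [hr, dli p!]; linarith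
        rw [← hr]
        have fn := fn n hn'
        have f1 := f1 n hn'
        have ex : exp (-(2*A*((n+1:ℕ)*τ))) ≤ exp (-(2*A*(n*τ)))*(1-A*τ) := by
          rw [show -(2*A*((n+1:ℕ)*τ)) = -(2*A*(n*τ)) + -(2*(A*τ)) by push_cast; ring, Real.exp_add]
          gcongr
          rw [Real.exp_neg]
          have h1 := Real.add_one_le_exp (2*(A*τ))
          have h2 : 0 < A*τ := p!
          rw [inv_le_comm₀ p! l!]
          refine le_trans ?_ h1
          rw [inv_le_iff_one_le_mul₀ l!]
          nlinarith only [h2, hAτ]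
        have eg : 0 < exp (-(2*A*(n*τ))) := Real.exp_pos _
        push_cast
        push_cast at ex
        generalize exp (-(2*A*((n+1)*τ))) = e', exp (-(2*A*(n*τ))) = e at *
        push_cast at *
        generalize Ts ((j:ℝ)*h) = T0, Ts (((j:ℝ)+1)*h) = T1, Ts (((j:ℝ)+2)*h) = T2 at *
        constructor
        · have k1 := mll l0 r0
          have k2 := mll l2 r0
          have k3 := mll l1 (l! : 0 ≤ 1-2*r)
          have k4 := mll cv (p! : 0 ≤ m*e*r)
          have k5 : m*e'*T1 ≤ m*(e*(1-A*τ))*T1 := by gcongr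
          have k6 : r*h^2 ≤ A*τ := by rw [hτ]; nlinarith only [r1, mul_pos (l! : 0 < A) tp]
          have k7 := mlr k6 (p! : 0 ≤ m*e*T1)
          have k8 := mul_nonneg tp.le (neg_nonneg.2 fn)
          linarith
        · have k1 := mll u0 r0
          have k2 := mll u2 r0
          have k3 := mll u1 (l! : 0 ≤ 1-2*r)
          have k8 := mll f1 tp.le
          linarith
  refine ⟨S, hτ, hh, hh1, w0p, b0', p!, fun n hn j => ?_, fun n hn j => ?_, hMA, F0, F0', fn, f1, f2⟩
  · refine le_trans ?_ (main n hn j).1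
    have := (Ts_le (t := j*h) p!).2
    calc w0 + m*exp (-(2*A*X))/2*mu (j*h) = w0 + m*exp (-(2*A*X))*(mu (j*h)/2) := by ring
      _ ≤ _ := by
        have h0 := T0 j
        have h2 : 0 ≤ mu (j*h) := le_min p! zero_le_one
        have h3 : 0 ≤ mu (j*h)/2 := l!
        gcongr
  · refine (main n hn j).2.trans ?_
    gcongr

namespace GB
variable (C : GB W f A τ h X w0 c M F F')
include C

lemma muh (j : ℕ) : 0 ≤ mu (j*h) := by have := C.hh; exact le_min p! zero_le_one

lemma low {n : ℕ} (hn : n*τ ≤ X) (j : ℕ) : w0 ≤ W n j := by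
  have := C.lo n hn j
  have := mul_nonneg C.c0.le (C.muh j)
  linarith

lemma wp {n : ℕ} (hn : n*τ ≤ X) (j : ℕ) : 0 < W n j := C.w0p.trans_le (C.low hn j)

lemma sA {n : ℕ} (hn : n*τ ≤ X) (j : ℕ) : √(W n j) ≤ A :=
  Real.sqrt_le_iff.2 ⟨by linarith [C.S.hA], (C.hi n hn j).trans C.hM⟩

lemma r4 {n : ℕ} (hn : n*τ ≤ X) (j : ℕ) : 0 ≤ √(W n j)/(4*A) ∧ √(W n j)/(4*A) ≤ 1/4 := by
  have := C.S.hA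
  refine ⟨p!, ?_⟩
  rw [dli p!]; linarith [C.sA hn j]

lemma dw (n j : ℕ) : W n (j+1) = W n j + h*zz W h n j := by
  have := C.hh.ne'
  unfold zz; field_simp; ring

lemma zs (n j : ℕ) : zz W h (n+1) (j+1) = zz W h n (j+1) + √(W n (j+2))/(4*A)*(zz W h n (j+2) - zz W h n (j+1))
    - √(W n (j+1))/(4*A)*(zz W h n (j+1) - zz W h n j) := by
  have := C.hh.ne'
  have := C.S.hA
  unfold zz; rw [C.S.s n (j+1), C.S.s n j]; field_simp; ring

lemma zq {n : ℕ} (hn : n*τ ≤ X) (j : ℕ) :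
    zz W h n (j+1) - zz W h n j = h*((qq W τ n (j+1) + 2*f n)/√(W n (j+1))) := by
  have := C.S.lap n j (C.wp hn _)
  have hh := C.hh.ne'
  rw [← C.hτ] at this
  unfold zz
  rw [← sub_div, div_eq_iff hh]
  linear_combination this

lemma up {K : ℝ} (K0 : 0 < K) (hK : 8*F ≤ K*√c) (h0 : ∀ j : ℕ, W 0 j ≤ w0 + K*bet 1 (j*h)) :
    ∀ n : ℕ, n*τ ≤ X → ∀ j : ℕ, W n j ≤ w0 + K*(1+16*F/K*τ)^n*bet 1 (j*h) := by
  have hh := C.hh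
  have hA := C.S.hA
  have tp := C.S.hτ
  have F0 := C.F0
  have bp : ∀ j : ℕ, 0 ≤ bet 1 (j*h) := fun j => by
    have h1 := (bet_facts (L := 1) (t := j*h) le_rfl p!).2.1
    have := C.muh j
    linarith
  intro n
  induction n with
  | zero => intro _ j; simpa using h0 j
  | succ n ih =>
    intro hn j
    push_cast at hn
    have hn' : n*τ ≤ X := l!
    have ih := ih hn'
    cases j with
    | zero =>
      rw [C.b0]
      have := bp 0
      have : 0 ≤ K*(1+16*F/K*τ)^(n+1)*bet 1 ((0:ℕ)*h) := p!
      linarith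
    | succ j =>
      obtain ⟨r0, r1⟩ := C.r4 hn' (j+1)
      have u0 := ih j
      have u1 := ih (j+1)
      have u2 := ih (j+2)
      have f1 := C.f1 n hn'
      have cv := curvB (c := c) (L := 1) (D := 2*F/K) (Λ := 16*F/K) (t := (j+1:ℕ)*h) (w := W n (j+1)) hA C.hτ le_rfl hh
        (hj1 hh j) (by linarith [C.hh1]) C.c0
        (by linarith [C.lo n hn' (j+1), C.w0p]) p!
        (by rw [dli K0]; linarith) (by apply le_of_eq; ring)
      rw [show ((j+1:ℕ):ℝ)*h+h = (j+2:ℕ)*h by push_cast; ring,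
          show ((j+1:ℕ):ℝ)*h-h = (j:ℕ)*h by push_cast; ring] at cv
      have b1 := bp (j+1)
      have P1 : 1 ≤ (1+16*F/K*τ)^n := one_le_pow₀ (by have : 0 ≤ 16*F/K*τ := p!
                                                      linarith)
      rw [C.S.s, pow_succ]
      generalize √(W n (j+1))/(4*A) = r, (1+16*F/K*τ)^n = P, bet 1 ((j:ℕ)*h) = B0, bet 1 ((j+1:ℕ)*h) = B1, bet 1 ((j+2:ℕ)*h) = B2 at *
      have k1 := mll u0 r0
      have k2 := mll u2 r0
      have k3 := mll u1 (l! : 0 ≤ 1-2*r)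
      have k4 := mll f1 tp.le
      have k5 := mll cv (p! : 0 ≤ K*P)
      have k6 : 2*F*τ ≤ K*P*(τ*(2*F/K)) := by
        rw [show K*P*(τ*(2*F/K)) = P*(2*F*τ) by field_simp]
        exact le_mul_of_one_le_left p! P1
      linarith

lemma zb {K Z : ℝ} (K0 : 0 ≤ K) (hZ : K ≤ Z) (hu : ∀ n : ℕ, n*τ ≤ X → ∀ j : ℕ, W n j ≤ w0 + K*(j*h))
    (z0 : ∀ j, |zz W h 0 j| ≤ Z) : ∀ n : ℕ, n*τ ≤ X → ∀ j : ℕ, |zz W h n j| ≤ Z := by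
  have hh := C.hh
  have tp := C.S.hτ
  intro n
  induction n with
  | zero => intro _ j; exact z0 j
  | succ n ih =>
    intro hn j
    have hn1 := hn
    push_cast at hn
    have hn' : n*τ ≤ X := l!
    have ih := ih hn'
    cases j with
    | zero =>
      have h1 := hu _ hn1 1
      have h2 := C.low hn1 1
      unfold zz
      rw [C.b0, abn (div_nonneg l! hh.le), dli hh]
      have : K*h ≤ Z*h := by gcongr
      push_cast at h1
      linarith
    | succ j =>
      rw [C.zs]
      obtain ⟨r0, r1⟩ := C.r4 hn' (j+1)
      obtain ⟨s0, s1⟩ := C.r4 hn' (j+2)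
      have a0 := abs_le.1 (ih j)
      have a1 := abs_le.1 (ih (j+1))
      have a2 := abs_le.1 (ih (j+2))
      generalize √(W n (j+1))/(4*A) = r, √(W n (j+2))/(4*A) = s, zz W h n j = x, zz W h n (j+1) = y, zz W h n (j+2) = z at *
      rw [abs_le]
      constructor
      · nlinarith only [mll a0.1 r0, mll a2.1 s0,
          mll a1.1 (l! : 0 ≤ 1-r-s)]
      · nlinarith only [mll a0.2 r0, mll a2.2 s0,
          mll a1.2 (l! : 0 ≤ 1-r-s)]

lemma ql {B : ℝ} (B0 : 0 ≤ B) (hs : 4*F*τ ≤ w0) (q0 : ∀ j, -B ≤ qq W τ 0 j) :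
    ∀ n : ℕ, n*τ ≤ X → ∀ j : ℕ, -(B+2*F'*(n*τ)) ≤ qq W τ n j := by
  have tp := C.S.hτ
  have F0 := C.F0
  have F0' := C.F0'
  intro n
  induction n with
  | zero => intro _ j; simpa using q0 j
  | succ n ih =>
    intro hn j
    have hn1 := hn
    push_cast at hn
    have hn' : n*τ ≤ X := l!
    have ih := ih hn'
    cases j with
    | zero => rw [C.S.q0, neg_nonpos]; positivity
    | succ j =>
      rw [C.S.qeq n j (C.wp hn' _) (C.wp hn1 _)]
      obtain ⟨r0, r1⟩ := C.r4 hn1 (j+1)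
      have b0 := ih j
      have b1 := ih (j+1)
      have b2 := ih (j+2)
      have fn := C.fn n hn'
      have f1 := C.f1 n hn'
      have f2 := (abs_le.1 (C.f2 n hn')).2
      have S1 := sqs (C.wp hn' (j+1)).le
      have l1 := C.low hn' (j+1)
      have a0 := sqp (C.wp hn' (j+1))
      have a0' := sqp (C.wp hn1 (j+1))
      rw [← S1] at l1
      have den : w0 ≤ √(W n (j+1))*(√(W (n+1) (j+1)) + √(W n (j+1))) := by nlinarith only [l1, a0, a0']
      have dp : 0 < √(W n (j+1))*(√(W (n+1) (j+1)) + √(W n (j+1))) := C.w0p.trans_le den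
      generalize √(W n (j+1))*(√(W (n+1) (j+1)) + √(W n (j+1))) = d at *
      push_cast
      have BB : 0 ≤ B+2*F'*(n*τ) := p!
      generalize √(W (n+1) (j+1))/(4*A) = r, qq W τ n j = x, qq W τ n (j+1) = y, qq W τ n (j+2) = z at *
      have key : -(B+2*F'*(n*τ)) ≤ y + r*(z-2*y+x) + τ*(y*(y+2*f n)/d) := by
        have k1 := mll b0 r0
        have k2 := mll b2 r0
        rcases le_total y 0 with hy | hy
        · have : 0 ≤ τ*(y*(y+2*f n)/d) := by
            refine mul_nonneg tp.le (div_nonneg (mul_nonneg_of_nonpos_of_nonpos hy l!) dp.le)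
          have k3 := mll b1 (l! : 0 ≤ 1-2*r)
          linarith
        · have : -(1/2)*y ≤ τ*(y*(y+2*f n)/d) := by
            rw [mul_div_assoc', ldi dp]
            have k4 : 0 ≤ τ*y^2 := p!
            have k5 := mll den hy
            have k6 := mll f1 (p! : 0 ≤ 2*τ*y)
            have k7 := mll hs hy
            linarith
          have k3 := mul_nonneg (l! : 0 ≤ 1/2-2*r) hy
          have k8 := mul_nonneg (l! : 0 ≤ 1-2*r) BB
          linarith
      linarith

lemma zl {B : ℝ} (B0 : 0 ≤ B) (hq : ∀ n : ℕ, n*τ ≤ X → ∀ j : ℕ, -B ≤ qq W τ n j) {n : ℕ} (hn : n*τ ≤ X) (j : ℕ)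
    (hj : j*h ≤ 1) : c - 2*(B+2*F)/√c*√(j*h) ≤ zz W h n j := by
  have hh := C.hh
  have c0 := C.c0
  have F0 := C.F0
  have sc := sqp c0
  induction j with
  | zero =>
    have := C.lo n hn 1
    rw [Nat.cast_one, one_mul, mu, min_eq_left (by linarith [C.hh1])] at this
    unfold zz
    rw [C.b0, ldi hh]
    simp only [Nat.cast_zero, zero_mul, Real.sqrt_zero, mul_zero, sub_zero]
    linarith
  | succ j ih =>
    have hj' := hj
    push_cast at hj'
    have ih := ih l!
    have e := C.zq hn j
    have l := C.lo n hn (j+1)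
    rw [mu, min_eq_left hj] at l
    have jp : 0 < ((j+1:ℕ):ℝ)*h := p!
    have sl : √c*√((j+1:ℕ)*h) ≤ √(W n (j+1)) := by
      rw [← Real.sqrt_mul c0.le]; exact sqm (by linarith [C.w0p])
    have s0 := sqp jp
    have f1 := C.f1 n hn
    have q1 := hq n hn (j+1)
    have g1 : -((B+2*F)/(√c*√((j+1:ℕ)*h))) ≤ (qq W τ n (j+1) + 2*f n)/√(W n (j+1)) := by
      have a0 := sqp (C.wp hn (j+1))
      calc -((B+2*F)/(√c*√((j+1:ℕ)*h))) ≤ -((B+2*F)/√(W n (j+1))) := by gcongr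
        _ = (-(B+2*F))/√(W n (j+1)) := by ring
        _ ≤ _ := by gcongr; linarith
    have g2 : h/√((j+1:ℕ)*h) ≤ 2*(√((j+1:ℕ)*h) - √(j*h)) := by
      rw [dli s0]
      have h1 := sqs jp.le
      have h2 := sqs (p! : 0 ≤ j*h)
      push_cast at *
      nlinarith only [h1, h2, sq_nonneg (√((j+1)*h) - √(j*h))]
    have g3 := mll g1 hh.le
    have g4 := mll g2 (p! : 0 ≤ (B+2*F)/√c)
    have g5 : h*-((B+2*F)/(√c*√((j+1:ℕ)*h))) = -((B+2*F)/√c*(h/√((j+1:ℕ)*h))) := by field_simp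
    rw [g5] at g3
    have g6 : 2*(B+2*F)/√c = 2*((B+2*F)/√c) := by ring
    rw [g6] at ih ⊢
    linarith
end GB
end

lemma posp {x h : ℝ} (hh : 0 < h) : (max (x+h) 0)^2 ≤ (max x 0 + h)^2 ∧ (max (x-h) 0)^2 ≤ (max x 0 - h)^2 := by
  constructor
  · have : max (x+h) 0 ≤ max x 0 + h := max_le (by linarith [le_max_left x 0]) (by linarith [le_max_right x 0])
    have h0 := le_max_right (x+h) 0
    gcongr
  · rcases le_total x h with h1 | h1
    · rw [max_eq_right l!]; rw [zero_pow two_ne_zero]; positivity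
    · rw [max_eq_left l!, max_eq_left l!]

namespace GB
variable {W : ℕ → ℕ → ℝ} {f : ℕ → ℝ} {A τ h X w0 c M F F' : ℝ}
variable (C : GB W f A τ h X w0 c M F F')
include C

lemma dr {Z ai : ℝ} (a0 : 0 < ai) {n m : ℕ} (hn : n*τ ≤ X) (hz : |zz W h n m| ≤ Z)
    (h1 : ai ≤ √(W n m)) (h2 : ai ≤ √(W n (m+1))) : |√(W n (m+1)) - √(W n m)| ≤ Z*h/(2*ai) := by
  have e := C.dw n m
  have s1 := sqs (C.wp hn m).le
  have s2 := sqs (C.wp hn (m+1)).le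
  have hh := C.hh
  rw [ldi p!]
  have k : |√(W n (m+1)) - √(W n m)| * (√(W n (m+1)) + √(W n m)) = h * |zz W h n m| := by
    rw [← abp (l! : 0 < √(W n (m+1)) + √(W n m)), ← abs_mul, ← abp hh, ← abs_mul, abp hh]
    congr 1; linarith
  have k2 := mll hz hh.le
  have k3 := mll (l! : 2*ai ≤ √(W n (m+1)) + √(W n m)) (abs_nonneg (√(W n (m+1)) - √(W n m)))
  linarith only [k, k2, k3]

lemma dbl {Z ai yo So Co N si : ℝ} (hz : ∀ n : ℕ, n*τ ≤ X → ∀ j : ℕ, |zz W h n j| ≤ Z) (Z0 : 0 ≤ Z) (y0 : 0 < yo) (y1 : yo ≤ 1)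
    (a0 : 0 < ai) (ha : ∀ n : ℕ, n*τ ≤ X → ∀ j : ℕ, yo/4 < j*h → ai ≤ √(W n j))
    (hS : ∀ j : ℕ, yo/4 < j*h → zz W h 0 (j+1) - zz W h 0 j ≤ So*h)
    (C0 : 0 ≤ Co) (N0 : 0 ≤ N) (s0 : 0 < si) (hC : 2*Z ≤ Co*(yo/4)^2) (hN2 : 2*Z ≤ 3/4*N*si) (hN3 : 2*So ≤ N)
    (hN : N*Z/ai + Co*(Z/ai+2*A) ≤ N*ai/si) (hs : h ≤ si) :
    ∀ n : ℕ, n*τ ≤ X → ∀ k i : ℕ, i*h ≤ 2*si →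
     zz W h n (k+i) - zz W h n k ≤ (N*(i*h) - N/(4*si)*(i*h)^2) + Co*(max (yo/2-k*h) 0)^2 := by
  have hh := C.hh
  have hA := C.S.hA
  have tp := C.S.hτ
  have φ0 : ∀ s, 0 ≤ s → s ≤ 2*si → N*s/2 ≤ N*s - N/(4*si)*s^2 := fun s h0 h1 => by
    have : N/(4*si)*s^2 ≤ N*s/2 := by
      rw [div_mul_eq_mul_div, dli p!]
      nlinarith only [mll h1 (p! : 0 ≤ N*s)]
    linarith
  have triv : ∀ n : ℕ, n*τ ≤ X → ∀ k i : ℕ, i*h ≤ 2*si → (i = 0 ∨ si ≤ i*h ∨ k*h ≤ yo/4) →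
     zz W h n (k+i) - zz W h n k ≤ (N*(i*h) - N/(4*si)*(i*h)^2) + Co*(max (yo/2-k*h) 0)^2 := by
    intro n hn k i hi ho
    have p1 := φ0 (i*h) p! hi
    have p2 : 0 ≤ Co*(max (yo/2-k*h) 0)^2 := p!
    have p4 : 0 ≤ N*(i*h)/2 := p!
    have z1 := abs_le.1 (hz n hn (k+i))
    have z2 := abs_le.1 (hz n hn k)
    rcases ho with rfl | ho | ho
    · simp only [add_zero, sub_self]; linarith
    · have : 3/4*N*si ≤ N*(i*h) - N/(4*si)*(i*h)^2 := by
        have : N*(i*h) - N/(4*si)*(i*h)^2 - 3/4*N*si = N/(4*si)*((i*h-si)*(3*si-i*h)) := by field_simp; ring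
        have : 0 ≤ N/(4*si)*((i*h-si)*(3*si-i*h)) := mul_nonneg p! (mul_nonneg l! l!)
        linarith
      linarith
    · have : Co*(yo/4)^2 ≤ Co*(max (yo/2-k*h) 0)^2 := by
        have : yo/4 ≤ max (yo/2-k*h) 0 := le_trans l! (le_max_left _ _)
        gcongr
      linarith
  intro n
  induction n with
  | zero =>
    intro hn k i hi
    rcases le_or_gt (k*h) (yo/4) with h1 | h1
    · exact triv 0 hn k i hi (Or.inr (Or.inr h1))
    · have : ∀ i : ℕ, zz W h 0 (k+i) - zz W h 0 k ≤ So*(i*h) := by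
        intro i
        induction i with
        | zero => simp
        | succ i ih =>
          have := hS (k+i) (by push_cast; nlinarith only [h1, mul_nonneg (Nat.cast_nonneg (α := ℝ) i) hh.le])
          rw [← add_assoc]; push_cast; linarith
      have h2 := this i
      have h3 := φ0 (i*h) p! hi
      have p2 : 0 ≤ Co*(max (yo/2-k*h) 0)^2 := p!
      have h4 := mlr hN3 (p! : 0 ≤ (i:ℝ)*h)
      linarith
  | succ n ih =>
    intro hn k i hi
    have hn1 := hn
    push_cast at hn
    have hn' : n*τ ≤ X := l!
    have ih := ih hn'
    by_cases ho : (i = 0 ∨ si ≤ i*h ∨ k*h ≤ yo/4)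
    · exact triv _ hn1 k i hi ho
    push Not at ho
    obtain ⟨o1, o2, o3⟩ := ho
    obtain ⟨i, rfl⟩ := Nat.exists_eq_succ_of_ne_zero o1
    have k0 : k ≠ 0 := by rintro rfl; simp at o3; linarith
    obtain ⟨k, rfl⟩ := Nat.exists_eq_succ_of_ne_zero k0
    simp only [Nat.succ_eq_add_one] at *
    have far : ∀ m : ℕ, yo/4 < ((k+1+m:ℕ):ℝ)*h := fun m => by
      push_cast at o3 ⊢; nlinarith only [o3, mul_nonneg (Nat.cast_nonneg (α := ℝ) m) hh.le]
    have hb := far 0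
    have hb1 := far 1
    have hb2 := far (i+1)
    have hb3 := far (i+2)
    have A1 := ha n hn' _ hb
    have A2 := ha n hn' _ hb1
    have A3 := ha n hn' _ hb2
    have A4 := ha n hn' _ hb3
    have D1 := C.dr a0 hn' (hz n hn' _) A1 A2
    have D2 := C.dr a0 hn' (hz n hn' _) A3 A4
    have e1 := C.zs n k
    have e2 := C.zs n (k+1+i)
    have R1 := (C.r4 hn' (k+1)).2
    have R2 := (C.r4 hn' (k+2)).2
    have R3 := (C.r4 hn' (k+1+(i+1))).2
    have R4 := (C.r4 hn' (k+1+(i+2))).2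
    have I0 := ih (k+1) (i+1) hi
    have I1 := ih (k+1) (i+2) (by push_cast at *; linarith)
    have I2 := ih (k+1) i (by push_cast at *; linarith)
    have I3 := ih (k+2) i (by push_cast at *; linarith)
    have I4 := ih k (i+2) (by push_cast at *; linarith)
    rw [show k+2+i = k+1+(i+1) by ring] at I3
    rw [show k+(i+2) = k+1+(i+1) by ring] at I4
    rw [show k+1+i+1 = k+1+(i+1) by ring, show k+1+i+2 = k+1+(i+2) by ring] at e2
    rw [e1, e2]
    simp only [Nat.add_zero] at A1 D1
    rw [show k+1+1 = k+2 by ring] at A2 D1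
    rw [show k+1+(i+1)+1 = k+1+(i+2) by ring] at D2
    obtain ⟨P1, P2⟩ := posp (x := yo/2 - (k+1:ℕ)*h) hh
    have pb : max (yo/2 - (k+1:ℕ)*h) 0 ≤ 1 := max_le (by push_cast; nlinarith only [y1, hh, mul_nonneg (Nat.cast_nonneg (α := ℝ) k) hh.le]) zero_le_one
    have p0 := le_max_right (yo/2 - (k+1:ℕ)*h) 0
    rw [show yo/2 - (k+1:ℕ)*h + h = yo/2 - (k:ℕ)*h by push_cast; ring] at P1
    rw [show yo/2 - (k+1:ℕ)*h - h = yo/2 - (k+2:ℕ)*h by push_cast; ring] at P2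
    have c1 := mll P1 C0
    have c2 := mll P2 C0
    generalize max (yo/2 - (k+1:ℕ)*h) 0 = p, max (yo/2 - (k+2:ℕ)*h) 0 = p2, max (yo/2 - (k:ℕ)*h) 0 = p1 at *
    rw [show ((i+2:ℕ):ℝ)*h = (i+1:ℕ)*h + h by push_cast; ring] at I1 I4
    rw [show (i:ℝ)*h = (i+1:ℕ)*h - h by push_cast; ring] at I2 I3
    have d0 : 0 ≤ ((i+1:ℕ):ℝ)*h := p!
    generalize ((i+1:ℕ):ℝ)*h = d, zz W h n (k+1+(i+1)) = z1, zz W h n (k+1+(i+2)) = z2, zz W h n (k+1+i) = z3, zz W h n (k+2) = z4, zz W h n (k+1) = z5, zz W h n k = z6, √(W n (k+1)) = a, √(W n (k+2)) = b, √(W n (k+1+(i+1))) = a', √(W n (k+1+(i+2))) = b' at *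
    clear e1 e2 ih triv ha hz hS far hb hb1 hb2 hb3 P1 P2 φ0 C
    have A0 : 0 < 4*A := l!
    obtain ⟨κ, hκ⟩ := exr (N/(4*si))
    have κ0 : 0 ≤ κ := by rw [hκ]; positivity
    have κd : 2*κ*d ≤ N := by
      rw [hκ, show 2*(N/(4*si))*d = N*d/(2*si) by field_simp; ring, dli p!]; gcongr
    rw [← hκ] at I0 I1 I2 I3 I4 ⊢
    obtain ⟨ρ, hρ⟩ := exr (Z/(8*A*ai))
    have ρ0 : 0 ≤ ρ := by rw [hρ]; positivity
    have key : 2*N*ρ + Co*(2*ρ+1/2) ≤ κ*(ai/A) := by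
      have e1 : 2*N*ρ + Co*(2*ρ+1/2) = (N*Z/ai + Co*(Z/ai+2*A))/(4*A) := by rw [hρ]; field_simp; ring
      have e2 : κ*(ai/A) = (N*ai/si)/(4*A) := by rw [hκ]; field_simp
      rw [e1, e2]; gcongr
    have cv : ∀ x y : ℝ, |y - x| ≤ Z*h/(2*ai) → |y/(4*A) - x/(4*A)| ≤ ρ*h := fun x y hxy => by
      rw [← sub_div, abs_div, abp A0, dli A0]
      refine hxy.trans (le_of_eq ?_); rw [hρ]; field_simp; ring
    have E1 := abs_le.1 (cv _ _ D1)
    have E2 := abs_le.1 (cv _ _ D2)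
    have lw : ∀ x, ai ≤ x → ai/(4*A) ≤ x/(4*A) := fun x hx => by gcongr
    have g := lw _ A1
    have g2 := lw _ A2
    have g3 := lw _ A3
    have g4 := lw _ A4
    have g0 : 0 < ai/(4*A) := p!
    rw [show ai/A = 4*(ai/(4*A)) by field_simp] at key
    generalize ai/(4*A) = gi, a/(4*A) = r, b/(4*A) = r', a'/(4*A) = t, b'/(4*A) = t' at *
    clear D1 D2 cv lw hκ hρ hN A1 A2 A3 A4
    have q1 := mll I1 (l! : 0 ≤ t')
    have q2 := mll I2 (l! : 0 ≤ t)
    have q3 := mll (I3.trans (add_le_add le_rfl c2)) (l! : 0 ≤ r')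
    have q4 := mll (I4.trans (add_le_add le_rfl c1)) (l! : 0 ≤ r)
    have q0 := mll I0 (l! : 0 ≤ 1-r-r'-t-t')
    have m1 : h*((N-2*κ*d)*(t'-t+r-r')) ≤ h*(N*(2*ρ*h)) := by
      have : (N-2*κ*d)*(t'-t+r-r') ≤ N*(2*ρ*h) := by
        have h0 : 0 ≤ 2*ρ*h := p!
        have h1 := mll (l! : t'-t+r-r' ≤ 2*ρ*h) (l! : 0 ≤ N-2*κ*d)
        have h2 := mul_nonneg (p! : 0 ≤ 2*κ*d) h0
        linarith
      gcongr
    have m2 : Co*(2*p*h*(r-r')) ≤ Co*(2*h*(ρ*h)) := by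
      have : 2*p*h*(r-r') ≤ 2*h*(ρ*h) := by
        have h1 := mll (l! : r-r' ≤ ρ*h) (p! : 0 ≤ 2*p*h)
        have h2 := mll pb (p! : 0 ≤ 2*h*(ρ*h))
        linarith
      gcongr
    have m3 : Co*(h^2*(r+r')) ≤ Co*(h^2*(1/2)) := by gcongr; linarith
    have m4 : κ*(h^2*(4*gi)) ≤ κ*(h^2*(r+r'+t+t')) := by gcongr; linarith
    have m5 := mll key (sq_nonneg h)
    linarith only [q0, q1, q2, q3, q4, m1, m2, m3, m4, m5]
end GB

lemma g5step {A τ h a b a' q q1 q0 z z1 z0 f f' K α Z Qb F F' Γ Kb : ℝ} (hA : 1 ≤ A) (hτ : h^2 = 4*A*τ) (hh : 0 < h) (h1 : h ≤ 1)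
    (α0 : 0 < α) (ha : α ≤ a) (hb : α ≤ b) (ha' : α ≤ a') (hA' : a' ≤ A) (eb : b^2 = a^2 + h*z) (ea : a'^2 = a^2+τ*q)
    (e1 : z1 - z = h*((q1+2*f)/b)) (e0 : z - z0 = h*((q+2*f)/a)) (Q0 : 0 ≤ Qb) (F0 : 0 ≤ F) (K0 : 0 ≤ K) (hK : K ≤ Kb)
    (hz : |z| ≤ Z) (hq : |q| ≤ Qb) (hq1 : |q1| ≤ Qb) (hf : |f| ≤ F) (hf' : |f'-f| ≤ F'*τ)
    (E0 : q0 ≤ K*z0) (E : q ≤ K*z) (E1 : q1 ≤ K*z1)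
    (G1 : (Qb+2*F)/α/(2*α) + Kb*((Z+Qb)/(2*α))/α ≤ Γ)
    (G2 : (Qb+2*F)/α*(Qb*((Z+Qb)/(2*α)/(4*α^2))) + Kb*((Z+Qb)/(2*α))*(Kb*((Qb+2*F)/α)/α + (Qb+2*F)*(Z/(2*α^3))) ≤ Γ)
    (hs : τ*Γ ≤ α/(4*A)) :
    -(τ*Γ*h) - 2*(F'*τ) ≤ K*(z + b/(4*A)*(z1-z) - a/(4*A)*(z-z0)) -
      (q + a'/(4*A)*(q1-2*q+q0) + τ*(q*(q+2*f)/(a*(a'+a))) - 2*(f'-f)) := by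
  have a0 : 0 < a := l!
  have b0 : 0 < b := l!
  have a0' : 0 < a' := l!
  have Z0 := (abs_nonneg _).trans hz
  have Kb0 := K0.trans hK
  have tp : 0 < τ := by
    have : 0 < A*τ := by nlinarith only [hτ, pow_pos hh 2]
    exact pos_of_mul_pos_right this l!
  have th : τ ≤ h := by nlinarith only [hτ, hA, h1, hh, mul_nonneg (sbn hA) tp.le]
  obtain ⟨Ca, hCa⟩ := exr ((Z+Qb)/(2*α))
  obtain ⟨S, hS⟩ := exr ((Qb+2*F)/α)
  rw [← hCa, ← hS] at G1 G2
  have Ca0 : 0 ≤ Ca := by rw [hCa]; positivity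
  have S0 : 0 ≤ S := by rw [hS]; positivity
  have nf : ∀ x, |x| ≤ Qb → |x+2*f| ≤ Qb+2*F := fun x hx => by
    refine (aal _ _).trans ?_
    rw [abs_mul 2, abp (by norm_num : (0:ℝ)<2)]; linarith
  have sb : ∀ x y, |x| ≤ Qb → α ≤ y → |(x+2*f)/y| ≤ S := fun x y hx hy => by
    rw [abs_div, abp (l! : 0 < y), hS]
    have := nf x hx
    gcongr
  have d1 : |b - a| ≤ Z*h/(2*α) := by
    have k : (b-a)*(b+a) = h*z := by linarith only [eb]
    rw [ldi p!]
    calc |b-a| * (2*α) ≤ |b-a| * (b+a) := by gcongr; linarith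
      _ = |h*z| := by rw [← k, abs_mul, abp (l! : 0 < b+a)]
      _ ≤ Z*h := by rw [abs_mul, abp hh, mul_comm]; gcongr
  have d2 : |a' - a| ≤ Qb*h/(2*α) := by
    have k : (a'-a)*(a'+a) = τ*q := by linarith only [ea]
    rw [ldi p!]
    calc |a'-a| * (2*α) ≤ |a'-a| * (a'+a) := by gcongr; linarith
      _ = |τ*q| := by rw [← k, abs_mul, abp (l! : 0 < a'+a)]
      _ ≤ Qb*h := by rw [abs_mul, abp tp, mul_comm]; gcongr
  have d3 : |b - a'| ≤ Ca*h := by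
    calc |b-a'| = |(b-a) - (a'-a)| := by congr 1; ring
      _ ≤ |b-a| + |a'-a| := abs_sub _ _
      _ ≤ Z*h/(2*α) + Qb*h/(2*α) := add_le_add d1 d2
      _ = _ := by rw [hCa]; ring
  have s0 := sb q a hq ha
  have s1 := sb q1 b hq1 hb
  obtain ⟨s, es⟩ := exr ((q+2*f)/a)
  obtain ⟨t, et⟩ := exr ((q1+2*f)/b)
  obtain ⟨e, he⟩ := exr (K*z - q)
  obtain ⟨e', he'⟩ := exr (K*z1 - q1)
  have ep : 0 ≤ e := l!
  have ep' : 0 ≤ e' := l!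
  rw [← es] at s0 e0
  rw [← et] at s1 e1
  have ds : |t - s| ≤ (Kb*h*S + e + e')/α + (Qb+2*F)*(Z*h/(2*α^3)) := by
    have k : t - s = (q1-q)/b + (q+2*f)*((a-b)/(a*b)) := by rw [et, es]; field_simp; ring
    rw [k]
    refine (aal _ _).trans (add_le_add ?_ ?_)
    · rw [abs_div, abp b0]
      have : |q1 - q| ≤ Kb*h*S+e+e' := by
        rw [show q1 - q = K*h*t + (e - e') by rw [he, he']; linear_combination K*e1]
        refine (aal _ _).trans ?_
        have : |e - e'| ≤ e+e' := abs_le.2 ⟨l!, l!⟩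
        rw [abs_mul, abn (p! : 0 ≤ K*h)]
        have : K*h * |t| ≤ Kb*h*S := by gcongr
        linarith
      gcongr
    · rw [abs_mul, abs_div, abp (p! : 0 < a*b), abc a b]
      have h3 := nf q hq
      have : |b-a| / (a*b) ≤ Z*h/(2*α)/(α*α) := by gcongr
      calc _ ≤ (Qb+2*F)*(Z*h/(2*α)/(α*α)) := by gcongr
        _ = _ := by field_simp
  have id : K*(z + b/(4*A)*(z1-z) - a/(4*A)*(z-z0)) -
      (q + a'/(4*A)*(q1-2*q+q0) + τ*(q*(q+2*f)/(a*(a'+a))) - 2*(f'-f)) =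
      e + a'/(4*A)*(e'-2*e+(K*z0-q0)) + τ*(s*(e/(b+a))) + τ*(s*(q*((a'-b)/((b+a)*(a'+a)))))
       + τ*(K*((b-a')/h)*(t-s)) + 2*(f'-f) := by
    have i1 : τ*(q*(q+2*f)/(a*(a'+a))) = τ*(s*(q/(a'+a))) := by rw [es]; field_simp
    have i2 : τ*(s*(e/(b+a))) + τ*(s*(q*((a'-b)/((b+a)*(a'+a))))) = τ*(s*(K*z/(b+a))) - τ*(s*(q/(a'+a))) := by
      rw [he]; field_simp; ring
    have i3 : z = (b-a)*(b+a)/h := by rw [eq_div_iff hh.ne']; linarith only [eb]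
    have i4 : τ*(s*(K*z/(b+a))) = h*(K*((b-a)/(4*A))*s) := by
      rw [i3, show τ = h^2/(4*A) by rw [hτ]; field_simp]; field_simp
    have i5 : τ*(K*((b-a')/h)*(t-s)) = K*h*((b-a')/(4*A))*(t-s) := by
      rw [show τ = h^2/(4*A) by rw [hτ]; field_simp]; field_simp
    rw [i1, i5]
    rw [add_assoc (e + _) _ _, i2, i4, he, he']
    linear_combination (K*(b/(4*A)) - K*a'/(4*A))*e1 + (K*a'/(4*A)-K*(a/(4*A)))*e0
  rw [id]
  have r1 : α/(4*A) ≤ a'/(4*A) := by gcongr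
  have r2 : a'/(4*A) ≤ 1/4 := by rw [dli p!]; linarith
  have T1 : |s*(e/(b+a))| ≤ S*(e/(2*α)) := by
    rw [abs_mul, abn (p! : 0 ≤ e/(b+a))]
    have : 2*α ≤ b+a := l!
    gcongr
  have T2 : |s*(q*((a'-b)/((b+a)*(a'+a))))| ≤ S*(Qb*(Ca*h/(4*α^2))) := by
    rw [abs_mul, abs_mul, abs_div, abp (p! : 0 < (b+a)*(a'+a)), abc a' b]
    have : 4*α^2 ≤ (b+a)*(a'+a) := by
      calc 4*α^2 = (α+α)*(α+α) := by ring
        _ ≤ _ := by gcongr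
    gcongr
  have T3 : |K*((b-a')/h)*(t-s)| ≤ Kb*Ca*((Kb*h*S + e + e')/α + (Qb+2*F)*(Z*h/(2*α^3))) := by
    rw [abs_mul, abs_mul, abn K0, abs_div, abp hh]
    have : |b-a'| / h ≤ Ca := by rwa [dli hh]
    gcongr
  have T4 : S*(e/(2*α)) + S*(Qb*(Ca*h/(4*α^2))) + Kb*Ca*((Kb*h*S + e + e')/α + (Qb+2*F)*(Z*h/(2*α^3))) ≤ Γ*(e+e') + Γ*h := by
    have k1 := mlr G1 (l! : 0 ≤ e+e')
    have k2 := mlr G2 hh.le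
    have k3 : 0 ≤ S/(2*α)*e' := p!
    have k4 : S*(e/(2*α)) + S*(Qb*(Ca*h/(4*α^2))) + Kb*Ca*((Kb*h*S + e + e')/α + (Qb+2*F)*(Z*h/(2*α^3)))
      = (S/(2*α)+Kb*Ca/α)*(e+e') - S/(2*α)*e' + (S*(Qb*(Ca/(4*α^2))) + Kb*Ca*(Kb*S/α + (Qb+2*F)*(Z/(2*α^3))))*h := by ring
    rw [k4]; linarith
  have T5 := mll T4 tp.le
  have U1 := mll (abs_le.1 T1).1 tp.le
  have U2 := mll (abs_le.1 T2).1 tp.le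
  have U3 := mll (abs_le.1 T3).1 tp.le
  have U4 := (abs_le.1 hf').1
  have V1 := mul_nonneg (l! : 0 ≤ a'/(4*A) - τ*Γ) ep'
  have V2 := mul_nonneg (l! : 0 ≤ 1-2*(a'/(4*A)) - τ*Γ) ep
  have V3 := mul_nonneg (by linarith [div_pos α0 (l! : 0 < 4*A)] : 0 ≤ a'/(4*A)) (l! : 0 ≤ K*z0-q0)
  linarith only [T5, U1, U2, U3, U4, V1, V2, V3]

namespace GB
variable {W : ℕ → ℕ → ℝ} {f : ℕ → ℝ} {A τ h X w0 c M F F' : ℝ}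
variable (C : GB W f A τ h X w0 c M F F')
include C

lemma qz {Z B yo Qz Ko κ Γ Kb Qb : ℝ} (hz : ∀ n : ℕ, n*τ ≤ X → ∀ j : ℕ, |zz W h n j| ≤ Z)
    (hB : ∀ n : ℕ, n*τ ≤ X → ∀ j : ℕ, -B ≤ qq W τ n j) (zl : ∀ n : ℕ, n*τ ≤ X → ∀ j : ℕ, j*h ≤ yo → c/2 ≤ zz W h n j)
    (hQ : ∀ n : ℕ, n*τ ≤ X → ∀ j : ℕ, 3/4*yo < j*h → qq W τ n j ≤ Qz) (hh4 : h ≤ yo/4)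
    (K0 : 0 ≤ Ko) (hKo : Qz ≤ Ko*(c/2)) (q0 : ∀ j : ℕ, qq W τ 0 j ≤ Ko*(c/2)) (κ0 : 0 ≤ κ) (hκ : 1+2*F' ≤ κ*(c/2))
    (hKb : Ko + X*κ ≤ Kb) (hQb : B ≤ Qb) (hQb2 : Kb*Z ≤ Qb)
    (G1 : (Qb+2*F)/√w0/(2*√w0) + Kb*((Z+Qb)/(2*√w0))/√w0 ≤ Γ)
    (G2 : (Qb+2*F)/√w0*(Qb*((Z+Qb)/(2*√w0)/(4*√w0^2))) + Kb*((Z+Qb)/(2*√w0))*(Kb*((Qb+2*F)/√w0)/√w0 + (Qb+2*F)*(Z/(2*√w0^3))) ≤ Γ)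
    (hs : τ*Γ ≤ √w0/(4*A)) (hΓ : Γ*h ≤ 1) :
    ∀ n : ℕ, n*τ ≤ X → ∀ j : ℕ, j*h ≤ yo → qq W τ n j ≤ (Ko+n*τ*κ)*zz W h n j := by
  have hh := C.hh
  have hA := C.S.hA
  have tp := C.S.hτ
  have c0 := C.c0
  have α0 := sqp C.w0p
  have Kz : ∀ n : ℕ, n*τ ≤ X → ∀ j : ℕ, j*h ≤ yo → Ko*(c/2) ≤ (Ko+n*τ*κ)*zz W h n j := fun n hn j hj => by
    have := zl n hn j hj
    have : 0 ≤ n*τ*κ := p!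
    calc Ko*(c/2) ≤ (Ko+n*τ*κ)*(c/2) := by gcongr; linarith
      _ ≤ _ := by gcongr
  intro n
  induction n with
  | zero => intro hn j hj; exact (q0 j).trans (Kz 0 hn j hj)
  | succ n ih =>
    intro hn j hj
    have hn1 := hn
    push_cast at hn
    have hn' : n*τ ≤ X := l!
    have ih := ih hn'
    rcases lt_or_ge (3/4*yo) (j*h) with h1 | h1
    · exact ((hQ _ hn1 j h1).trans hKo).trans (Kz _ hn1 j hj)
    cases j with
    | zero =>
      rw [C.S.q0]
      exact le_trans p! (Kz _ hn1 0 hj)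
    | succ j =>
      have j0 : (j:ℝ)*h ≤ yo := by push_cast at hj; linarith
      have j2 : ((j+2:ℕ):ℝ)*h ≤ yo := by push_cast at h1 ⊢; linarith
      have I0 := ih j j0
      have I1 := ih (j+1) hj
      have I2 := ih (j+2) j2
      have Kp : 0 ≤ Ko+n*τ*κ := p!
      have Kl : Ko+n*τ*κ ≤ Kb := by
        have : n*τ*κ ≤ X*κ := by gcongr
        linarith
      have qb : ∀ i : ℕ, i*h ≤ yo → |qq W τ n i| ≤ Qb := fun i hi => by
        refine abs_le.2 ⟨by linarith [hB n hn' i], (ih i hi).trans (le_trans ?_ hQb2)⟩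
        have h1 := (le_abs_self _).trans (hz n hn' i)
        have h2 := zl n hn' i hi
        gcongr <;> linarith only [h2, c0, Kp, Kl]
      have st := g5step (A := A) (τ := τ) (h := h) (a := √(W n (j+1))) (b := √(W n (j+2))) (a' := √(W (n+1) (j+1)))
        (q := qq W τ n (j+1)) (q1 := qq W τ n (j+2)) (q0 := qq W τ n j) (z := zz W h n (j+1)) (z1 := zz W h n (j+2))
        (z0 := zz W h n j) (f := f n) (f' := f (n+1)) (K := Ko+n*τ*κ) hA C.hτ hh (by linarith [C.hh1]) α0
        (sqm (C.low hn' _)) (sqm (C.low hn' _)) (sqm (C.low hn1 _)) (C.sA hn1 _)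
        (by rw [sqs (C.wp hn' _).le, sqs (C.wp hn' _).le]; exact C.dw n (j+1))
        (by rw [sqs (C.wp hn' _).le, sqs (C.wp hn1 _).le]; exact C.S.Wq n (j+1))
        (C.zq hn' (j+1)) (C.zq hn' j) ((abs_nonneg _).trans (qb j j0)) C.F0 Kp Kl (hz n hn' _) (qb _ hj) (qb _ j2)
        (abs_le.2 ⟨C.f1 n hn', (C.fn n hn').trans C.F0⟩) (C.f2 n hn') I0 I1 I2 G1 G2 hs
      rw [← C.S.qeq n j (C.wp hn' _) (C.wp hn1 _), ← C.zs] at st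
      have zp := zl _ hn1 _ hj
      have u1 := mll zp (p! : 0 ≤ τ*κ)
      have u2 := mll hκ tp.le
      have u3 := mll hΓ tp.le
      push_cast
      linarith only [st, u1, u2, u3]
end GB

theorem gl {A X c F F' Z B Kq : ℝ} (hA : 1 ≤ A) (X0 : 0 < X) (c0 : 0 < c) (F0 : 0 ≤ F) (F0' : 0 ≤ F') (Z0 : 0 ≤ Z) (B0 : 0 ≤ B) (Kq0 : 0 ≤ Kq) :
    ∃ Q : ℝ, 0 ≤ Q ∧ ∀ w0 > 0, ∃ h₀ > 0, ∀ (W : ℕ → ℕ → ℝ) (f : ℕ → ℝ) (τ h M : ℝ), h < h₀ → GB W f A τ h X w0 c M F F' →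
    (∀ n : ℕ, n*τ ≤ X → ∀ j : ℕ, |zz W h n j| ≤ Z) → (∀ n : ℕ, n*τ ≤ X → ∀ j : ℕ, -B ≤ qq W τ n j) →
    (∀ j, qq W τ 0 j ≤ Kq) → ∀ n : ℕ, n*τ ≤ X → ∀ j : ℕ, |qq W τ n j| ≤ Q := by
  have sc := sqp c0
  obtain ⟨C', hC'⟩ := exr (2*(B+2*F)/√c)
  have C'0 : 0 ≤ C' := by rw [hC']; positivity
  obtain ⟨yo, y0, y1, hy⟩ : ∃ yo : ℝ, 0 < yo ∧ yo ≤ 1 ∧ C'*√yo ≤ c/2 := by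
    refine ⟨min 1 ((c/(2*(C'+1)))^2), p!, min_le_left _ _, ?_⟩
    have : √(min 1 ((c/(2*(C'+1)))^2)) ≤ c/(2*(C'+1)) := Real.sqrt_le_iff.2 ⟨p!, min_le_right _ _⟩
    calc _ ≤ (C'+1)*(c/(2*(C'+1))) := by gcongr; linarith
      _ = _ := by field_simp
  obtain ⟨ai, hai⟩ := exr (√(c*(yo/4)))
  have a0 : 0 < ai := by rw [hai]; positivity
  obtain ⟨Co, hCo⟩ := exr (2*Z/(yo/4)^2)
  have C0 : 0 ≤ Co := by rw [hCo]; positivity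
  obtain ⟨si, hsi⟩ := exr (ai^2/(2*(Z+1)))
  have s0 : 0 < si := by rw [hsi]; positivity
  obtain ⟨N, hN⟩ := exr (ai*(Co*(Z/ai+2*A)) + 2*(Kq/ai) + 3*Z/si)
  have N0 : 0 ≤ N := by rw [hN]; positivity
  have n1 : 2*Z ≤ 3/4*N*si := by
    have : 3*Z/si*si ≤ N*si := by
      gcongr; rw [hN]; have : 0 ≤ ai*(Co*(Z/ai+2*A)) + 2*(Kq/ai) := p!
      linarith
    rw [div_mul_cancel₀ _ s0.ne'] at this; linarith
  have n2 : N*Z/ai + Co*(Z/ai+2*A) ≤ N*ai/si := by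
    have e : N*ai/si = 2*(N*Z/ai) + 2*(N/ai) := by rw [hsi]; field_simp
    have : Co*(Z/ai+2*A) ≤ N/ai := by
      rw [ldi a0, hN]; have : 0 ≤ 2*(Kq/ai) + 3*Z/si := p!
      linarith
    have : 0 ≤ N*Z/ai := p!
    have : 0 ≤ N/ai := p!
    linarith
  have n3 : 2*(Kq/ai) ≤ N := by
    rw [hN]; have : 0 ≤ ai*(Co*(Z/ai+2*A)) + 3*Z/si := p!
    linarith
  obtain ⟨Qz, hQz⟩ := exr (N*A+2*F)
  have Q20 : 0 ≤ Qz := by rw [hQz]; positivity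
  obtain ⟨Ko, hKo⟩ := exr ((Qz+Kq)*(2/c))
  have K0 : 0 ≤ Ko := by rw [hKo]; positivity
  have K1 : Ko*(c/2) = Qz+Kq := by rw [hKo]; field_simp
  obtain ⟨κ, hκ⟩ := exr ((1+2*F')*(2/c))
  have κ0 : 0 ≤ κ := by rw [hκ]; positivity
  have κ1 : κ*(c/2) = 1+2*F' := by rw [hκ]; field_simp
  obtain ⟨Kb, hKb⟩ := exr (Ko+X*κ)
  have Kb0 : 0 ≤ Kb := by rw [hKb]; positivity
  obtain ⟨Qb, hQb⟩ := exr (B+Kb*Z)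
  have Kz : 0 ≤ Kb*Z := p!
  have Qb0 : 0 ≤ Qb := by rw [hQb]; positivity
  refine ⟨Qb+Qz, p!, fun w0 w0p => ?_⟩
  have α0 := sqp w0p
  obtain ⟨Γ1, hΓ1⟩ := exr ((Qb+2*F)/√w0/(2*√w0) + Kb*((Z+Qb)/(2*√w0))/√w0)
  obtain ⟨Γ2, hΓ2⟩ := exr ((Qb+2*F)/√w0*(Qb*((Z+Qb)/(2*√w0)/(4*√w0^2))) + Kb*((Z+Qb)/(2*√w0))*(Kb*((Qb+2*F)/√w0)/√w0 + (Qb+2*F)*(Z/(2*√w0^3))))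
  have g1 : 0 ≤ Γ1 := by rw [hΓ1]; positivity
  have g2 : 0 ≤ Γ2 := by rw [hΓ2]; positivity
  obtain ⟨Γ, hΓ⟩ := exr (Γ1+Γ2+1)
  have Γ0 : 0 < Γ := by rw [hΓ]; positivity
  refine ⟨min (min si (yo/4)) (min (1/Γ) (√w0/Γ)), p!, ?_⟩
  intro W f τ h M hlt C hz hB q0
  simp only [lt_min_iff] at hlt
  obtain ⟨⟨l1, l2⟩, l3, l4⟩ := hlt
  rw [lt_div_iff₀ Γ0] at l3 l4
  have hh := C.hh
  have tp := C.S.hτ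
  have h1 : h ≤ 1 := by linarith [C.hh1]
  have X0' : ((0:ℕ):ℝ)*τ ≤ X := by simpa using X0.le
  have a1l : ∀ n : ℕ, n*τ ≤ X → ∀ j : ℕ, yo/4 < j*h → ai ≤ √(W n j) := fun n hn j hj => by
    rw [hai]; refine sqm ((C.lo n hn j).trans' ?_)
    have : yo/4 ≤ mu (j*h) := le_min hj.le l!
    have : c*(yo/4) ≤ c*mu (j*h) := by gcongr
    linarith
  have db := C.dbl (So := Kq/ai) hz Z0 y0 y1 a0 a1l (by
    intro j hj
    have hj1 : yo/4 < ((j+1:ℕ):ℝ)*h := by push_cast; linarith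
    rw [C.zq X0' j, mul_comm]
    have a2 := a1l 0 X0' (j+1) hj1
    have f0 := C.fn 0 X0'
    gcongr
    linarith [q0 (j+1)]) C0 N0 s0 (by rw [hCo, div_mul_cancel₀]; positivity) n1 n3 n2 l1.le
  have far : ∀ n : ℕ, n*τ ≤ X → ∀ j : ℕ, 3/4*yo < j*h → qq W τ n j ≤ Qz := by
    intro n hn j hj
    cases j with
    | zero => simp at hj; linarith
    | succ j =>
      push_cast at hj
      have d := db n hn j 1 (by push_cast; linarith)
      rw [max_eq_right l!, C.zq hn j] at d
      have : 0 ≤ N/(4*si)*((1:ℕ)*h)^2 := p!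
      have d2 : h*((qq W τ n (j+1) + 2*f n)/√(W n (j+1))) ≤ h*N := by push_cast at *; linarith
      have d3 := le_of_mul_le_mul_left d2 hh
      rw [dli (sqp (C.wp hn _))] at d3
      have d4 := mll (C.sA hn (j+1)) N0
      rw [hQz]
      linarith [C.f1 n hn]
  have zl : ∀ n : ℕ, n*τ ≤ X → ∀ j : ℕ, j*h ≤ yo → c/2 ≤ zz W h n j := fun n hn j hj => by
    have e := C.zl B0 hB hn j (hj.trans y1)
    rw [← hC'] at e
    have : C'*√(j*h) ≤ C'*√yo := by gcongr
    linarith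
  have qz := C.qz (Γ := Γ) (Qb := Qb) (Kb := Kb) hz hB zl far l2.le K0 (by rw [K1]; linarith) (fun j => by rw [K1]; linarith [q0 j]) κ0 κ1.ge
    hKb.ge (by rw [hQb]; linarith) (by rw [hQb]; linarith) (by rw [← hΓ1]; linarith) (by rw [← hΓ2]; linarith)
    (by
      rw [ldi p!, show τ*Γ*(4*A) = h^2*Γ by rw [C.hτ]; ring]
      nlinarith only [l4, mll h1 (mul_pos hh Γ0).le]) l!
  intro n hn j
  refine abs_le.2 ⟨by rw [hQb]; linarith [hB n hn j], ?_⟩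
  rcases le_or_gt (j*h) yo with hj | hj
  · refine (qz n hn j hj).trans ?_
    have h1 := (le_abs_self _).trans (hz n hn j)
    have h2 := zl n hn j hj
    calc (Ko+n*τ*κ)*zz W h n j ≤ Kb*Z := by
          rw [hKb]; gcongr; linarith
      _ ≤ _ := by rw [hQb]; linarith
  · linarith [far n hn j l!]

theorem g6 {A X c F F' Q Kq : ℝ} (hA : 1 ≤ A) (X0 : 0 < X) (c0 : 0 < c) (F0 : 0 ≤ F) (F0' : 0 ≤ F') (Q0 : 0 ≤ Q) (Kq1 : 1 ≤ Kq) :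
    ∃ K : ℝ, ∃ h₀ > 0, ∀ (W : ℕ → ℕ → ℝ) (f : ℕ → ℝ) (τ h ε : ℝ), 0 < h → h < h₀ → 0 < ε → h^2 = 4*A*τ → Sch A τ f W →
    (∀ n : ℕ, n*τ ≤ X → ∀ j : ℕ, c*mu (ε+j*h) ≤ W n j ∧ W n j ≤ A^2 ∧ |qq W τ n j| ≤ Q) →
    (∀ n : ℕ, n*τ ≤ X → |f n| ≤ F ∧ |f (n+1) - f n| ≤ F'*τ) →
    (∀ j : ℕ, |qq W τ 0 j| ≤ Kq*mu (ε+j*h)) → ∀ n : ℕ, n*τ ≤ X → ∀ j : ℕ, |qq W τ n j| ≤ K*mu (ε+j*h) := by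
  obtain ⟨D, hD⟩ := exr ((Q+2*F)/c + 2*F')
  have hDp : 0 ≤ D := by rw [hD]; positivity
  have sc := sqp c0
  obtain ⟨L, hL⟩ := exr (1 + 4*D/√c)
  have hL1 : 1 ≤ L := by rw [hL]; have : 0 ≤ 4*D/√c := p!
                         linarith
  have hDL : D ≤ √c*L/4 := by
    have e : √c*L/4 = √c/4 + D := by rw [hL]; field_simp
    rw [e]; linarith
  have hL2 : 1 ≤ L^2 := by nlinarith only [hL1]
  obtain ⟨Λ, hΛ⟩ := exr (8*L^2*D)
  have hΛp : 0 ≤ Λ := by rw [hΛ]; positivity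
  obtain ⟨Ko, hKo⟩ := exr (8*L^2*Kq)
  have hK1 : 1 ≤ Ko := by nlinarith only [hKo, hL2, Kq1]
  refine ⟨Ko*exp (X*Λ), 1/(8*L^2), p!, ?_⟩
  intro W f τ h ε hh hlt hε hτ S HW Hf H0
  have tp := S.hτ
  rw [lt_div_iff₀ p!] at hlt
  have pp : ∀ j : ℕ, 0 < ε + j*h := fun j => p!
  have bp : ∀ j : ℕ, 0 < bet L (ε+j*h) := fun j => bet_pos hL1 (pp j)
  have bm : ∀ j : ℕ, bet L (ε+j*h) ≤ mu (ε+j*h) := fun j => (bet_facts hL1 (pp j).le).1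
  have main : ∀ n : ℕ, n*τ ≤ X → ∀ j : ℕ, |qq W τ n j| ≤ Ko*(1+Λ*τ)^n*bet L (ε+j*h) := by
    intro n
    induction n with
    | zero =>
      intro _ j
      refine (H0 j).trans ?_
      calc _ ≤ Kq*(8*L^2*bet L (ε+j*h)) := by gcongr; exact (bet_facts hL1 (pp j).le).2.1
        _ = _ := by rw [hKo]; ring
    | succ n ih =>
      intro hn j
      have hn1 := hn
      push_cast at hn
      have hn' : n*τ ≤ X := l!
      have ih := ih hn'
      have p1 : 1 ≤ (1+Λ*τ)^n := one_le_pow₀ (by have : 0 ≤ Λ*τ := p!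
                                                 linarith)
      rcases j with _ | j
      · rw [S.q0]; simp only [abs_zero]; have := bp 0; positivity
      · have st := S.stepB (n := n) (j := j) (b := fun j => bet L (ε+j*h)) (K := Ko*(1+Λ*τ)^n) (c := c) (R := 0)
          (Fz := Q+2*F) (F' := F') (Λ := Λ) (one_le_mul_of_one_le_of_one_le hK1 p1) c0 bp F0' ih
          (le_trans (by gcongr; exact bm (j+1)) (HW n hn' (j+1)).1)
          (lt_of_lt_of_le (mul_pos c0 (mu_pos (pp _))) (HW _ hn1 (j+1)).1) (HW _ hn1 (j+1)).2.1
          ((aal _ _).trans (by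
            rw [abs_mul 2, abp (by norm_num : (0:ℝ)<2)]; linarith [(HW n hn' (j+1)).2.2, (Hf n hn').1])) (Hf n hn').2
          (by
            have := curvB (t := ε+(j+1:ℕ)*h) (w := W (n+1) (j+1)) hA hτ hL1 hh
              (by push_cast; nlinarith only [hε, hh, mul_nonneg (Nat.cast_nonneg (α := ℝ) j) hh.le]) l! c0 (HW _ hn1 (j+1)).1 hDp hDL
              hΛ.ge
            have e1 : ε+(j+1:ℕ)*h+h = ε+(j+2:ℕ)*h := by push_cast; ring
            have e2 : ε+(j+1:ℕ)*h-h = ε+(j:ℕ)*h := by push_cast; ring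
            rw [e1, e2] at this
            rw [← hD]; exact this)
        calc _ ≤ _ := st
          _ = _ := by rw [pow_succ]; ring
  intro n hn j
  refine (main n hn j).trans ?_
  have e1 : (1+Λ*τ)^n ≤ exp (X*Λ) := (pow_le_exp' p! n).trans (Real.exp_le_exp.2 (by
    calc n*(Λ*τ) = (n*τ)*Λ := by ring
      _ ≤ _ := by gcongr))
  have := bm j; have := (bp j).le
  gcongr

noncomputable def ul (s : ℕ → ℝ) : ℝ := limUnder (hyperfilter ℕ : Filter ℕ) s

lemma ul_tendsto {s : ℕ → ℝ} {B : ℝ} (h : ∀ ν, |s ν| ≤ B) :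
    Tendsto s (hyperfilter ℕ) (𝓝 (ul s)) := by
  obtain ⟨x, -, hx⟩ := isCompact_Icc.ultrafilter_le_nhds (Ultrafilter.map s (hyperfilter ℕ))
    (s := Icc (-B) B) (by
      rw [le_principal_iff]
      show s ⁻¹' Icc (-B) B ∈ hyperfilter ℕ
      exact univ_mem' fun ν => abs_le.1 (h ν))
  exact tendsto_nhds_limUnder ⟨x, hx⟩

lemma disc_deriv {F G : ℕ → ℝ} {s t ω : ℝ} {J J' : ℕ} (hs : 0 ≤ s) (hJ : J ≤ J')
    (h : ∀ k, F (k+1) - F k = s*G k) (hG : ∀ k, J ≤ k → k < J' → |G k - t| ≤ ω) :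
    |F J' - F J - ((J':ℝ)-J)*s*t| ≤ ((J':ℝ)-J)*s*ω := by
  induction J', hJ using Nat.le_induction with
  | base => simp
  | succ J' hJ ih =>
    have ih := ih fun k h1 h2 => hG k h1 (by omega)
    have g := mll (hG J' hJ (by omega)) hs
    have e : F (J'+1) - F J - (((J'+1:ℕ):ℝ)-J)*s*t
      = (F J' - F J - ((J':ℝ)-J)*s*t) + s*(G J' - t) := by
      push_cast; linear_combination h J'
    rw [e]
    refine (aal _ _).trans ?_
    rw [abs_mul, abn hs]
    push_cast
    linarith

/-- approximating sequence -/
structure Appr (wo f p : ℝ → ℝ) (U2 X c M K A F F' : ℝ) (ε h τ : ℕ → ℝ)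
    (W : ℕ → ℕ → ℕ → ℝ) : Prop where
  X0 : 0 < X
  ctx : ∀ ν, Ctx (W ν) (fun n => f (n*τ ν)) A (τ ν) X c M K (ε ν) (h ν) F F'
  eps : Tendsto ε atTop (𝓝 0)
  hz : Tendsto h atTop (𝓝 0)
  tau : Tendsto τ atTop (𝓝 0)
  ini : ∀ ν j, W ν 0 j = wo (ε ν + j*h ν)
  modq : ∀ δ > 0, ∃ N > 0, ∀ᶠ ν in atTop, ∀ n : ℕ, n*τ ν ≤ X → ∀ j i : ℕ,
    |qq (W ν) (τ ν) n (j+i) - qq (W ν) (τ ν) n j| ≤ δ + N*√(i*h ν) ∧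
      ((n+i:ℕ)*τ ν ≤ X → |qq (W ν) (τ ν) (n+i) j - qq (W ν) (τ ν) n j| ≤ δ + N*(i*τ ν))
  inf : ∀ δ > 0, ∃ D, ∀ᶠ ν in atTop, ∀ n : ℕ, n*τ ν ≤ X → ∀ j : ℕ,
    |W ν n j - U2 + 2*(p (n*τ ν) - p 0)| ≤ δ + D*exp (-(ε ν+j*h ν))
  fc : Continuous f
  pc : Continuous p
  wc : ContinuousOn wo (Ici 0)
  w0 : wo 0 = 0

/-- the limit flow in von Mises variables -/
structure VMFlow (wo f p : ℝ → ℝ) (U2 X c M K Z : ℝ) (w q z : ℝ → ℝ → ℝ) : Prop where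
  X0 : 0 < X
  c0 : 0 < c
  K1 : 1 ≤ K
  lo : ∀ x ∈ Icc 0 X, ∀ t ≥ 0, c*mu t ≤ w x t
  hi : ∀ x ∈ Icc 0 X, ∀ t ≥ 0, w x t ≤ M
  qb : ∀ x ∈ Icc 0 X, ∀ t ≥ 0, |q x t| ≤ K*mu t
  zb : ∀ x ∈ Icc 0 X, ∀ t ≥ 0, |z x t| ≤ Z
  qc : ContinuousOn (fun a : ℝ × ℝ => q a.1 a.2) (Icc 0 X ×ˢ Ici 0)
  zc : ContinuousOn (fun a : ℝ × ℝ => z a.1 a.2) (Icc 0 X ×ˢ Ici 0)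
  wx : ∀ x ∈ Icc 0 X, ∀ t ≥ 0, HasDerivWithinAt (fun x => w x t) (q x t) (Icc 0 X) x
  wt : ∀ x ∈ Icc 0 X, ∀ t ≥ 0, HasDerivWithinAt (w x) (z x t) (Ici 0) t
  zt : ∀ x ∈ Icc 0 X, ∀ t > 0, HasDerivAt (z x) ((q x t + 2*f x)/√(w x t)) t
  ini : ∀ t ≥ 0, w 0 t = wo t
  w0 : ∀ x ∈ Icc 0 X, w x 0 = 0
  inf : ∀ x ∈ Icc 0 X, Tendsto (w x) atTop (𝓝 (U2 - 2*(p x - p 0)))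

section
variable {wo f p : ℝ → ℝ} {U2 X c M K A F F' : ℝ} {ε h τ : ℕ → ℝ} {W : ℕ → ℕ → ℕ → ℝ}
local notation "AP" => Appr wo f p U2 X c M K A F F' ε h τ W

lemma idx_tendsto {τ : ℕ → ℝ} (h0 : ∀ ν, 0 < τ ν) (ht : Tendsto τ atTop (𝓝 0)) {x : ℝ} (hx : 0 ≤ x) :
    Tendsto (fun ν => (⌊x/τ ν⌋₊:ℝ)*τ ν) (hyperfilter ℕ) (𝓝 x) := by
  have : Tendsto (fun ν => (⌊x/τ ν⌋₊:ℝ)*τ ν) atTop (𝓝 x) := by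
    have h1 : Tendsto (fun ν => x - τ ν) atTop (𝓝 x) := by simpa using tendsto_const_nhds.sub ht
    refine tendsto_of_tendsto_of_tendsto_of_le_of_le h1 tendsto_const_nhds (fun ν => ?_) (fun ν => ?_)
    · have := Nat.lt_floor_add_one (x/τ ν)
      rw [div_lt_iff₀ (h0 ν)] at this
      show x - τ ν ≤ _
      linarith
    · have := Nat.floor_le (div_nonneg hx (h0 ν).le)
      rwa [ldi (h0 ν)] at this
  exact this.mono_left Nat.hyperfilter_le_atTop

lemma idx_le {τ x : ℝ} (h0 : 0 < τ) (hx : 0 ≤ x) : (⌊x/τ⌋₊:ℝ)*τ ≤ x := by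
  have := Nat.floor_le (div_nonneg hx h0.le)
  rwa [ldi h0] at this

noncomputable def lw (W : ℕ → ℕ → ℕ → ℝ) (h τ : ℕ → ℝ) (x t : ℝ) : ℝ :=
  ul fun ν => W ν ⌊x/τ ν⌋₊ ⌊t/h ν⌋₊
noncomputable def lq (W : ℕ → ℕ → ℕ → ℝ) (h τ : ℕ → ℝ) (x t : ℝ) : ℝ :=
  ul fun ν => qq (W ν) (τ ν) ⌊x/τ ν⌋₊ ⌊t/h ν⌋₊
noncomputable def lz (W : ℕ → ℕ → ℕ → ℝ) (h τ : ℕ → ℝ) (x t : ℝ) : ℝ :=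
  ul fun ν => zz (W ν) (h ν) ⌊x/τ ν⌋₊ ⌊t/h ν⌋₊

lemma Appr.nX (P : AP) {x : ℝ} (hx : x ∈ Icc 0 X) (ν : ℕ) :
    (⌊x/τ ν⌋₊:ℝ)*τ ν ≤ X := (idx_le (P.ctx ν).S.hτ hx.1).trans hx.2

lemma Appr.tw (P : AP) {x : ℝ} (hx : x ∈ Icc 0 X) (t : ℝ) :
    Tendsto (fun ν => W ν ⌊x/τ ν⌋₊ ⌊t/h ν⌋₊) (hyperfilter ℕ) (𝓝 (lw W h τ x t)) :=
  ul_tendsto (B := M) fun ν => by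
    rw [abp ((P.ctx ν).Wp (P.nX hx ν) _)]
    exact ((P.ctx ν).B _ (P.nX hx ν) _).2.1

lemma Appr.tq (P : AP) {x : ℝ} (hx : x ∈ Icc 0 X) (t : ℝ) :
    Tendsto (fun ν => qq (W ν) (τ ν) ⌊x/τ ν⌋₊ ⌊t/h ν⌋₊) (hyperfilter ℕ) (𝓝 (lq W h τ x t)) :=
  ul_tendsto (B := K) fun ν => ((P.ctx ν).B _ (P.nX hx ν) _).2.2.trans
    (ml1 (by linarith [(P.ctx ν).hK]) (mu_le_one _))

lemma Appr.tz (P : AP) {x : ℝ} (hx : x ∈ Icc 0 X) (t : ℝ) :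
    Tendsto (fun ν => zz (W ν) (h ν) ⌊x/τ ν⌋₊ ⌊t/h ν⌋₊) (hyperfilter ℕ) (𝓝 (lz W h τ x t)) :=
  ul_tendsto fun ν => (P.ctx ν).zbd (P.nX hx ν) _

lemma Appr.tn (P : AP) {x : ℝ} (hx : 0 ≤ x) :
    Tendsto (fun ν => (⌊x/τ ν⌋₊:ℝ)*τ ν) (hyperfilter ℕ) (𝓝 x) :=
  idx_tendsto (fun ν => (P.ctx ν).S.hτ) P.tau hx

lemma Appr.tj (P : AP) {t : ℝ} (ht : 0 ≤ t) :
    Tendsto (fun ν => (⌊t/h ν⌋₊:ℝ)*h ν) (hyperfilter ℕ) (𝓝 t) :=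
  idx_tendsto (fun ν => (P.ctx ν).hh) P.hz ht

lemma Appr.tp (P : AP) {t : ℝ} (ht : 0 ≤ t) :
    Tendsto (fun ν => ε ν + (⌊t/h ν⌋₊:ℝ)*h ν) (hyperfilter ℕ) (𝓝 t) := by
  simpa using (P.eps.mono_left Nat.hyperfilter_le_atTop).add (P.tj ht)

lemma cont_mu : Continuous mu := by unfold mu; fun_prop

lemma Appr.wlo (P : AP) {x : ℝ} (hx : x ∈ Icc 0 X) {t : ℝ} (ht : 0 ≤ t) :
    c*mu t ≤ lw W h τ x t ∧ lw W h τ x t ≤ M ∧ |lq W h τ x t| ≤ K*mu t ∧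
    |lz W h τ x t| ≤ M + 5*((K+2*F)/√c) := by
  have tm : Tendsto (fun ν => mu (ε ν + (⌊t/h ν⌋₊:ℝ)*h ν)) (hyperfilter ℕ) (𝓝 (mu t)) :=
    (cont_mu.tendsto t).comp (P.tp ht)
  refine ⟨le_of_tendsto_of_tendsto' (tm.const_mul c) (P.tw hx t) fun ν => ((P.ctx ν).B _ (P.nX hx ν) _).1,
    le_of_tendsto' (P.tw hx t) fun ν => ((P.ctx ν).B _ (P.nX hx ν) _).2.1,
    le_of_tendsto_of_tendsto' (P.tq hx t).abs (tm.const_mul K) fun ν => ((P.ctx ν).B _ (P.nX hx ν) _).2.2,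
    le_of_tendsto' (P.tz hx t).abs fun ν => (P.ctx ν).zbd (P.nX hx ν) _⟩

lemma Appr.idx (P : AP) {t t' : ℝ} (htt : t ≤ t') (ν : ℕ) :
    ∃ i, ⌊t'/h ν⌋₊ = ⌊t/h ν⌋₊ + i := by
  refine Nat.exists_eq_add_of_le (Nat.floor_mono ?_)
  have := (P.ctx ν).hh
  gcongr

lemma Appr.idn (P : AP) {t t' : ℝ} (htt : t ≤ t') (ν : ℕ) :
    ∃ i, ⌊t'/τ ν⌋₊ = ⌊t/τ ν⌋₊ + i := by
  refine Nat.exists_eq_add_of_le (Nat.floor_mono ?_)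
  have := (P.ctx ν).S.hτ
  gcongr

lemma Appr.qmod (P : AP) {δ : ℝ} (hδ : 0 < δ) :
    ∃ N > 0, (∀ x ∈ Icc 0 X, ∀ t ≥ 0, ∀ t' ≥ t, |lq W h τ x t' - lq W h τ x t| ≤ δ + N*√(t'-t)) ∧
     (∀ t ≥ 0, ∀ x ∈ Icc 0 X, ∀ x' ∈ Icc 0 X, x ≤ x' → |lq W h τ x' t - lq W h τ x t| ≤ δ + N*(x'-x)) ∧
     (∀ t ≥ 0, ∀ x ∈ Icc 0 X, ∀ x' ∈ Icc 0 X, x ≤ x' →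
        |lw W h τ x' t - lw W h τ x t - (x'-x)*lq W h τ x t| ≤ (x'-x)*(δ+N*(x'-x))) := by
  obtain ⟨N, hN, ev⟩ := P.modq δ hδ
  have ev := ev.filter_mono Nat.hyperfilter_le_atTop
  refine ⟨N, hN, ?_, ?_, ?_⟩
  · intro x hx t ht t' htt
    have l1 := ((P.tq hx t').sub (P.tq hx t)).abs
    have l2 : Tendsto (fun ν => δ + N*√((⌊t'/h ν⌋₊:ℝ)*h ν - (⌊t/h ν⌋₊:ℝ)*h ν)) (hyperfilter ℕ)
      (𝓝 (δ + N*√(t'-t))) := (((P.tj (ht.trans htt)).sub (P.tj ht)).sqrt.const_mul N).const_add δ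
    refine le_of_tendsto_of_tendsto l1 l2 ?_
    filter_upwards [ev] with ν hν
    obtain ⟨i, hi⟩ := P.idx htt ν
    rw [hi]
    have e : ((⌊t/h ν⌋₊+i:ℕ):ℝ)*h ν - ⌊t/h ν⌋₊*h ν = i*h ν := by push_cast; ring
    rw [e]
    exact (hν _ (P.nX hx ν) ⌊t/h ν⌋₊ i).1
  · intro t ht x hx x' hx' hxx
    have l1 := ((P.tq hx' t).sub (P.tq hx t)).abs
    have l2 : Tendsto (fun ν => δ + N*((⌊x'/τ ν⌋₊:ℝ)*τ ν - (⌊x/τ ν⌋₊:ℝ)*τ ν)) (hyperfilter ℕ)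
      (𝓝 (δ + N*(x'-x))) := (((P.tn hx'.1).sub (P.tn hx.1)).const_mul N).const_add δ
    refine le_of_tendsto_of_tendsto l1 l2 ?_
    filter_upwards [ev] with ν hν
    obtain ⟨i, hi⟩ := P.idn hxx ν
    have := P.nX hx' ν
    rw [hi] at this ⊢
    have e : ((⌊x/τ ν⌋₊+i:ℕ):ℝ)*τ ν - ⌊x/τ ν⌋₊*τ ν = i*τ ν := by push_cast; ring
    rw [e]
    exact (hν _ (P.nX hx ν) ⌊t/h ν⌋₊ i).2 this
  · intro t ht x hx x' hx' hxx
    have d := (P.tn hx'.1).sub (P.tn hx.1)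
    have l1 := (((P.tw hx' t).sub (P.tw hx t)).sub (d.mul (P.tq hx t))).abs
    have l2 := d.mul ((d.const_mul N).const_add δ)
    refine le_of_tendsto_of_tendsto l1 l2 ?_
    filter_upwards [ev] with ν hν
    have hτ := (P.ctx ν).S.hτ
    have n' := P.nX hx' ν
    obtain ⟨i, hi⟩ := P.idn hxx ν
    have := disc_deriv (F := fun n => W ν n ⌊t/h ν⌋₊) (G := fun n => qq (W ν) (τ ν) n ⌊t/h ν⌋₊) (s := τ ν)
      (t := qq (W ν) (τ ν) ⌊x/τ ν⌋₊ ⌊t/h ν⌋₊) (J := ⌊x/τ ν⌋₊) (J' := ⌊x'/τ ν⌋₊)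
      (ω := δ + N*((⌊x'/τ ν⌋₊:ℝ)*τ ν - (⌊x/τ ν⌋₊:ℝ)*τ ν)) hτ.le (by omega)
      (fun k => by show W ν (k+1) _ - W ν k _ = _; rw [(P.ctx ν).S.Wq]; ring) (by
        intro k h1 h2
        obtain ⟨l, rfl⟩ := Nat.exists_eq_add_of_le h1
        have hk : ((⌊x/τ ν⌋₊+l:ℕ):ℝ)*τ ν ≤ ⌊x'/τ ν⌋₊*τ ν := by gcongr
        refine ((hν _ (P.nX hx ν) ⌊t/h ν⌋₊ l).2 (hk.trans n')).trans ?_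
        push_cast at hk
        gcongr
        linarith)
    rw [sub_mul] at this
    exact this

lemma cont_Phi : Continuous Phi := by unfold Phi; fun_prop

lemma Phi_mono {a b : ℝ} (h : a ≤ b) : Phi a ≤ Phi b := by
  unfold Phi; have := sqm h; linarith

lemma Appr.zmod (P : AP) {x : ℝ} (hx : x ∈ Icc 0 X)
    {t t' : ℝ} (ht : 0 ≤ t) (htt : t ≤ t') :
    |lz W h τ x t' - lz W h τ x t| ≤ (K+2*F)/√c*(Phi t' - Phi t) ∧
    |lw W h τ x t' - lw W h τ x t - (t'-t)*lz W h τ x t| ≤ (t'-t)*((K+2*F)/√c*(Phi t' - Phi t)) := by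
  have tP : Tendsto (fun ν => (K+2*F)/√c*(Phi (ε ν + (⌊t'/h ν⌋₊:ℝ)*h ν) - Phi (ε ν + (⌊t/h ν⌋₊:ℝ)*h ν)))
      (hyperfilter ℕ) (𝓝 ((K+2*F)/√c*(Phi t' - Phi t))) :=
    (((cont_Phi.tendsto t').comp (P.tp (ht.trans htt))).sub ((cont_Phi.tendsto t).comp (P.tp ht))).const_mul _
  constructor
  · refine le_of_tendsto_of_tendsto' ((P.tz hx t').sub (P.tz hx t)).abs tP fun ν => ?_
    obtain ⟨i, hi⟩ := P.idx htt ν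
    rw [hi]
    exact (P.ctx ν).zmod (P.nX hx ν) _ _
  · have d := (P.tj (ht.trans htt)).sub (P.tj ht)
    refine le_of_tendsto_of_tendsto' (((P.tw hx t').sub (P.tw hx t)).sub (d.mul (P.tz hx t))).abs
      (d.mul tP) fun ν => ?_
    obtain ⟨i, hi⟩ := P.idx htt ν
    have hh := (P.ctx ν).hh
    have F0 := (P.ctx ν).hF
    have K0 := (P.ctx ν).hK
    have := disc_deriv (F := fun j => W ν ⌊x/τ ν⌋₊ j) (G := fun j => zz (W ν) (h ν) ⌊x/τ ν⌋₊ j) (s := h ν)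
      (t := zz (W ν) (h ν) ⌊x/τ ν⌋₊ ⌊t/h ν⌋₊) (J := ⌊t/h ν⌋₊) (J' := ⌊t'/h ν⌋₊)
      (ω := (K+2*F)/√c*(Phi (ε ν + (⌊t'/h ν⌋₊:ℝ)*h ν) - Phi (ε ν + (⌊t/h ν⌋₊:ℝ)*h ν))) hh.le (by omega)
      (fun k => by unfold zz; field_simp) (by
        intro k h1 h2
        obtain ⟨l, rfl⟩ := Nat.exists_eq_add_of_le h1
        refine ((P.ctx ν).zmod (P.nX hx ν) _ _).trans ?_
        gcongr
        exact Phi_mono (by gcongr))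
    rw [sub_mul] at this
    exact this

lemma deriv_of_fwd {F g : ℝ → ℝ} {s : Set ℝ} (hg : ContinuousOn g s)
    (h : ∀ ε > 0, ∃ d > 0, ∀ a ∈ s, ∀ b ∈ s, a ≤ b → b - a < d → |F b - F a - (b-a)*g a| ≤ ε*(b-a))
    {x : ℝ} (hx : x ∈ s) : HasDerivWithinAt F (g x) s x := by
  rw [hasDerivWithinAt_iff_isLittleO, Asymptotics.isLittleO_iff]
  intro ε hε
  obtain ⟨d, hd, H⟩ := h (ε/2) p!
  obtain ⟨d', hd', H'⟩ := Metric.continuousOn_iff.1 hg x hx (ε/2) p!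
  filter_upwards [self_mem_nhdsWithin, mem_nhdsWithin_of_mem_nhds (Metric.ball_mem_nhds x (lt_min hd hd'))]
    with y hy hb
  rw [Metric.mem_ball] at hb
  have b1 := hb.trans_le (min_le_left _ _)
  have b2 := H' y hy (hb.trans_le (min_le_right _ _))
  rw [Real.dist_eq] at b1 b2
  rw [smul_eq_mul, Real.norm_eq_abs, Real.norm_eq_abs]
  rcases le_total x y with hxy | hxy
  · have := H x hx y hy hxy ((le_abs_self _).trans_lt b1)
    rw [abn (sbn hxy)]
    nlinarith
  · have := H y hy x hx hxy (by rw [abc] at b1; exact (le_abs_self _).trans_lt b1)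
    rw [abc y x, abn (sbn hxy)]
    have e : F y - F x - (y-x)*g x = -(F x - F y - (x-y)*g y) + (x-y)*(g x - g y) := by ring
    rw [e]
    refine (aal _ _).trans ?_
    rw [abs_neg, abs_mul, abn (sbn hxy), abc (g x)]
    nlinarith [mll b2.le (sbn hxy)]

lemma cont_sep {Q : ℝ → ℝ → ℝ} {I T : Set ℝ}
    (hA : ∀ t ∈ T, ∀ δ > 0, ∃ d > 0, ∀ x ∈ I, ∀ t' ∈ T, |t' - t| < d → |Q x t' - Q x t| ≤ δ)
    (hB : ∀ t ∈ T, ContinuousOn (fun x => Q x t) I) :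
    ContinuousOn (fun a : ℝ × ℝ => Q a.1 a.2) (I ×ˢ T) := by
  rw [Metric.continuousOn_iff]
  rintro ⟨x, t⟩ ⟨hx, ht⟩ ε hε
  obtain ⟨d, hd, H⟩ := hA t ht (ε/2) p!
  obtain ⟨d', hd', H'⟩ := Metric.continuousOn_iff.1 (hB t ht) x hx (ε/2) p!
  refine ⟨min d d', lt_min hd hd', ?_⟩
  rintro ⟨y, r⟩ ⟨hy, hr⟩ hdist
  rw [Prod.dist_eq, max_lt_iff] at hdist
  have h1 := H y hy r hr (hdist.2.trans_le (min_le_left _ _))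
  have h2 := H' y hy (hdist.1.trans_le (min_le_right _ _))
  rw [Real.dist_eq] at h2 ⊢
  have := abs_sub_le (Q y r) (Q y t) (Q x t)
  simp only at *
  linarith

lemma small_of_cont {g : ℝ → ℝ} (hg : Continuous g) (h0 : g 0 = 0) {δ : ℝ} (hδ : 0 < δ) :
    ∃ d > 0, ∀ s : ℝ, |s| < d → g s ≤ δ := by
  obtain ⟨d, hd, H⟩ := Metric.continuous_iff.1 hg 0 δ hδ
  refine ⟨d, hd, fun s hs => ?_⟩
  have := H s (by simpa [Real.dist_eq] using hs)
  rw [h0, Real.dist_eq, sub_zero] at this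
  exact (le_abs_self _).trans this.le

lemma Appr.zder (P : AP) {x : ℝ} (hx : x ∈ Icc 0 X)
    {tr δ : ℝ} (hto : 0 < tr) (hδ : 0 < δ) : ∃ N > 0, ∀ t ≥ tr, ∀ t' ≥ t,
    |lz W h τ x t' - lz W h τ x t - (t'-t)*((lq W h τ x t + 2*f x)/√(lw W h τ x t))|
      ≤ (t'-t)*(δ + N*(√(t'-t)+(t'-t))) := by
  have c0 := (P.ctx 0).hc
  have K0 := (P.ctx 0).hK
  have F0 := (P.ctx 0).hF
  obtain ⟨α, hα⟩ := exr (√(c*mu (tr/2)))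
  have m0 : 0 < mu (tr/2) := mu_pos p!
  have α0 : 0 < α := by rw [hα]; positivity
  obtain ⟨Z, hZ⟩ := exr (M + 5*((K+2*F)/√c))
  have Zb := fun ν j => (P.ctx ν).zbd (P.nX hx ν) j
  rw [← hZ] at Zb
  have Z0 : 0 ≤ Z := (abs_nonneg _).trans (Zb 0 0)
  obtain ⟨N, hN, ev⟩ := P.modq (δ*α) p!
  have ev := ev.filter_mono Nat.hyperfilter_le_atTop
  refine ⟨N/α + (K+2*F)*Z/α^3, p!, fun t ht t' htt => ?_⟩
  have t0 : 0 ≤ t := hto.le.trans ht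
  have wp : 0 < lw W h τ x t := lt_of_lt_of_le (mul_pos c0 (mu_pos (lt_of_lt_of_le hto ht))) (P.wlo hx t0).1
  have d := (P.tj (t0.trans htt)).sub (P.tj t0)
  have dh := d.add (P.hz.mono_left Nat.hyperfilter_le_atTop)
  rw [add_zero] at dh
  have tf : Tendsto (fun ν => f (⌊x/τ ν⌋₊*τ ν)) (hyperfilter ℕ) (𝓝 (f x)) := (P.fc.tendsto x).comp (P.tn hx.1)
  have tg := ((P.tq hx t).add (tf.const_mul 2)).div (P.tw hx t).sqrt (sqp wp).ne'
  refine le_of_tendsto_of_tendsto (((P.tz hx t').sub (P.tz hx t)).sub (d.mul tg)).abs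
    (d.mul (((dh.sqrt.add dh).const_mul (N/α + (K+2*F)*Z/α^3)).const_add δ)) ?_
  filter_upwards [ev, (P.tp t0).eventually_const_le (show tr/2 < t by linarith)] with ν hν hlow
  have hh := (P.ctx ν).hh
  have hn := P.nX hx ν
  obtain ⟨i, hi⟩ := P.idx htt ν
  have low : ∀ l : ℕ, α ≤ √(W ν ⌊x/τ ν⌋₊ (⌊t/h ν⌋₊+l)) := fun l => by
    rw [hα]
    refine sqm (le_trans ?_ ((P.ctx ν).B _ hn _).1)
    have : tr/2 ≤ ε ν + (⌊t/h ν⌋₊+l:ℕ)*h ν := by push_cast; nlinarith [(Nat.cast_nonneg l : (0:ℝ) ≤ l)]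
    gcongr
    exact min_le_min_right _ this
  have := disc_deriv (F := fun j => zz (W ν) (h ν) ⌊x/τ ν⌋₊ j)
      (G := fun j => (qq (W ν) (τ ν) ⌊x/τ ν⌋₊ (j+1) + 2*f (⌊x/τ ν⌋₊*τ ν))/√(W ν ⌊x/τ ν⌋₊ (j+1))) (s := h ν)
      (t := (qq (W ν) (τ ν) ⌊x/τ ν⌋₊ ⌊t/h ν⌋₊ + 2*f (⌊x/τ ν⌋₊*τ ν))/√(W ν ⌊x/τ ν⌋₊ ⌊t/h ν⌋₊))
      (J := ⌊t/h ν⌋₊) (J' := ⌊t'/h ν⌋₊)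
      (ω := δ + (N/α + (K+2*F)*Z/α^3)*(√((⌊t'/h ν⌋₊:ℝ)*h ν - (⌊t/h ν⌋₊:ℝ)*h ν + h ν)
        + ((⌊t'/h ν⌋₊:ℝ)*h ν - (⌊t/h ν⌋₊:ℝ)*h ν + h ν))) hh.le (by omega)
      (fun k => by
        show zz (W ν) (h ν) _ (k+1) - zz (W ν) (h ν) _ k = _
        rw [(P.ctx ν).zstep hn]) (by
        intro k h1 h2
        obtain ⟨l, rfl⟩ := Nat.exists_eq_add_of_le h1
        have dW := disc_deriv (F := fun j => W ν ⌊x/τ ν⌋₊ j) (G := fun j => zz (W ν) (h ν) ⌊x/τ ν⌋₊ j)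
          (s := h ν) (t := 0) (J := ⌊t/h ν⌋₊) (J' := ⌊t/h ν⌋₊+(l+1)) (ω := Z) hh.le (by omega)
          (fun k => by unfold zz; field_simp) (fun k _ _ => by rw [sub_zero]; exact Zb ν k)
        have dq := (hν _ hn ⌊t/h ν⌋₊ (l+1)).1
        have a0 := low 0
        have a1 := low (l+1)
        have p0 := (P.ctx ν).Wp hn ⌊t/h ν⌋₊
        have p1 := (P.ctx ν).Wp hn (⌊t/h ν⌋₊+(l+1))
        have qb := ((P.ctx ν).B _ hn ⌊t/h ν⌋₊).2.2
        have qb := qb.trans (ml1 l! (mu_le_one _))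
        have fb := (P.ctx ν).f1 _ hn
        have S0 := sqs p0.le
        have S1 := sqs p1.le
        have hl : ((l+1:ℕ):ℝ)*h ν ≤ (⌊t'/h ν⌋₊:ℝ)*h ν - (⌊t/h ν⌋₊:ℝ)*h ν + h ν := by
          have : ((⌊t/h ν⌋₊+l:ℕ):ℝ)*h ν ≤ (⌊t'/h ν⌋₊:ℝ)*h ν := by gcongr
          push_cast at this ⊢
          linarith
        have e1 : (((⌊t/h ν⌋₊+(l+1):ℕ):ℝ)-⌊t/h ν⌋₊) = ((l+1:ℕ):ℝ) := by push_cast; ring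
        rw [e1, mul_zero, sub_zero] at dW
        have l0 : 0 ≤ ((l+1:ℕ):ℝ)*h ν := p!
        rw [add_zero] at a0
        rw [← add_assoc] at a1 p1 S1 dq dW
        show |(qq (W ν) (τ ν) ⌊x/τ ν⌋₊ (⌊t/h ν⌋₊+l+1) + _)/√(W ν ⌊x/τ ν⌋₊ (⌊t/h ν⌋₊+l+1)) - _| ≤ _
        generalize √(W ν ⌊x/τ ν⌋₊ (⌊t/h ν⌋₊+l+1)) = b, √(W ν ⌊x/τ ν⌋₊ ⌊t/h ν⌋₊) = a, qq (W ν) (τ ν) ⌊x/τ ν⌋₊ (⌊t/h ν⌋₊+l+1) = q', qq (W ν) (τ ν) ⌊x/τ ν⌋₊ ⌊t/h ν⌋₊ = q, f (⌊x/τ ν⌋₊*τ ν) = g, (⌊t'/h ν⌋₊:ℝ)*h ν - (⌊t/h ν⌋₊:ℝ)*h ν + h ν = S, ((l+1:ℕ):ℝ)*h ν = s at *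
        have ap : 0 < a := l!
        have bp : 0 < b := l!
        have ab : |a - b| ≤ Z*s/α := by
          rw [ldi α0]
          have : |a-b| * (a+b) = |b^2-a^2| := by
            rw [← abp (l! : 0 < a+b), ← abs_mul, ← abs_neg]; congr 1
            ring
          rw [S0, S1] at this
          have h3 : |a-b| * α ≤ |a-b| * (a+b) := by gcongr; linarith
          linarith
        have e : (q'+2*g)/b - (q+2*g)/a = (q'-q)/b + (q+2*g)*(a-b)/(a*b) := by field_simp; ring
        rw [e]
        refine (aal _ _).trans ?_
        rw [abs_div, abs_div, abs_mul, abp bp, abp (mul_pos ap bp)]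
        have g1 : |q'-q|/b ≤ (δ*α+N*√S)/α := by
          refine div_le_div₀ p! (dq.trans ?_) α0 a1
          gcongr
        have g2 : |q+2*g| ≤ K+2*F := by
          refine (aal _ _).trans ?_
          rw [abs_mul 2, abp (by norm_num : (0:ℝ)<2)]; linarith
        have g3 : |q+2*g| * |a-b|/(a*b) ≤ (K+2*F)*(Z*S/α)/(α*α) := by
          refine div_le_div₀ (by have := l0.trans hl; positivity) ?_ p! (by gcongr)
          refine mul_le_mul g2 (ab.trans ?_) (abs_nonneg _) p!
          gcongr
        have S0' := l0.trans hl
        have g4 : (δ*α+N*√S)/α + (K+2*F)*(Z*S/α)/(α*α) = δ + (N/α)*√S + (K+2*F)*Z/α^3*S := by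
          field_simp
        have g5 : 0 ≤ N/α*S := p!
        have g6 : 0 ≤ (K+2*F)*Z/α^3*√S := p!
        linarith)
  rw [sub_mul] at this
  exact this

theorem Appr.flow (P : AP) :
    VMFlow wo f p U2 X c M K (M + 5*((K+2*F)/√c)) (lw W h τ) (lq W h τ) (lz W h τ) := by
  have c0 := (P.ctx 0).hc
  have K0 := (P.ctx 0).hK
  have F0 := (P.ctx 0).hF
  have C0 : 0 ≤ (K+2*F)/√c := p!
  have sq : ∀ N, Continuous fun s : ℝ => N*√|s| := fun N => by fun_prop
  have qt : ∀ t ∈ Ici (0:ℝ), ∀ δ > 0, ∃ d > 0, ∀ x ∈ Icc 0 X, ∀ t' ∈ Ici (0:ℝ), |t'-t| < d →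
      |lq W h τ x t' - lq W h τ x t| ≤ δ := by
    intro t ht δ hδ
    obtain ⟨N, hN, H, -⟩ := P.qmod (δ := δ/2) p!
    obtain ⟨d, hd, hs⟩ := small_of_cont (sq N) (by simp) (δ := δ/2) p!
    refine ⟨d, hd, fun x hx t' ht' htt => ?_⟩
    have := hs _ htt
    rcases le_total t t' with l | l
    · have := H x hx t ht t' l
      rw [abn (sbn l)] at *
      linarith
    · have := H x hx t' ht' t l
      rw [abc t', abn (sbn l)] at *
      rw [abc]
      linarith
  have qx : ∀ t ∈ Ici (0:ℝ), ContinuousOn (fun x => lq W h τ x t) (Icc 0 X) := by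
    intro t ht
    rw [Metric.continuousOn_iff]
    intro x hx δ hδ
    obtain ⟨N, hN, -, H, -⟩ := P.qmod (δ := δ/2) p!
    refine ⟨δ/(2*N), p!, fun x' hx' hd => ?_⟩
    rw [Real.dist_eq] at *
    rw [lt_div_iff₀ p!] at hd
    rcases le_total x x' with l | l
    · have := H t ht x hx x' hx' l
      rw [abn (sbn l)] at hd
      linarith
    · have := H t ht x' hx' x hx l
      rw [abc x', abn (sbn l)] at hd
      rw [abc]
      linarith
  have wx : ∀ x ∈ Icc 0 X, ∀ t ≥ 0, HasDerivWithinAt (fun x => lw W h τ x t) (lq W h τ x t) (Icc 0 X) x := by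
    intro x hx t ht
    refine deriv_of_fwd (g := fun x => lq W h τ x t) (qx t ht) (fun δ hδ => ?_) hx
    obtain ⟨N, hN, -, -, H⟩ := P.qmod (δ := δ/2) p!
    refine ⟨δ/(2*N), p!, fun a ha b hb hab hd => (H t ht a ha b hb hab).trans ?_⟩
    rw [lt_div_iff₀ p!] at hd
    rw [mul_comm]
    have := sbn hab
    gcongr
    linarith
  have Pt : ∀ t ≥ (0:ℝ), ∀ δ > 0, ∃ d > 0, ∀ t' ≥ (0:ℝ), |t'-t| < d → (K+2*F)/√c*|Phi t' - Phi t| ≤ δ := by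
    intro t ht δ hδ
    obtain ⟨d, hd, H⟩ := small_of_cont (g := fun s => (K+2*F)/√c*|Phi (t+s) - Phi t|)
      (by have := cont_Phi; fun_prop) (by simp) hδ
    exact ⟨d, hd, fun t' _ h => by have := H _ h; simpa using this⟩
  have zt : ∀ t ∈ Ici (0:ℝ), ∀ δ > 0, ∃ d > 0, ∀ x ∈ Icc 0 X, ∀ t' ∈ Ici (0:ℝ), |t'-t| < d →
      |lz W h τ x t' - lz W h τ x t| ≤ δ := by
    intro t ht δ hδ
    obtain ⟨d, hd, H⟩ := Pt t ht δ hδ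
    refine ⟨d, hd, fun x hx t' ht' htt => le_trans ?_ (H t' ht' htt)⟩
    rcases le_total t t' with l | l
    · refine (P.zmod hx ht l).1.trans ?_
      gcongr
      exact le_abs_self _
    · rw [abc, abc (Phi t')]
      refine (P.zmod hx ht' l).1.trans ?_
      gcongr
      exact le_abs_self _
  have zc := cont_sep (Q := lz W h τ) (I := Icc 0 X) (T := Ici 0) zt (by
    intro t ht
    rw [Metric.continuousOn_iff]
    intro x hx δ hδ
    obtain ⟨d, hd, H⟩ := Pt t ht (δ/4) p!
    have ht : (0:ℝ) ≤ t := ht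
    have s0 : 0 < d/2 := p!
    have hP := H (t+d/2) p! (by rw [add_sub_cancel_left, abp s0]; linarith)
    have cw : ContinuousOn (fun x => (lw W h τ x (t+d/2) - lw W h τ x t)/(d/2)) (Icc 0 X) := by
      have h1 : ContinuousOn (fun x => lw W h τ x (t+d/2)) (Icc 0 X) :=
        fun x hx => (wx x hx _ p!).continuousWithinAt
      have h2 : ContinuousOn (fun x => lw W h τ x t) (Icc 0 X) := fun x hx => (wx x hx _ ht).continuousWithinAt
      fun_prop
    have ap : ∀ x ∈ Icc 0 X, |(lw W h τ x (t+d/2) - lw W h τ x t)/(d/2) - lz W h τ x t| ≤ δ/4 := by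
      intro x hx
      have := (P.zmod hx ht (show t ≤ t+d/2 by linarith)).2
      rw [add_sub_cancel_left] at this
      rw [← mul_le_mul_iff_right₀ s0, ← abp s0, ← abs_mul, abp s0, mul_sub, mul_div_cancel₀ _ s0.ne']
      refine this.trans ?_
      gcongr
      refine le_trans ?_ hP
      gcongr
      exact le_abs_self _
    obtain ⟨d', hd', H'⟩ := Metric.continuousOn_iff.1 cw x hx (δ/4) p!
    refine ⟨d', hd', fun x' hx' hdd => ?_⟩
    have h1 := H' x' hx' hdd
    rw [Real.dist_eq] at h1 ⊢
    have h2 := ap x hx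
    have h3 := ap x' hx'
    rw [abs_lt] at *
    rw [abs_le] at *
    constructor <;> linarith)
  have wt : ∀ x ∈ Icc 0 X, ∀ t ≥ 0, HasDerivWithinAt (lw W h τ x) (lz W h τ x t) (Ici 0) t := by
    intro x hx t ht
    refine deriv_of_fwd (g := fun t => lz W h τ x t) (s := Ici 0) ?_ (fun δ hδ => ?_) ht
    · exact zc.comp (f := fun t => (x,t)) (by fun_prop) fun t ht => ⟨hx, ht⟩
    have Pu : ∃ d > 0, ∀ a ≥ (0:ℝ), ∀ b ≥ a, b - a < d → (K+2*F)/√c*(Phi b - Phi a) ≤ δ := by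
      obtain ⟨d, hd, H⟩ := Pt 0 le_rfl δ hδ
      refine ⟨d, hd, fun a ha b hb hab => le_trans ?_ (H (b-a) l! (by rwa [sub_zero, abn l!]))⟩
      gcongr
      refine le_trans ?_ (le_abs_self _)
      unfold Phi
      have : √b ≤ √(b-a) + √a := by
        refine Real.sqrt_le_iff.2 ⟨p!, ?_⟩
        nlinarith only [sqs ha, sqs (sbn hb), mul_nonneg (Real.sqrt_nonneg (b-a)) (Real.sqrt_nonneg a)]
      rw [Real.sqrt_zero]
      linarith
    obtain ⟨d, hd, H⟩ := Pu
    refine ⟨d, hd, fun a ha b hb hab hd => (P.zmod hx ha hab).2.trans ?_⟩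
    rw [mul_comm]
    have := sbn hab
    gcongr
    exact H a ha b hab hd
  refine ⟨P.X0, c0, K0, fun x hx t ht => (P.wlo hx ht).1, fun x hx t ht => (P.wlo hx ht).2.1,
    fun x hx t ht => (P.wlo hx ht).2.2.1, fun x hx t ht => (P.wlo hx ht).2.2.2, cont_sep qt qx, zc, wx, wt, ?_, ?_, ?_, ?_⟩
  · intro x hx t ht
    have t2 : 0 < t/2 := p!
    have wc : ContinuousOn (lw W h τ x) (Ici (t/2)) := by
      intro r hr
      have hr : t/2 ≤ r := hr
      exact (wt x hx r (t2.le.trans hr)).continuousWithinAt.mono (Ici_subset_Ici.2 t2.le)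
    refine HasDerivWithinAt.hasDerivAt (deriv_of_fwd (s := Ici (t/2)) (g := fun t => (lq W h τ x t + 2*f x)/√(lw W h τ x t)) ?_ (fun δ hδ => ?_)
      (show t/2 ≤ t by linarith)) (Ici_mem_nhds l!)
    · have qc : ContinuousOn (fun t => lq W h τ x t) (Ici (t/2)) :=
        (cont_sep qt qx).comp (f := fun t => (x,t)) (by fun_prop) fun r hr => ⟨hx, t2.le.trans hr⟩
      refine ContinuousOn.div (by fun_prop) (by fun_prop) fun r hr => ?_
      have := lt_of_lt_of_le t2 hr
      exact (sqp ((mul_pos c0 (mu_pos this)).trans_le (P.wlo hx this.le).1)).ne'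
    · obtain ⟨N, hN, H⟩ := P.zder hx t2 (δ := δ/2) p!
      obtain ⟨d, hd, hs⟩ := small_of_cont (g := fun s => N*(√|s|+|s|)) (by fun_prop) (by simp) (δ := δ/2) p!
      refine ⟨d, hd, fun a ha b hb hab hd => (H a ha b hab).trans ?_⟩
      have := sbn hab
      have h3 := hs (b-a) (by rwa [abn this])
      rw [abn this] at h3
      rw [mul_comm]
      gcongr
      linarith
  · intro t ht
    have h1 := P.tw (x := 0) ⟨le_rfl, P.X0.le⟩ t
    have h2 : Tendsto (fun ν => wo (ε ν + (⌊t/h ν⌋₊:ℝ)*h ν)) (hyperfilter ℕ) (𝓝 (wo t)) :=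
      (P.wc t ht).tendsto.comp (tendsto_nhdsWithin_iff.2 ⟨P.tp ht, .of_forall fun ν => ((P.ctx ν).tp _).le⟩)
    refine tendsto_nhds_unique h1 (h2.congr fun ν => ?_)
    rw [← P.ini, zero_div, Nat.floor_zero]
  · intro x hx
    have h1 := P.tw hx 0
    have h2 : Tendsto (fun ν => wo (ε ν + (⌊(0:ℝ)/h ν⌋₊:ℝ)*h ν)) (hyperfilter ℕ) (𝓝 (wo 0)) :=
      (P.wc 0 self_mem_Ici).tendsto.comp (tendsto_nhdsWithin_iff.2 ⟨P.tp le_rfl, .of_forall fun ν => ((P.ctx ν).tp _).le⟩)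
    rw [P.w0] at h2
    refine tendsto_nhds_unique h1 (h2.congr fun ν => ?_)
    rw [← P.ini, zero_div, Nat.floor_zero]
    generalize ⌊x/τ ν⌋₊ = n
    induction n with
    | zero => rfl
    | succ n ih => rw [(P.ctx ν).S.b, ih]
  · intro x hx
    have key : ∀ δ > 0, ∃ D, ∀ t ≥ 0, |lw W h τ x t - U2 + 2*(p x - p 0)| ≤ δ + D*exp (-t) := by
      intro δ hδ
      obtain ⟨D, ev⟩ := P.inf δ hδ
      refine ⟨D, fun t ht => ?_⟩
      have tp : Tendsto (fun ν => p (⌊x/τ ν⌋₊*τ ν)) (hyperfilter ℕ) (𝓝 (p x)) := (P.pc.tendsto x).comp (P.tn hx.1)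
      have te := (((Real.continuous_exp.tendsto _).comp (P.tp ht).neg).const_mul D).const_add δ
      refine le_of_tendsto_of_tendsto (((P.tw hx t).sub_const U2).add ((tp.sub_const (p 0)).const_mul 2)).abs te ?_
      filter_upwards [ev.filter_mono Nat.hyperfilter_le_atTop] with ν hν
      exact hν _ (P.nX hx ν) _
    rw [Metric.tendsto_atTop']
    intro δ hδ
    obtain ⟨D, H⟩ := key (δ/2) p!
    have te : Tendsto (fun t => D*exp (-t)) atTop (𝓝 0) := by
      simpa using (Real.tendsto_exp_comp_nhds_zero.2 tendsto_neg_atTop_atBot).const_mul D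
    obtain ⟨T, hT⟩ := eventually_atTop.1 (te.eventually_lt_const (show 0 < δ/2 by positivity))
    refine ⟨max T 0, fun t ht => ?_⟩
    have h1 := H t ((le_max_right _ _).trans ht.le)
    have h2 := hT t ((le_max_left _ _).trans ht.le)
    rw [Real.dist_eq, show lw W h τ x t - (U2 - 2*(p x - p 0)) = lw W h τ x t - U2 + 2*(p x - p 0) by ring]
    linarith
end

structure Data (wo w1 G : ℝ → ℝ) (f0 U2 cr Mo Mi Kq : ℝ) : Prop where
  c0 : 0 < cr
  Kq1 : 1 ≤ Kq
  M1 : 0 ≤ Mi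
  lo : ∀ t ≥ 0, cr*mu t ≤ wo t
  hi : ∀ t ≥ 0, wo t ≤ Mo
  z : wo 0 = 0
  lip : ∀ s ≥ 0, ∀ t ≥ 0, |wo s - wo t| ≤ Mi*|s-t|
  d1 : ∀ t > 0, HasDerivAt wo (w1 t) t
  d2 : ∀ t > 0, HasDerivAt w1 (G t/√(wo t)) t
  Gb : ∀ t ≥ 0, |G t - 2*f0| ≤ Kq*mu t
  Gm : ∀ δ > 0, ∃ N ≥ 0, ∀ s ≥ 0, ∀ t ≥ 0, |G s - G t| ≤ δ + N*√|s-t|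
  inf : ∀ δ > 0, ∃ N, ∀ t ≥ 0, |wo t - U2| ≤ δ + N*exp (-t)
  inc : ∃ m > 0, ∃ εi > 0, ∀ ε > 0, ε < εi → ∀ y ≥ 0, wo ε + m*mu y ≤ wo (ε+y)

noncomputable def Wd (A τ : ℝ) (f g : ℕ → ℝ) : ℕ → ℕ → ℝ
  | 0, j => g j
  | n+1, 0 => Wd A τ f g n 0
  | n+1, j+1 => Wd A τ f g n (j+1)
    + √(Wd A τ f g n (j+1))/(4*A)*(Wd A τ f g n (j+2) - 2*Wd A τ f g n (j+1) + Wd A τ f g n j) - 2*τ*f n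

lemma Wd_sch {A τ : ℝ} (f g : ℕ → ℝ) (hA : 1 ≤ A) (hτ : 0 < τ) : Sch A τ f (Wd A τ f g) :=
  ⟨hA, hτ, fun n => by rw [Wd], fun n j => by rw [Wd]⟩

/-- the concrete scheme -/
noncomputable def WW (wo f : ℝ → ℝ) (A ε h : ℝ) : ℕ → ℕ → ℝ :=
  Wd A (h^2/(4*A)) (fun n => f (n*(h^2/(4*A)))) (fun j => wo (ε+j*h))

lemma WW_sch {wo f : ℝ → ℝ} {A ε h : ℝ} (hA : 1 ≤ A) (hh : 0 < h) :
    Sch A (h^2/(4*A)) (fun n => f (n*(h^2/(4*A)))) (WW wo f A ε h) := Wd_sch _ _ hA p!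

lemma WW_ini {wo f : ℝ → ℝ} {A ε h : ℝ} (j : ℕ) : WW wo f A ε h 0 j = wo (ε+j*h) := by rw [WW, Wd]

section
variable {wo w1 G : ℝ → ℝ} {f0 U2 cr Mo Mi Kq : ℝ}

lemma Data.w0p (D : Data wo w1 G f0 U2 cr Mo Mi Kq) {t : ℝ} (ht : 0 < t) : 0 < wo t :=
  (mul_pos D.c0 (mu_pos ht)).trans_le (D.lo t ht.le)

lemma Data.second (D : Data wo w1 G f0 U2 cr Mo Mi Kq) {t h : ℝ} (ht : 0 < t) (hh : 0 < h) :
    ∃ ξ ∈ Ioo t (t+2*h), wo (t+2*h) - 2*wo (t+h) + wo t = h^2*(G ξ/√(wo ξ)) := by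
  have hd : ∀ s ∈ Icc t (t+h), HasDerivAt (fun s => wo (s+h) - wo s) (w1 (s+h) - w1 s) s := fun s hs => by
    have s0 : 0 < s := ht.trans_le hs.1
    exact ((D.d1 (s+h) l!).comp_add_const s h).sub (D.d1 s s0)
  obtain ⟨s, hs, e⟩ := exists_hasDerivAt_eq_slope (fun s => wo (s+h) - wo s) (fun s => w1 (s+h) - w1 s)
    (show t < t+h by linarith) (fun s hs => (hd s hs).continuousAt.continuousWithinAt)
    (fun s hs => hd s (Ioo_subset_Icc_self hs))
  have s0 : 0 < s := ht.trans hs.1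
  obtain ⟨ξ, hξ, e'⟩ := exists_hasDerivAt_eq_slope w1 (fun s => G s/√(wo s))
    (show s < s+h by linarith) (fun r hr => (D.d2 r (s0.trans_le hr.1)).continuousAt.continuousWithinAt)
    (fun r hr => D.d2 r (s0.trans hr.1))
  refine ⟨ξ, ⟨hs.1.trans hξ.1, by linarith [hs.2, hξ.2]⟩, ?_⟩
  rw [e']
  rw [add_sub_cancel_left, eq_div_iff hh.ne'] at e
  rw [add_sub_cancel_left]
  field_simp
  rw [show t+2*h = t+h+h by ring]; linear_combination -e

lemma Data.adm (D : Data wo w1 G f0 U2 cr Mo Mi Kq) {f : ℝ → ℝ} (hf : f 0 = f0) {A : ℝ} (hA : 1 ≤ A)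
    {ε : ℝ} (hε : 0 < ε) (hε1 : ε ≤ 1) : ∀ᶠ h in 𝓝[>] (0:ℝ), ∀ j : ℕ,
    |qq (WW wo f A ε h) (h^2/(4*A)) 0 j - (G (ε+j*h) - 2*f0)| ≤ Kq*ε := by
  obtain ⟨N, hN, H⟩ := D.Gm (ε/2) p!
  have c0 := D.c0; have Kq1 := D.Kq1; have M10 := D.M1
  obtain ⟨C, hC⟩ := exr ((2*|f0|+Kq)*Mi/(cr*ε))
  have C0 : 0 ≤ C := by rw [hC]; positivity
  have sm : ∀ᶠ h in 𝓝[>] (0:ℝ), N*√h + C*h < ε/2 := by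
    refine (Tendsto.eventually_lt_const (show (0:ℝ) < ε/2 by positivity) ?_)
    have : Continuous fun h : ℝ => N*√h + C*h := by fun_prop
    simpa using (this.tendsto 0).mono_left nhdsWithin_le_nhds
  filter_upwards [sm, self_mem_nhdsWithin] with h hs hh j
  have hh : 0 < h := hh
  have hτ : 0 < h^2/(4*A) := p!
  cases j with
  | zero =>
    rw [(WW_sch hA hh).q0, zero_sub, abs_neg, Nat.cast_zero, zero_mul, add_zero]
    exact (D.Gb ε hε.le).trans (by have := min_le_left ε 1; unfold mu; gcongr)
  | succ j =>
    have e := (WW_sch (wo := wo) (f := f) (ε := ε) hA hh).s 0 j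
    have tp : 0 < ε + j*h := p!
    obtain ⟨ξ, hξ, e2⟩ := D.second tp hh
    have ta : 0 < ε + (j+1:ℕ)*h := p!
    simp only [WW_ini] at e
    have i1 : ε + ((j+1:ℕ):ℝ)*h = ε + j*h + h := by push_cast; ring
    have i2 : ε + ((j+2:ℕ):ℝ)*h = ε + j*h + 2*h := by push_cast; ring
    rw [i2, i1, e2] at e
    rw [qq, e, WW_ini, i1]
    rw [i1] at ta
    have hξ0 : 0 < ξ := tp.trans hξ.1
    have wa := D.w0p ta
    have wb := D.w0p hξ0
    have lb : cr*ε ≤ wo ξ := by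
      refine le_trans ?_ (D.lo ξ hξ0.le)
      gcongr
      refine le_min ?_ hε1
      have : 0 ≤ j*h := p!
      linarith [hξ.1]
    have dist : |ξ - (ε+j*h+h)| ≤ h := by rw [abs_le]; constructor <;> linarith [hξ.1, hξ.2]
    have dG := H ξ hξ0.le _ ta.le
    have dw := D.lip _ ta.le ξ hξ0.le
    rw [abc _ ξ] at dw
    have gb : |G ξ| ≤ 2*|f0|+Kq := by
      have h1 := D.Gb ξ hξ0.le
      have h2 : Kq*mu ξ ≤ Kq := ml1 l! (mu_le_one _)
      have h3 := aal (G ξ - 2*f0) (2*f0)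
      rw [sub_add_cancel, abs_mul 2, abs_two] at h3
      linarith
    have dG' : |G ξ - G (ε+j*h+h)| ≤ ε/2+N*√h := dG.trans (by gcongr)
    have dw' : |wo (ε+j*h+h) - wo ξ| ≤ Mi*h := dw.trans (by gcongr)
    rw [Nat.cast_zero, zero_mul, hf]
    have S0 := sqs wa.le
    have S1 := sqs wb.le
    have a0 := sqp wa
    have b0 := sqp wb
    generalize √(wo (ε+j*h+h)) = a, √(wo ξ) = b at *
    have e3 : (wo (ε+j*h+h) + a/(4*A)*(h^2*(G ξ/b)) - 2*(h^2/(4*A))*f0 - wo (ε+j*h+h))/(h^2/(4*A))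
      - (G (ε+j*h+h) - 2*f0) = (G ξ - G (ε+j*h+h)) + G ξ*((a-b)/b) := by field_simp; ring
    rw [e3]
    have ab : |(a-b)/b| ≤ Mi*h/(cr*ε) := by
      rw [abs_div, abp b0, div_le_div_iff₀ b0 p!]
      have h1 : |a-b| * (a+b) = |wo (ε+j*h+h) - wo ξ| := by
        rw [← S0, ← S1, show a^2-b^2 = (a-b)*(a+b) by ring, abs_mul, abp (add_pos a0 b0)]
      calc |a-b| * (cr*ε) ≤ |a-b| * b^2 := by rw [S1]; gcongr
        _ ≤ |a-b| * (b*(a+b)) := by gcongr; nlinarith only [a0, b0]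
        _ = (|a-b| * (a+b))*b := by ring
        _ ≤ _ := by rw [h1]; gcongr
    have h5 : |G ξ*((a-b)/b)| ≤ C*h := by
      rw [abs_mul, hC, show (2*|f0|+Kq)*Mi/(cr*ε)*h = (2*|f0|+Kq)*(Mi*h/(cr*ε)) by ring]
      gcongr
    have h6 := aal (G ξ - G (ε+j*h+h)) (G ξ*((a-b)/b))
    have h7 : 1*ε ≤ Kq*ε := by gcongr
    linarith only [h5, h6, h7, hs, dG']

lemma riemann {p f : ℝ → ℝ} {τ F' X : ℝ} (hτ : 0 < τ) (hp : ∀ x, HasDerivAt p (f x) x) (F0 : 0 ≤ F')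
    (f2 : ∀ x ∈ Icc 0 (X+1), ∀ y ∈ Icc 0 (X+1), |f x - f y| ≤ F'*|x-y|) {n : ℕ} (hn : n*τ ≤ X) :
    |p (n*τ) - p 0 - τ*∑ i ∈ Finset.range n, f (i*τ)| ≤ n*τ*(F'*τ) := by
  induction n with
  | zero => simp
  | succ n ih =>
    push_cast at hn
    have n0 : 0 ≤ n*τ := p!
    have ih := ih l!
    obtain ⟨ξ, hξ, e⟩ := exists_hasDerivAt_eq_slope p f (show n*τ < n*τ+τ by linarith)
      (fun x _ => (hp x).continuousAt.continuousWithinAt) (fun x _ => hp x)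
    have := f2 ξ ⟨by linarith [hξ.1], by linarith [hξ.2]⟩ (n*τ) ⟨n0, l!⟩
    have d : |ξ - n*τ| ≤ τ := by rw [abs_le]; constructor <;> linarith [hξ.1, hξ.2]
    have := this.trans (mll d F0)
    rw [add_sub_cancel_left, eq_div_iff hτ.ne'] at e
    rw [Finset.sum_range_succ]
    push_cast
    have e2 : p ((n+1)*τ) - p 0 - τ*(∑ i ∈ Finset.range n, f (i*τ) + f (n*τ))
      = (p (n*τ) - p 0 - τ*∑ i ∈ Finset.range n, f (i*τ)) + (f ξ - f (n*τ))*τ := by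
      rw [show ((n:ℝ)+1)*τ = n*τ+τ by ring, sub_mul, e]; ring
    rw [e2]
    refine (aal _ _).trans ?_
    rw [abs_mul (f ξ - _), abp hτ]
    have := mlr this hτ.le
    linarith

theorem mk_flow (D : Data wo w1 G f0 U2 cr Mo Mi Kq) {f p : ℝ → ℝ} (hf : f 0 = f0) (fc : Continuous f)
    (hp : ∀ x, HasDerivAt p (f x) x) {X c M K A F F' : ℝ} (X0 : 0 < X) (c0 : 0 < c) (hA : 1 ≤ A)
    (hM : M ≤ A^2) (F0 : 0 ≤ F) (F0' : 0 ≤ F') (f1 : ∀ x ∈ Icc 0 (X+1), |f x| ≤ F)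
    (f2 : ∀ x ∈ Icc 0 (X+1), ∀ y ∈ Icc 0 (X+1), |f x - f y| ≤ F'*|x-y|)
    (hB : ∀ᶠ ε in 𝓝[>] (0:ℝ), ∀ᶠ h in 𝓝[>] (0:ℝ), Bd (WW wo f A ε h) (h^2/(4*A)) X c M K ε h) :
    ∃ Z w q z, VMFlow wo f p U2 X c M (max K 1) Z w q z := by
  have Kq1 := D.Kq1
  have seq : ∀ ν : ℕ, ∃ ε h : ℝ, 0 < ε ∧ ε ≤ 1/(ν+1) ∧ 0 < h ∧ h ≤ 1/(ν+1) ∧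
      Bd (WW wo f A ε h) (h^2/(4*A)) X c M K ε h ∧
      ∀ j : ℕ, |qq (WW wo f A ε h) (h^2/(4*A)) 0 j - (G (ε+j*h) - 2*f0)| ≤ Kq*ε := by
    intro ν
    have ν0 : (0:ℝ) < 1/(ν+1) := p!
    have lt : ∀ᶠ ε in 𝓝[>] (0:ℝ), ε ∈ Ioc 0 (1/((ν:ℝ)+1)) := Ioc_mem_nhdsGT ν0
    obtain ⟨ε, hε, hε'⟩ := (hB.and lt).exists
    have : (1:ℝ)/(ν+1) ≤ 1 := by rw [div_le_one p!]; linarith [(Nat.cast_nonneg ν : (0:ℝ) ≤ ν)]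
    obtain ⟨h, ⟨h1, h2⟩, h3⟩ := ((hε.and lt).and (D.adm hf hA hε'.1 (hε'.2.trans this))).exists
    exact ⟨ε, h, hε'.1, hε'.2, h2.1, h2.2, h1, h3⟩
  choose ε h e0 e1 h0 h1 B Q using seq
  have tn : Tendsto (fun ν : ℕ => (1:ℝ)/(ν+1)) atTop (𝓝 0) := tendsto_one_div_add_atTop_nhds_zero_nat
  have te : Tendsto ε atTop (𝓝 0) := squeeze_zero (fun ν => (e0 ν).le) e1 tn
  have th : Tendsto h atTop (𝓝 0) := squeeze_zero (fun ν => (h0 ν).le) h1 tn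
  have tt : Tendsto (fun ν => (h ν)^2/(4*A)) atTop (𝓝 0) := by simpa using (th.pow 2).div_const (4*A)
  have le1 : ∀ ν : ℕ, (1:ℝ)/(ν+1) ≤ 1 := fun ν => by
    rw [div_le_one p!]; linarith [(Nat.cast_nonneg ν : (0:ℝ) ≤ ν)]
  have τp : ∀ ν, 0 < (h ν)^2/(4*A) := fun ν => by have := h0 ν; positivity
  have τ1 : ∀ ν, (h ν)^2/(4*A) ≤ 1 := fun ν => by
    have := (h1 ν).trans (le1 ν)
    have := h0 ν
    rw [div_le_one p!]; nlinarith
  have ctx : ∀ ν, Ctx (WW wo f A (ε ν) (h ν)) (fun n => f (n*((h ν)^2/(4*A)))) A ((h ν)^2/(4*A)) X c M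
      (max K 1) (ε ν) (h ν) F F' := fun ν => by
    have tp := τp ν
    refine ⟨WW_sch hA (h0 ν), fun n hn j => ?_, hM, c0, le_max_right _ _, e0 ν, (e1 ν).trans (le1 ν), h0 ν,
      (h1 ν).trans (le1 ν), by field_simp, F0, F0', fun n hn => f1 _ ⟨p!, l!⟩, fun n hn => ?_⟩
    · obtain ⟨b1, b2, b3⟩ := B ν n hn j
      refine ⟨b1, b2, b3.trans ?_⟩
      have : 0 ≤ mu (ε ν+j*h ν) := (mu_pos (by have := e0 ν; have := h0 ν; positivity)).le
      gcongr
      exact le_max_left _ _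
    · have := τ1 ν
      have n0 : 0 ≤ n*((h ν)^2/(4*A)) := p!
      have := f2 _ (show ((n+1:ℕ):ℝ)*((h ν)^2/(4*A)) ∈ Icc 0 (X+1) from ⟨p!, by push_cast; linarith⟩)
        (n*((h ν)^2/(4*A))) ⟨p!, l!⟩
      refine this.trans_eq ?_
      rw [← sub_mul]; push_cast
      rw [add_sub_cancel_left, one_mul, abp tp]
  have K1 : (1:ℝ) ≤ max K 1 := le_max_right _ _
  have P : Appr wo f p U2 X c M (max K 1) A F F' ε h (fun ν => (h ν)^2/(4*A))
      (fun ν => WW wo f A (ε ν) (h ν)) := by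
    refine ⟨X0, ctx, te, th, tt, fun ν j => WW_ini j, ?_, ?_, fc, ?_, ?_, D.z⟩
    · intro δ hδ
      obtain ⟨No, hNo, H⟩ := D.Gm (δ/4) p!
      obtain ⟨N, hN, HN⟩ := Ctx.modQ (A := A) (X := X) (c := c) (K := max K 1) (F := F) (F' := F') (δ := δ/2) (No := No) hA c0 K1 F0 F0'
        p!
      refine ⟨N, hN, ?_⟩
      filter_upwards [te.eventually_le_const (show 0 < δ/(2*max K 1) by positivity),
        te.eventually_le_const (show 0 < δ/(8*Kq) by positivity)] with ν hν hν2
      rw [ldi p!] at hν hν2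
      intro n hn j i
      obtain ⟨g1, g2⟩ := HN _ _ _ _ _ _ (ctx ν) l! (by
        intro k i
        have q1 := Q ν (k+i)
        have q2 := Q ν k
        have hp := h0 ν
        have ep := e0 ν
        have q3 := H (ε ν + (k+i:ℕ)*h ν) p! (ε ν + k*h ν) p!
        rw [show ε ν + (k+i:ℕ)*h ν - (ε ν + k*h ν) = i*h ν by push_cast; ring, abn (p! : 0 ≤ i*h ν)] at q3
        rw [abs_le] at *
        constructor <;> linarith) n hn j i
      exact ⟨g1.trans l!, fun hh => (g2 hh).trans l!⟩
    · intro δ hδ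
      obtain ⟨N, H⟩ := D.inf (δ/2) p!
      obtain ⟨D', hD⟩ := exr (max ((M + |U2| + 2*(F*X))*exp 1) (max N 0))
      have D0 : 0 ≤ D' := by rw [hD]; exact (le_max_right _ _).trans (le_max_right _ _)
      refine ⟨D'*exp (2*A*X), ?_⟩
      filter_upwards [tt.eventually_le_const (show 0 < δ/(4*(X*(F'+1))) by positivity)] with ν hν
      rw [ldi p!] at hν
      intro n hn j
      have tp := τp ν
      have g := (ctx ν).inf (δ := δ/2) (D := D') X0.le p! (by rw [hD]; exact le_max_left _ _) (by
        intro j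
        rw [WW_ini]
        refine (H _ (by have := e0 ν; have := h0 ν; positivity)).trans ?_
        gcongr
        rw [hD]; exact (le_max_left _ _).trans (le_max_right _ _)) n hn j
      have r := riemann tp hp F0' f2 hn
      have x1 : (1+2*A*((h ν)^2/(4*A)))^n ≤ exp (2*A*X) := by
        refine (pow_le_exp' p! n).trans (Real.exp_le_exp.2 ?_)
        calc n*(2*A*((h ν)^2/(4*A))) = 2*A*(n*((h ν)^2/(4*A))) := by ring
          _ ≤ _ := by gcongr
      have x2 : D'*(1+2*A*((h ν)^2/(4*A)))^n*exp (-(ε ν+j*h ν)) ≤ D'*exp (2*A*X)*exp (-(ε ν+j*h ν)) := by gcongr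
      have x3 : n*((h ν)^2/(4*A))*(F'*((h ν)^2/(4*A))) ≤ δ/4 := by
        calc n*((h ν)^2/(4*A))*(F'*((h ν)^2/(4*A))) ≤ X*((F'+1)*((h ν)^2/(4*A))) := by gcongr; linarith
          _ ≤ δ/4 := l!
      rw [abs_le] at *
      constructor <;> linarith
    · exact continuous_iff_continuousAt.2 fun x => (hp x).continuousAt
    · intro t ht
      rcases (show (0:ℝ) ≤ t from ht).eq_or_lt with rfl | h
      · refine Metric.continuousWithinAt_iff.2 fun δ hδ => ?_
        have M10 := D.M1
        refine ⟨δ/(Mi+1), p!, fun {x} hx hd => ?_⟩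
        rw [Real.dist_eq] at *
        rw [lt_div_iff₀ p!] at hd
        have := D.lip x hx 0 le_rfl
        nlinarith [abs_nonneg (x-0)]
      · exact (D.d1 t h).continuousAt.continuousWithinAt
  exact ⟨_, _, _, _, P.flow⟩
end

section
variable {wo w1 G : ℝ → ℝ} {f0 U2 cr Mo Mi Kq : ℝ}

lemma Data.q0 (D : Data wo w1 G f0 U2 cr Mo Mi Kq) {f : ℝ → ℝ} (hf : f 0 = f0) {A : ℝ} (hA : 1 ≤ A)
    {ε : ℝ} (hε : 0 < ε) (hε1 : ε ≤ 1) : ∀ᶠ h in 𝓝[>] (0:ℝ), ∀ j : ℕ,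
    |qq (WW wo f A ε h) (h^2/(4*A)) 0 j| ≤ 2*Kq*mu (ε+j*h) := by
  filter_upwards [D.adm hf hA hε hε1, self_mem_nhdsWithin] with h H hh j
  have hh : 0 < h := hh
  have jh : 0 ≤ (j:ℝ)*h := p!
  have h1 := abs_le.1 (H j)
  have h2 := abs_le.1 (D.Gb (ε+j*h) p!)
  have h3 : Kq*ε ≤ Kq*mu (ε+j*h) := by
    have := D.Kq1
    gcongr; exact le_min l! hε1
  exact abs_le.2 ⟨l!, l!⟩

theorem glob_bd (D : Data wo w1 G f0 U2 cr Mo Mi Kq) {f : ℝ → ℝ} (hf : f 0 = f0)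
    {X F F' : ℝ} (X0 : 0 < X) (F0 : 0 ≤ F) (F0' : 0 ≤ F') (f1 : ∀ x ∈ Icc 0 (X+1), |f x| ≤ F)
    (f2 : ∀ x ∈ Icc 0 (X+1), ∀ y ∈ Icc 0 (X+1), |f x - f y| ≤ F'*|x-y|) (fn : ∀ x ≥ 0, f x ≤ 0) :
    ∃ c > 0, ∃ M K A : ℝ, 1 ≤ A ∧ M ≤ A^2 ∧
    ∀ᶠ ε in 𝓝[>] (0:ℝ), ∀ᶠ h in 𝓝[>] (0:ℝ), Bd (WW wo f A ε h) (h^2/(4*A)) X c M K ε h := by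
  obtain ⟨m, m0, εi, ε0, inc⟩ := D.inc
  have c00 := D.c0
  have Kq1 := D.Kq1
  have M10 := D.M1
  have M0 : 0 ≤ Mo := by have := D.hi 0 le_rfl; rwa [D.z] at this
  obtain ⟨A, hA⟩ := exr (Mo+2*F*X+1)
  have FX : 0 ≤ 2*F*X := p!
  have A1 : 1 ≤ A := l!
  have MA : Mo+2*F*X ≤ A^2 := by nlinarith only [hA, A1]
  obtain ⟨c, hc⟩ := exr (m*exp (-(2*A*X))/2)
  have c0 : 0 < c := by rw [hc]; positivity
  have sc := sqp c0
  obtain ⟨Ku, hKu⟩ := exr (8*(Mi+Mo+F/√c+1))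
  have Ku0 : 0 < Ku := by rw [hKu]; positivity
  have Ku1 : 8*F ≤ Ku*√c := by
    have : F/√c*√c = F := by field_simp
    have : 0 ≤ (Mi+Mo+1)*√c := p!
    rw [hKu]; linarith
  have Ku2 : 8*(Mi+Mo) ≤ Ku := by
    have : 0 ≤ F/√c := p!
    rw [hKu]; linarith
  obtain ⟨K', hK'⟩ := exr (Ku*exp (X*(16*F/Ku)))
  have K0' : 0 ≤ K' := by rw [hK']; positivity
  obtain ⟨Q, Q0, HQ⟩ := gl (A := A) (X := X) (c := c) (Z := K'+Mi) (B := 2*Kq+2*F'*X) (Kq := 2*Kq) A1 X0 c0 F0 F0'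
    p! p! p!
  obtain ⟨ci, hci⟩ := exr (min cr c)
  have c10 : 0 < ci := by rw [hci]; positivity
  obtain ⟨K, h₁, h10, HK⟩ := g6 (A := A) (X := X) (c := ci) (Kq := 2*Kq) A1 X0 c10 F0 F0' Q0 l!
  refine ⟨ci, c10, Mo+2*F*X, K, A, A1, MA, ?_⟩
  have lt : ∀ᶠ ε in 𝓝[>] (0:ℝ), ε ∈ Ioo 0 (min εi 1) := Ioo_mem_nhdsGT p!
  filter_upwards [lt] with ε hε
  obtain ⟨εp, hε⟩ := hε
  obtain ⟨e1, e2⟩ := lt_min_iff.1 hε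
  have w0p := D.w0p εp
  obtain ⟨h₀, h00, HQ⟩ := HQ (wo ε) w0p
  have lt : ∀ᶠ h in 𝓝[>] (0:ℝ), h ∈ Ioo 0 (min (min h₀ h₁) (min (1/8) (wo ε/(F+1)))) := Ioo_mem_nhdsGT p!
  filter_upwards [lt, D.q0 hf A1 εp e2.le] with h hh hq
  obtain ⟨hp, hh⟩ := hh
  simp only [lt_min_iff] at hh
  obtain ⟨⟨l1, l2⟩, l3, l4⟩ := hh
  rw [lt_div_iff₀ p!] at l4
  have S := WW_sch (wo := wo) (f := f) (ε := ε) A1 hp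
  have tp := S.hτ
  have eτ : h^2 = 4*A*(h^2/(4*A)) := by field_simp
  have ini := fun j => WW_ini (wo := wo) (f := f) (A := A) (ε := ε) (h := h) j
  obtain ⟨τ, hτ⟩ := exr (h^2/(4*A))
  have h21 : h^2 ≤ h := by nlinarith only [hp, l3]
  have τ1 : τ ≤ 1 := by
    rw [hτ, div_le_one p!]; linarith
  rw [← hτ] at S tp eτ hq ⊢
  generalize hW : WW wo f A ε h = W at *
  have Xm : ∀ n : ℕ, n*τ ≤ X → n*τ ∈ Icc 0 (X+1) := fun n hn => ⟨p!, l!⟩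
  have g1 : ∀ n : ℕ, n*τ ≤ X → |f (n*τ)| ≤ F := fun n hn => f1 _ (Xm n hn)
  have g2 : ∀ n : ℕ, n*τ ≤ X → |f ((n+1:ℕ)*τ) - f (n*τ)| ≤ F'*τ := fun n hn => by
    have := f2 ((n+1:ℕ)*τ) ⟨p!, by push_cast; linarith⟩ (n*τ) (Xm n hn)
    rwa [show ((n+1:ℕ):ℝ)*τ - n*τ = τ by push_cast; ring, abp tp] at this
  have mj : ∀ j : ℕ, 0 ≤ mu (j*h) := fun j => le_min p! zero_le_one
  have dif : ∀ j : ℕ, 0 ≤ (j:ℝ)*h := fun j => p!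
  have C : GB W (fun n => f (n*τ)) A τ h X (wo ε) c (Mo+2*F*X) F F' := by
    rw [hc]
    exact mk_GB S eτ hp l! w0p (by rw [ini]; simp) m0 (fun j => by rw [ini]; exact inc ε εp e1 _ (dif j))
      (fun j => by rw [ini]; exact D.hi _ (by linarith [dif j])) MA F0 F0' l!
      (fun n hn => fn _ (Xm n hn).1) (fun n hn => (abs_le.1 (g1 n hn)).1) g2
  have up := C.up Ku0 Ku1 (fun j => by
    have b1 := (bet_facts (L := 1) (t := j*h) le_rfl (dif j)).2.1
    have hi := D.hi (ε+j*h) (by linarith [dif j])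
    have lp := D.lip (ε+j*h) (by linarith [dif j]) ε εp.le
    rw [add_sub_cancel_left, abn (dif j)] at lp
    have lp := (le_abs_self _).trans lp
    have : wo (ε+j*h) - wo ε ≤ (Mi+Mo)*mu (j*h) := by
      unfold mu
      rcases le_total ((j:ℝ)*h) 1 with hj | hj
      · rw [min_eq_left hj]; have := mul_nonneg M0 (dif j); linarith
      · rw [min_eq_right hj]; linarith
    rw [ini]
    have mj := mj j
    have k1 := mll b1 (p! : 0 ≤ Mi+Mo)
    have k2 := mlr Ku2 (l! : 0 ≤ bet 1 (j*h))
    linarith)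
  have hz := C.zb (Z := K'+Mi) K0' l! (fun n hn j => by
    refine (up n hn j).trans ?_
    have b1 := (bet_facts (L := 1) (t := j*h) le_rfl (dif j)).1
    have b2 := (bet_facts (L := 1) (t := j*h) le_rfl (dif j)).2.1
    have b3 : bet 1 (j*h) ≤ j*h := b1.trans (min_le_left _ _)
    have b4 : 0 ≤ bet 1 (j*h) := by linarith [mj j]
    have e1 : (1+16*F/Ku*τ)^n ≤ exp (X*(16*F/Ku)) := (pow_le_exp' p! n).trans (Real.exp_le_exp.2 (by
      calc n*(16*F/Ku*τ) = (n*τ)*(16*F/Ku) := by ring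
        _ ≤ _ := by gcongr))
    rw [hK']; gcongr) (fun j => by
    have lp := D.lip (ε+(j+1:ℕ)*h) (by linarith [dif (j+1)]) (ε+j*h) (by linarith [dif j])
    rw [show ε+((j+1:ℕ):ℝ)*h-(ε+j*h) = h by push_cast; ring, abp hp] at lp
    unfold zz
    rw [ini, ini, abs_div, abp hp, dli hp]
    have : 0 ≤ K'*h := p!
    linarith)
  have q2 : ∀ j, |qq W τ 0 j| ≤ 2*Kq := fun j => (hq j).trans (by
    have : mu (ε+j*h) ≤ 1 := min_le_right _ _
    exact ml1 p! this)
  have hB : ∀ n : ℕ, n*τ ≤ X → ∀ j : ℕ, -(2*Kq+2*F'*X) ≤ qq W τ n j := fun n hn j => by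
    have := C.ql (B := 2*Kq) p! (by
      have : 4*τ ≤ h := by
        rw [hτ, mul_div_assoc', dli p!]
        nlinarith only [h21, A1, hp]
      nlinarith only [mll this F0, l4, hp]) (fun j => (abs_le.1 (q2 j)).1) n hn j
    have : 2*F'*(n*τ) ≤ 2*F'*X := by gcongr
    linarith
  have hQ := HQ W _ τ h _ l1 C hz hB (fun j => (abs_le.1 (q2 j)).2)
  have lo : ∀ n : ℕ, n*τ ≤ X → ∀ j : ℕ, ci*mu (ε+j*h) ≤ W n j := fun n hn j => by
    refine le_trans ?_ (C.lo n hn j)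
    have l0 := D.lo ε εp.le
    rw [mu, min_eq_left e2.le] at l0
    have k1 : mu (ε+j*h) ≤ ε + mu (j*h) := by
      unfold mu; rcases le_total ((j:ℝ)*h) 1 with hj | hj
      · rw [min_eq_left hj]; exact min_le_left _ _
      · rw [min_eq_right hj]; exact (min_le_right _ _).trans l!
    have mj := mj j
    calc ci*mu (ε+j*h) ≤ ci*(ε+mu (j*h)) := by gcongr
      _ = ci*ε + ci*mu (j*h) := by ring
      _ ≤ cr*ε + c*mu (j*h) := by rw [hci]; gcongr <;> simp
      _ ≤ _ := l!
  intro n hn j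
  exact ⟨lo n hn j, C.hi n hn j, HK W _ τ h ε hp l2 εp eτ S (fun n hn j => ⟨lo n hn j, (C.hi n hn j).trans MA, hQ n hn j⟩)
    (fun n hn => ⟨g1 n hn, g2 n hn⟩) hq n hn j⟩

lemma C1_bd {f : ℝ → ℝ} (hf : ContDiff ℝ 1 f) (X : ℝ) : ∃ F F' : ℝ, 0 ≤ F ∧ 0 ≤ F' ∧ (∀ x ∈ Icc 0 (X+1), |f x| ≤ F) ∧
    ∀ x ∈ Icc 0 (X+1), ∀ y ∈ Icc 0 (X+1), |f x - f y| ≤ F'*|x-y| := by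
  obtain ⟨F, hF⟩ := isCompact_Icc.exists_bound_of_continuousOn (s := Icc 0 (X+1)) hf.continuous.continuousOn
  obtain ⟨F', hF'⟩ := isCompact_Icc.exists_bound_of_continuousOn (s := Icc 0 (X+1)) (hf.continuous_deriv le_rfl).continuousOn
  refine ⟨|F|, |F'|, abs_nonneg _, abs_nonneg _, fun x hx => (hF x hx).trans (le_abs_self _), fun x hx y hy => ?_⟩
  exact (convex_Icc _ _).norm_image_sub_le_of_norm_deriv_le (fun z _ => (hf.differentiable one_ne_zero) z)
    (fun z hz => (hF' z hz).trans (le_abs_self _)) hy hx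

theorem glob_flow (D : Data wo w1 G f0 U2 cr Mo Mi Kq) {f p : ℝ → ℝ} (hf : f 0 = f0) (fC : ContDiff ℝ 1 f)
    (hp : ∀ x, HasDerivAt p (f x) x) (fn : ∀ x ≥ 0, f x ≤ 0) {X : ℝ} (X0 : 0 < X) :
    ∃ c M K Z w q z, VMFlow wo f p U2 X c M K Z w q z := by
  obtain ⟨F, F', F0, F0', f1, f2⟩ := C1_bd fC X
  obtain ⟨c, c0, M, K, A, hA, hM, hB⟩ := glob_bd D hf X0 F0 F0' f1 f2 fn
  exact ⟨_, _, _, mk_flow D hf fC.continuous hp X0 c0 hA hM F0 F0' f1 f2 hB⟩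

theorem short_flow (D : Data wo w1 G f0 U2 cr Mo Mi Kq) {f p : ℝ → ℝ} (hf : f 0 = f0) (fC : ContDiff ℝ 1 f)
    (hp : ∀ x, HasDerivAt p (f x) x) :
    ∃ X > 0, ∃ c M K Z w q z, VMFlow wo f p U2 X c M K Z w q z := by
  obtain ⟨F, F', F0, F0', f1, f2⟩ := C1_bd fC 1
  have Kq1 := D.Kq1
  have M0 : 0 ≤ Mo := by have := D.hi 0 le_rfl; rwa [D.z] at this
  obtain ⟨X, X0, X1, c, c0, M, K, A, h₀, hA, h00, hM, H⟩ := short_bd (Kq := 2*Kq) D.c0 M0 l! F0 F0'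
  have sub : Icc 0 (X+1) ⊆ Icc 0 (1+1) := Icc_subset_Icc le_rfl l!
  refine ⟨X, X0, c, M, max K 1, mk_flow D hf fC.continuous hp X0 c0 hA hM F0 F0' (fun x hx => f1 x (sub hx))
    (fun x hx y hy => f2 x (sub hx) y (sub hy)) ?_⟩
  have lt : ∀ᶠ ε in 𝓝[>] (0:ℝ), ε ∈ Ioo (0:ℝ) 1 := Ioo_mem_nhdsGT p!
  filter_upwards [lt] with ε hε
  have lt : ∀ᶠ h in 𝓝[>] (0:ℝ), h ∈ Ioo 0 (min h₀ 1) := Ioo_mem_nhdsGT p!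
  filter_upwards [lt, D.q0 hf hA hε.1 hε.2.le] with h hh hq
  obtain ⟨hp, hh⟩ := hh
  obtain ⟨l1, l2⟩ := lt_min_iff.1 hh
  have ε0 := hε.1
  have τ1 : h^2/(4*A) ≤ 1 := by
    rw [div_le_one p!]; nlinarith only [hp, l2, hA]
  have tp : 0 < h^2/(4*A) := p!
  refine H ε hε.1 h hp l1 _ _ (WW_sch hA hp) (fun j => ⟨?_, ?_, hq j⟩) (fun n hn => ⟨f1 _ ⟨p!, l!⟩, ?_⟩)
  · rw [WW_ini]; exact D.lo _ p!
  · rw [WW_ini]; exact D.hi _ p!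
  · have := f2 ((n+1:ℕ)*(h^2/(4*A))) ⟨p!, by push_cast; linarith⟩ (n*(h^2/(4*A))) ⟨p!, l!⟩
    rwa [show ((n+1:ℕ):ℝ)*(h^2/(4*A)) - n*(h^2/(4*A)) = h^2/(4*A) by push_cast; ring, abp tp] at this
end

lemma mu_int (a b : ℝ) : IntervalIntegrable (fun s => 1/√(mu |s|)) volume a b := by
  refine intervalIntegrable_of_even (fun x => by simp) (fun x hx => ?_)
  have h1 : IntervalIntegrable (fun s : ℝ => s^(-(1/2):ℝ) + 1) volume 0 x :=
    (intervalIntegral.intervalIntegrable_rpow' (by norm_num)).add intervalIntegrable_const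
  refine h1.mono_fun' (Measurable.aestronglyMeasurable (by unfold mu; fun_prop)) ?_
  refine (ae_restrict_iff' measurableSet_uIoc).2 (Eventually.of_forall fun s hs => ?_)
  rw [uIoc_of_le hx.le] at hs
  have s0 := hs.1
  show ‖1/√(mu |s|)‖ ≤ s^(-(1/2):ℝ) + 1
  rw [Real.norm_of_nonneg p!, abp s0, Real.rpow_neg s0.le, ← Real.sqrt_eq_rpow]
  have := sqp s0
  unfold mu
  rcases le_total s 1 with h | h
  · rw [min_eq_left h, one_div]; linarith
  · rw [min_eq_right h]; simp

structure Ker (a b B : ℝ) (g : ℝ → ℝ → ℝ) : Prop where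
  bd : ∀ x ∈ Ioo a b, ∀ t, |g x t| ≤ B*(1/√(mu |t|))
  ct : ∀ x ∈ Ioo a b, ∀ t ≠ 0, ContinuousAt (fun p : ℝ × ℝ => g p.1 p.2) (x, t)
  ms : ∀ x, Measurable (g x)

section
variable {a b B x : ℝ} {g : ℝ → ℝ → ℝ}

lemma ae_ne0 : ∀ᵐ t : ℝ, t ≠ 0 := by simp [ae_iff]

lemma Ker.int (G : Ker a b B g) (hx : x ∈ Ioo a b) (s t : ℝ) : IntervalIntegrable (g x) volume s t :=
  ((mu_int s t).const_mul B).mono_fun' (G.ms x).aestronglyMeasurable (Eventually.of_forall fun t => G.bd x hx t)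

lemma Ker.cont (G : Ker a b B g) (hx : x ∈ Ioo a b) (t : ℝ) :
    ContinuousAt (fun p : ℝ × ℝ => ∫ s in (0:ℝ)..p.2, g p.1 s) (x, t) := by
  refine intervalIntegral.continuousAt_parametric_primitive_of_dominated (fun t => B*(1/√(mu |t|))) (-(|t|+1)) (|t|+1)
    (fun x => (G.ms x).aestronglyMeasurable) ?_ ((mu_int _ _).const_mul B) ?_ ⟨?_, ?_⟩ ⟨?_, ?_⟩ (by simp)
  · filter_upwards [Ioo_mem_nhds hx.1 hx.2] with x hx
    exact Eventually.of_forall fun t => G.bd x hx t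
  · refine ae_restrict_of_ae (ae_ne0.mono fun t ht => ?_)
    exact ContinuousAt.comp (f := fun x : ℝ => (x, t)) (G.ct x hx t ht) (by fun_prop)
  · have := abs_nonneg t; linarith
  · have := abs_nonneg t; linarith
  · have := neg_abs_le t; linarith
  · have := le_abs_self t; linarith

lemma Ker.dt (G : Ker a b B g) (hx : x ∈ Ioo a b) {t : ℝ} (ht : t ≠ 0) :
    HasDerivAt (fun t => ∫ s in (0:ℝ)..t, g x s) (g x t) t :=
  intervalIntegral.integral_hasDerivAt_right (G.int hx _ _) (G.ms x).stronglyMeasurable.stronglyMeasurableAtFilter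
    (ContinuousAt.comp (f := fun t : ℝ => (x, t)) (G.ct x hx t ht) (by fun_prop))

lemma Ker.dx (G : Ker a b B g) {B' : ℝ} {g' : ℝ → ℝ → ℝ} (G' : Ker a b B' g')
    (hd : ∀ x ∈ Ioo a b, ∀ t ≠ 0, HasDerivAt (fun x => g x t) (g' x t) x) (hx : x ∈ Ioo a b) (t : ℝ) :
    HasDerivAt (fun x => ∫ s in (0:ℝ)..t, g x s) (∫ s in (0:ℝ)..t, g' x s) x := by
  refine (intervalIntegral.hasDerivAt_integral_of_dominated_loc_of_deriv_le (bound := fun t => B'*(1/√(mu |t|)))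
    (Ioo_mem_nhds hx.1 hx.2) (Eventually.of_forall fun x => (G.ms x).aestronglyMeasurable) (G.int hx _ _)
    (G'.ms x).aestronglyMeasurable (Eventually.of_forall fun t _ x hx => G'.bd x hx t) ((mu_int _ _).const_mul B') ?_).2
  exact ae_ne0.mono fun t ht _ x hx => hd x hx t ht
end

/-- first half of the two-variable chain rule -/
lemma chain1 {F Fx : ℝ → ℝ → ℝ} {g : ℝ → ℝ} {xo : ℝ} {a b : ℝ} (hx : xo ∈ Ioo a b)
    (hd : ∀ x ∈ Ioo a b, ∀ t, HasDerivAt (fun x => F x t) (Fx x t) x)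
    (hc : ContinuousAt (fun p : ℝ × ℝ => Fx p.1 p.2) (xo, g xo)) (hg : ContinuousAt g xo) :
    HasDerivAt (fun x => F x (g x) - F xo (g x)) (Fx xo (g xo)) xo := by
  rw [hasDerivAt_iff_isLittleO, Asymptotics.isLittleO_iff]
  intro ε hε
  obtain ⟨s, hs, r, hr, H⟩ := mem_nhds_prod_iff.1 (hc (Metric.closedBall_mem_nhds _ hε))
  obtain ⟨l, u, hlu, hsub⟩ := mem_nhds_iff_exists_Ioo_subset.1 (inter_mem hs (Ioo_mem_nhds hx.1 hx.2))
  filter_upwards [hg hr, Ioo_mem_nhds hlu.1 hlu.2] with x hgx hx'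
  have := (convex_Ioo l u).norm_image_sub_le_of_norm_hasDerivWithin_le (C := ε)
    (f := fun y => F y (g x) - y*Fx xo (g xo)) (f' := fun y => Fx y (g x) - 1*Fx xo (g xo)) (fun y hy =>
    ((hd y (hsub hy).2 _).sub ((hasDerivAt_id y).mul_const _)).hasDerivWithinAt) (fun y hy => by
      have := H (mk_mem_prod (hsub hy).1 hgx)
      simp only [mem_preimage, Metric.mem_closedBall, Real.dist_eq] at this
      simpa using this) hlu hx'
  simp only [smul_eq_mul, sub_self, sub_zero]
  convert this using 2
  ring

lemma chain2 {F Fx : ℝ → ℝ → ℝ} {g : ℝ → ℝ} {xo g' Ft : ℝ} {a b : ℝ} (hx : xo ∈ Ioo a b)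
    (hd : ∀ x ∈ Ioo a b, ∀ t, HasDerivAt (fun x => F x t) (Fx x t) x)
    (hc : ContinuousAt (fun p : ℝ × ℝ => Fx p.1 p.2) (xo, g xo)) (hg : HasDerivAt g g' xo)
    (ht : HasDerivAt (F xo) Ft (g xo)) :
    HasDerivAt (fun x => F x (g x)) (Fx xo (g xo) + Ft*g') xo := by
  refine ((chain1 hx hd hc hg.continuousAt).add (ht.comp xo hg)).congr_of_eventuallyEq (Eventually.of_forall fun x => ?_)
  simp

structure EX (a b c M K : ℝ) (w q : ℝ → ℝ → ℝ) : Prop where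
  c0 : 0 < c
  K0 : 0 ≤ K
  wc : Continuous (fun p : ℝ × ℝ => w p.1 p.2)
  qc : Continuous (fun p : ℝ × ℝ => q p.1 p.2)
  lo : ∀ x ∈ Ioo a b, ∀ t, c*mu |t| ≤ w x t
  hi : ∀ x ∈ Ioo a b, ∀ t, w x t ≤ M
  qb : ∀ x t, |q x t| ≤ K*mu |t|
  wx : ∀ x t, HasDerivAt (fun x => w x t) (q x t) x
  w0 : ∀ x, w x 0 = 0

noncomputable def gY (w : ℝ → ℝ → ℝ) (x t : ℝ) : ℝ := 1/√(w x t)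
noncomputable def gX (w q : ℝ → ℝ → ℝ) (x t : ℝ) : ℝ := -q x t/(2*w x t*√(w x t))
noncomputable def YY (w : ℝ → ℝ → ℝ) (x t : ℝ) : ℝ := ∫ s in (0:ℝ)..t, gY w x s
noncomputable def YX (w q : ℝ → ℝ → ℝ) (x t : ℝ) : ℝ := ∫ s in (0:ℝ)..t, gX w q x s
noncomputable def PS (w : ℝ → ℝ → ℝ) (x y : ℝ) : ℝ := Function.invFun (YY w x) y

section
variable {a b c M K x : ℝ} {w q : ℝ → ℝ → ℝ}
local notation "EE" => EX a b c M K w q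

lemma EX.wp (E : EE) (hx : x ∈ Ioo a b) {t : ℝ} (ht : t ≠ 0) : 0 < w x t :=
  lt_of_lt_of_le (mul_pos E.c0 (mu_pos (abs_pos.2 ht))) (E.lo x hx t)

lemma EX.wcx (E : EE) (x : ℝ) : Continuous (w x) :=
  E.wc.comp (f := fun t : ℝ => (x, t)) (by fun_prop)

lemma EX.qcx (E : EE) (x : ℝ) : Continuous (q x) :=
  E.qc.comp (f := fun t : ℝ => (x, t)) (by fun_prop)

lemma EX.kY (E : EE) : Ker a b (1/√c) (gY w) where
  bd := fun x hx t => by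
    have c0 := E.c0
    rcases eq_or_ne t 0 with rfl | ht
    · simp [gY, E.w0, mu]
    have m0 := mu_pos (abs_pos.2 ht)
    have := E.wp hx ht
    rw [gY, abp p!, div_mul_div_comm, one_mul, ← Real.sqrt_mul c0.le]
    gcongr
    exact E.lo x hx t
  ct := fun x hx t ht => by
    unfold gY
    have := (sqp (E.wp hx ht)).ne'
    exact continuousAt_const.div E.wc.continuousAt.sqrt this
  ms := fun x => by
    have := (E.wcx x).measurable
    unfold gY; fun_prop

lemma EX.kX (E : EE) : Ker a b (K/(2*c*√c)) (gX w q) where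
  bd := fun x hx t => by
    have c0 := E.c0
    have K0 := E.K0
    rcases eq_or_ne t 0 with rfl | ht
    · simp [gX, E.w0, mu]
    have m0 := mu_pos (abs_pos.2 ht)
    have := E.wp hx ht
    have lo := E.lo x hx t
    rw [gX, abs_div, abs_neg, abp (p! : 0 < 2*w x t*√(w x t))]
    calc |q x t|/(2*w x t*√(w x t)) ≤ (K*mu |t|)/(2*(c*mu |t|)*√(c*mu |t|)) := by
          gcongr; exact E.qb x t
      _ = _ := by rw [Real.sqrt_mul c0.le]; field_simp
  ct := fun x hx t ht => by
    unfold gX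
    have h1 := E.wp hx ht
    have := sqp h1
    exact E.qc.continuousAt.neg.div ((continuousAt_const.mul E.wc.continuousAt).mul E.wc.continuousAt.sqrt) p!
  ms := fun x => by
    have := (E.wcx x).measurable
    have := (E.qcx x).measurable
    unfold gX; fun_prop

lemma EX.YYc (E : EE) (hx : x ∈ Ioo a b) (t : ℝ) :
    ContinuousAt (fun p : ℝ × ℝ => YY w p.1 p.2) (x, t) := E.kY.cont hx t
lemma EX.YXc (E : EE) (hx : x ∈ Ioo a b) (t : ℝ) :
    ContinuousAt (fun p : ℝ × ℝ => YX w q p.1 p.2) (x, t) := E.kX.cont hx t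
lemma EX.YYt (E : EE) (hx : x ∈ Ioo a b) {t : ℝ} (ht : t ≠ 0) :
    HasDerivAt (YY w x) (gY w x t) t := E.kY.dt hx ht
lemma EX.YXt (E : EE) (hx : x ∈ Ioo a b) {t : ℝ} (ht : t ≠ 0) :
    HasDerivAt (YX w q x) (gX w q x t) t := E.kX.dt hx ht
lemma EX.YYx (E : EE) (hx : x ∈ Ioo a b) (t : ℝ) :
    HasDerivAt (fun x => YY w x t) (YX w q x t) x := by
  refine E.kY.dx E.kX (fun x hx t ht => ?_) hx t
  have h1 := E.wp hx ht
  have h2 := sqp h1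
  unfold gY gX
  have := ((E.wx x t).sqrt h1.ne').inv h2.ne'
  simp only [one_div]
  refine this.congr_deriv ?_
  rw [sqs h1.le]; field_simp

lemma YY0 : YY w x 0 = 0 := intervalIntegral.integral_same
lemma YX0 : YX w q x 0 = 0 := intervalIntegral.integral_same

lemma EX.M0 (E : EE) (hx : x ∈ Ioo a b) : 0 < M := (E.wp hx one_ne_zero).trans_le (E.hi x hx 1)

lemma EX.YYinc (E : EE) (hx : x ∈ Ioo a b) {s t : ℝ} (hst : s ≤ t) :
    (t-s)*(1/√M) ≤ YY w x t - YY w x s := by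
  unfold YY
  rw [intervalIntegral.integral_interval_sub_left (E.kY.int hx _ _) (E.kY.int hx _ _)]
  have : (∫ _ in s..t, 1/√M) = (t-s)*(1/√M) := by simp
  rw [← this]
  refine intervalIntegral.integral_mono_ae hst intervalIntegrable_const (E.kY.int hx _ _) (ae_ne0.mono fun t ht => ?_)
  have := E.wp hx ht
  have := E.hi x hx t
  unfold gY
  show 1/√M ≤ _
  gcongr

lemma EX.YYm (E : EE) (hx : x ∈ Ioo a b) : StrictMono (YY w x) := fun s t hst => by
  have := E.YYinc hx hst.le
  have h2 : 0 < (t-s)*(1/√M) := mul_pos l! (one_div_pos.2 (sqp (E.M0 hx)))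
  linarith

lemma EX.YYs (E : EE) (hx : x ∈ Ioo a b) : Function.Surjective (YY w x) := by
  have M0 := one_div_pos.2 (sqp (E.M0 hx))
  have hc : Continuous (YY w x) := continuous_iff_continuousAt.2 fun t =>
    ContinuousAt.comp (f := fun t : ℝ => (x, t)) (E.YYc hx t) (by fun_prop)
  refine hc.surjective ?_ ?_
  · refine tendsto_atTop_mono' atTop ?_ (tendsto_id.atTop_mul_const M0)
    filter_upwards [eventually_ge_atTop 0] with t ht
    have := E.YYinc hx ht
    rw [YY0] at this; simpa using this
  · refine tendsto_atBot_mono' atBot ?_ (tendsto_id.atBot_mul_const M0)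
    filter_upwards [eventually_le_atBot 0] with t ht
    have := E.YYinc hx ht
    rw [YY0] at this
    simp only [id]; linarith

lemma EX.PSl (E : EE) (hx : x ∈ Ioo a b) (t : ℝ) : PS w x (YY w x t) = t :=
  Function.leftInverse_invFun (E.YYm hx).injective t
lemma EX.PSr (E : EE) (hx : x ∈ Ioo a b) (y : ℝ) : YY w x (PS w x y) = y :=
  Function.rightInverse_invFun (E.YYs hx) y
lemma EX.PS0 (E : EE) (hx : x ∈ Ioo a b) : PS w x 0 = 0 := by
  have := E.PSl hx 0
  rwa [YY0] at this
lemma EX.PSm (E : EE) (hx : x ∈ Ioo a b) : StrictMono (PS w x) := fun s t hst => by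
  rw [← (E.YYm hx).lt_iff_lt, E.PSr hx, E.PSr hx]; exact hst
lemma EX.PSp (E : EE) (hx : x ∈ Ioo a b) {y : ℝ} (hy : 0 < y) : 0 < PS w x y := by
  have := E.PSm hx hy
  rwa [E.PS0 hx] at this
lemma EX.PSn (E : EE) (hx : x ∈ Ioo a b) {y : ℝ} (hy : 0 ≤ y) : 0 ≤ PS w x y := by
  have := (E.PSm hx).monotone hy
  rwa [E.PS0 hx] at this

lemma EX.PSc (E : EE) (hx : x ∈ Ioo a b) (y : ℝ) :
    ContinuousAt (fun p : ℝ × ℝ => PS w p.1 p.2) (x, y) := by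
  have hev : ∀ᶠ p : ℝ × ℝ in 𝓝 (x, y), p.1 ∈ Ioo a b := continuousAt_fst (Ioo_mem_nhds hx.1 hx.2)
  have key : ∀ t, ContinuousAt (fun p : ℝ × ℝ => YY w p.1 t) (x, y) := fun t =>
    ContinuousAt.comp (x := (x, y)) (f := fun p : ℝ × ℝ => (p.1, t)) (g := fun p : ℝ × ℝ => YY w p.1 p.2) (E.YYc hx t) (by fun_prop)
  refine tendsto_order.2 ⟨fun t ht => ?_, fun t ht => ?_⟩
  · have : YY w x t < y := by rw [← E.PSr hx y]; exact E.YYm hx ht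
    filter_upwards [hev, (key t).eventually_lt continuousAt_snd this] with p hp h
    rwa [← (E.YYm hp).lt_iff_lt, E.PSr hp]
  · have : y < YY w x t := by rw [← E.PSr hx y]; exact E.YYm hx ht
    filter_upwards [hev, continuousAt_snd.eventually_lt (key t) this] with p hp h
    rwa [← (E.YYm hp).lt_iff_lt, E.PSr hp]

lemma EX.PSne (E : EE) (hx : x ∈ Ioo a b) {y : ℝ} (hy : y ≠ 0) : PS w x y ≠ 0 := fun h => by
  rw [← E.PS0 hx] at h
  exact hy ((E.PSm hx).injective h)

lemma EX.PSy (E : EE) (hx : x ∈ Ioo a b) {y : ℝ} (hy : y ≠ 0) :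
    HasDerivAt (PS w x) (√(w x (PS w x y))) y := by
  have hn := E.PSne hx hy
  have hp := sqp (E.wp hx hn)
  have := HasDerivAt.of_local_left_inverse (f := YY w x) (g := PS w x) (a := y)
    (ContinuousAt.comp (f := fun t : ℝ => (x, t)) (E.PSc hx y) (by fun_prop)) (E.YYt hx hn)
    (by unfold gY; positivity) (Eventually.of_forall (E.PSr hx))
  refine this.congr_deriv ?_
  unfold gY; simp

lemma EX.PSx (E : EE) (hx : x ∈ Ioo a b) {y : ℝ} (hy : y ≠ 0) :
    HasDerivAt (fun x => PS w x y) (-(√(w x (PS w x y))*YX w q x (PS w x y))) x := by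
  have hc : ContinuousAt (fun x => PS w x y) x := ContinuousAt.comp (f := fun x : ℝ => (x, y)) (E.PSc hx y) (by fun_prop)
  have h1 := chain1 (F := YY w) (Fx := YX w q) (g := fun x => PS w x y) hx (fun x hx t => E.YYx hx t) (E.YXc hx _) hc
  have h2 := h1.const_sub y
  have e : y - (YY w x (PS w x y) - YY w x (PS w x y)) = y := by ring
  have h3 := HasDerivAt.comp x (h₂ := PS w x) (by rw [e]; exact E.PSy hx hy) h2
  refine (h3.congr_of_eventuallyEq ?_).congr_deriv (by ring)
  filter_upwards [Ioo_mem_nhds hx.1 hx.2] with x' hx'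
  simp only [Function.comp, E.PSr hx', sub_sub_cancel, E.PSl hx]
end

structure FX (wo f p : ℝ → ℝ) (U2 X a b c M K Z : ℝ) (w q z : ℝ → ℝ → ℝ) : Prop where
  E : EX a b c M K w q
  sub : ∀ x ∈ Icc 0 X, x ∈ Ioo a b
  zc : Continuous (fun p : ℝ × ℝ => z p.1 p.2)
  zb : ∀ x t, |z x t| ≤ Z
  zp : ∀ x ∈ Icc 0 X, 0 < z x 0
  wt : ∀ x ∈ Icc 0 X, ∀ t > 0, HasDerivAt (w x) (z x t) t
  zt : ∀ x ∈ Icc 0 X, ∀ t > 0, HasDerivAt (z x) ((q x t + 2*f x)/√(w x t)) t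
  ini : ∀ t ≥ 0, w 0 t = wo t
  inf : ∀ x ∈ Icc 0 X, Tendsto (w x) atTop (𝓝 (U2 - 2*(p x - p 0)))

theorem VMFlow.ext {wo f p : ℝ → ℝ} {U2 X c M K Z : ℝ} {w q z : ℝ → ℝ → ℝ}
    (V : VMFlow wo f p U2 X c M K Z w q z) :
    ∃ a b c' M' w' q' z', FX wo f p U2 X a b c' M' K Z w' q' z' := by
  have X0 := V.X0
  have c0 := V.c0
  have K1 := V.K1
  obtain ⟨pr, hpr⟩ : ∃ g : ℝ → ℝ, g = fun x => max 0 (min x X) := ⟨_, rfl⟩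
  have prc : Continuous pr := by rw [hpr]; fun_prop
  have prm : ∀ x, pr x ∈ Icc 0 X := fun x => by
    rw [hpr]; exact ⟨le_max_left _ _, max_le X0.le (min_le_right _ _)⟩
  have pri : ∀ x ∈ Icc 0 X, pr x = x := fun x hx => by
    rw [hpr]; simp only; rw [min_eq_left hx.2, max_eq_right hx.1]
  have mm : Continuous (fun p : ℝ × ℝ => (pr p.1, |p.2|)) := by fun_prop
  have mp : ∀ p : ℝ × ℝ, (pr p.1, |p.2|) ∈ Icc 0 X ×ˢ Ici (0:ℝ) := fun p => ⟨prm _, abs_nonneg p.2⟩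
  obtain ⟨q', hq'⟩ : ∃ g : ℝ → ℝ → ℝ, g = fun x t => q (pr x) |t| := ⟨_, rfl⟩
  obtain ⟨z', hz'⟩ : ∃ g : ℝ → ℝ → ℝ, g = fun x t => z (pr x) |t| := ⟨_, rfl⟩
  obtain ⟨w', hw'⟩ : ∃ g : ℝ → ℝ → ℝ, g = fun x t => w 0 |t| + ∫ s in (0:ℝ)..x, q' s t := ⟨_, rfl⟩
  have qc : Continuous (fun p : ℝ × ℝ => q' p.1 p.2) := by rw [hq']; exact V.qc.comp_continuous mm mp
  have zc : Continuous (fun p : ℝ × ℝ => z' p.1 p.2) := by rw [hz']; exact V.zc.comp_continuous mm mp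
  have m0 : (0:ℝ) ∈ Icc 0 X := ⟨le_rfl, X0.le⟩
  have w0c : Continuous (fun t => w 0 |t|) := ContinuousOn.comp_continuous (s := Ici 0)
    (fun t ht => (V.wt 0 m0 t ht).continuousWithinAt) continuous_abs (fun t => abs_nonneg t)
  have wc : Continuous (fun p : ℝ × ℝ => w' p.1 p.2) := by
    rw [hw']
    refine (w0c.comp continuous_snd).add ?_
    exact intervalIntegral.continuous_parametric_intervalIntegral_of_continuous (f := fun (p : ℝ × ℝ) s => q' s p.2)
      (qc.comp (f := fun r : (ℝ × ℝ) × ℝ => (r.2, r.1.2)) (by fun_prop)) continuous_fst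
  have qct : ∀ t, Continuous (fun x => q' x t) := fun t => qc.comp (f := fun x : ℝ => (x, t)) (by fun_prop)
  have wx : ∀ x t, HasDerivAt (fun x => w' x t) (q' x t) x := fun x t => by
    rw [hw']
    exact (intervalIntegral.integral_hasDerivAt_right ((qct t).intervalIntegrable _ _)
      ((qct t).stronglyMeasurableAtFilter _ _) (qct t).continuousAt).const_add _
  have eqw : ∀ x ∈ Icc 0 X, ∀ t, w' x t = w x |t| := fun x hx t => by
    have hs : Icc 0 x ⊆ Icc 0 X := Icc_subset_Icc_right hx.2
    have := intervalIntegral.integral_eq_sub_of_hasDerivAt_of_le (f := fun x => w x |t|) (f' := fun x => q' x t) hx.1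
      (fun y hy => ((V.wx y (hs hy) _ (abs_nonneg t)).continuousWithinAt).mono hs) (fun y hy => by
        have hy' : y ∈ Ioo 0 X := ⟨hy.1, hy.2.trans_le hx.2⟩
        rw [hq']; simp only
        rw [pri y ⟨hy'.1.le, hy'.2.le⟩]
        exact (V.wx y ⟨hy'.1.le, hy'.2.le⟩ _ (abs_nonneg t)).hasDerivAt (Icc_mem_nhds hy'.1 hy'.2))
      ((qct t).intervalIntegrable _ _)
    rw [hw']; simp only; rw [this]; ring
  have qb : ∀ x t, |q' x t| ≤ K*mu |t| := fun x t => by rw [hq']; exact V.qb _ (prm x) _ (abs_nonneg t)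
  obtain ⟨δ, hδ⟩ := exr (c/(2*K))
  have δ0 : 0 < δ := by rw [hδ]; positivity
  have mu0 : ∀ t : ℝ, 0 ≤ mu |t| := fun t => le_min (abs_nonneg t) zero_le_one
  have near : ∀ x ∈ Ioo (-δ) (X+δ), ∀ t, |w' x t - w (pr x) (|t|)| ≤ c/2*mu |t| := fun x hx t => by
    rw [← eqw _ (prm x) t]
    have h1 := convex_univ.norm_image_sub_le_of_norm_hasDerivWithin_le (f := fun x => w' x t) (C := K*mu |t|)
      (fun y _ => (wx y t).hasDerivWithinAt) (fun y _ => qb y t) (mem_univ (pr x)) (mem_univ x)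
    refine h1.trans ?_
    have h2 : ‖x - pr x‖ ≤ δ := by
      rw [Real.norm_eq_abs, hpr]; simp only
      have h3 := hx.1
      have h4 := hx.2
      rcases le_total x X with h | h
      · rw [min_eq_left h]
        rcases le_total 0 x with h' | h'
        · rw [max_eq_right h']; simp [δ0.le]
        · rw [max_eq_left h', sub_zero, abs_of_nonpos h']; linarith
      · rw [min_eq_right h, max_eq_right X0.le, abn l!]; linarith
    have := mu0 t
    calc K*mu |t| * ‖x - pr x‖ ≤ K*mu |t| * δ := by gcongr
      _ = _ := by rw [hδ]; field_simp
  have eqw' : ∀ x ∈ Icc 0 X, ∀ t > 0, w' x =ᶠ[𝓝 t] w x := fun x hx t ht => by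
    filter_upwards [lt_mem_nhds ht] with s hs
    rw [eqw x hx, abp hs]
  refine ⟨-δ, X+δ, c/2, M+c/2, w', q', z', ⟨p!, l!, wc, qc, fun x hx t => ?_, fun x hx t => ?_,
    qb, wx, fun x => ?_⟩, fun x hx => ⟨by linarith [hx.1], by linarith [hx.2]⟩, zc, fun x t => ?_, fun x hx => ?_,
    fun x hx t ht => ?_, fun x hx t ht => ?_, fun t ht => ?_, fun x hx => ?_⟩
  · have h1 := abs_le.1 (near x hx t)
    have h2 := V.lo _ (prm x) _ (abs_nonneg t)
    linarith
  · have h1 := abs_le.1 (near x hx t)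
    have h2 := V.hi _ (prm x) _ (abs_nonneg t)
    have h3 : mu |t| ≤ 1 := min_le_right _ _
    nlinarith only [h1, h2, h3, c0]
  · have : ∀ s, q' s 0 = 0 := fun s => by
      have := qb s 0
      rw [abs_zero, mu, min_eq_left zero_le_one, mul_zero] at this
      exact abs_eq_zero.1 (le_antisymm this (abs_nonneg _))
    rw [hw']; simp [this, V.w0 0 m0]
  · rw [hz']; exact V.zb _ (prm x) _ (abs_nonneg t)
  · rw [hz']; simp only [abs_zero]
    rw [pri x hx]
    refine c0.trans_le ?_
    have h1 := (V.wt x hx 0 le_rfl)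
    rw [hasDerivWithinAt_iff_tendsto_slope, Ici_sdiff_left] at h1
    refine ge_of_tendsto h1 ?_
    filter_upwards [Ioo_mem_nhdsGT zero_lt_one] with t ht
    rw [slope_def_field, V.w0 x hx, sub_zero, sub_zero, ldi ht.1]
    have := V.lo x hx t ht.1.le
    rwa [mu, min_eq_left ht.2.le] at this
  · rw [hz']; simp only
    rw [pri x hx, abp ht]
    exact ((V.wt x hx t ht.le).hasDerivAt (Ici_mem_nhds ht)).congr_of_eventuallyEq (eqw' x hx t ht)
  · rw [eqw x hx, hq', hz']; simp only
    rw [pri x hx, abp ht]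
    refine (V.zt x hx t ht).congr_of_eventuallyEq ?_
    filter_upwards [lt_mem_nhds ht] with s hs
    rw [abp hs]
  · rw [eqw 0 m0, abn ht, V.ini t ht]
  · refine (V.inf x hx).congr' ?_
    filter_upwards [eventually_ge_atTop 0] with t ht
    rw [eqw x hx, abn ht]

noncomputable def pP (w : ℝ → ℝ → ℝ) (x y : ℝ) : ℝ := PS w x (max y 0)
noncomputable def uU (w z : ℝ → ℝ → ℝ) (f : ℝ → ℝ) (x y : ℝ) : ℝ :=
  √(w x (pP w x y)) + (z x 0/2*min y 0 + f x/2*(min y 0)^2)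
noncomputable def uY (w z : ℝ → ℝ → ℝ) (f : ℝ → ℝ) (x y : ℝ) : ℝ := z x (pP w x y)/2 + f x*min y 0
noncomputable def uYY (w q : ℝ → ℝ → ℝ) (f : ℝ → ℝ) (x y : ℝ) : ℝ := q x (pP w x y)/2 + f x
noncomputable def rX (w q z : ℝ → ℝ → ℝ) (x t : ℝ) : ℝ := q x t/(2*√(w x t)) - z x t/2*YX w q x t
noncomputable def uX (w q z : ℝ → ℝ → ℝ) (x y : ℝ) : ℝ := rX w q z x (pP w x y)
noncomputable def vV (w q : ℝ → ℝ → ℝ) (x y : ℝ) : ℝ := √(w x (pP w x y))*YX w q x (pP w x y)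

section
variable {wo f p uo U : ℝ → ℝ} {U2 X a b c M K Z x : ℝ} {w q z : ℝ → ℝ → ℝ}
local notation "FF" => FX wo f p U2 X a b c M K Z w q z

lemma EX.pc (E : EX a b c M K w q) (hx : x ∈ Ioo a b) (y : ℝ) :
    ContinuousAt (fun p : ℝ × ℝ => (p.1, pP w p.1 p.2)) (x, y) :=
  continuousAt_fst.prodMk (ContinuousAt.comp (x := (x, y)) (f := fun p : ℝ × ℝ => (p.1, max p.2 0))
    (g := fun p : ℝ × ℝ => PS w p.1 p.2) (E.PSc hx _) (by fun_prop))

lemma EX.cP (E : EX a b c M K w q) (hx : x ∈ Ioo a b) (y : ℝ) {F : ℝ → ℝ → ℝ}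
    (hF : ContinuousAt (fun p : ℝ × ℝ => F p.1 p.2) (x, pP w x y)) :
    ContinuousAt (fun p : ℝ × ℝ => F p.1 (pP w p.1 p.2)) (x, y) :=
  ContinuousAt.comp (x := (x, y)) (f := fun p : ℝ × ℝ => (p.1, pP w p.1 p.2)) (g := fun p : ℝ × ℝ => F p.1 p.2) hF (E.pc hx y)

lemma sl {F : ℝ → ℝ → ℝ} {y : ℝ} (h : ContinuousAt (fun p : ℝ × ℝ => F p.1 p.2) (x, y)) : ContinuousAt (F x) y :=
  ContinuousAt.comp (f := fun y : ℝ => (x, y)) h (by fun_prop)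

lemma FX.uUc (H : FF) (fc : Continuous f) (hx : x ∈ Icc 0 X) (y : ℝ) :
    ContinuousAt (fun p : ℝ × ℝ => uU w z f p.1 p.2) (x, y) := by
  have zc : Continuous (fun x => z x 0) := H.zc.comp (f := fun x : ℝ => (x, (0:ℝ))) (by fun_prop)
  refine (H.E.cP (H.sub x hx) y (F := fun x t => √(w x t)) H.E.wc.continuousAt.sqrt).add (Continuous.continuousAt ?_)
  fun_prop

lemma FX.uYc (H : FF) (fc : Continuous f) (hx : x ∈ Icc 0 X) (y : ℝ) :
    ContinuousAt (fun p : ℝ × ℝ => uY w z f p.1 p.2) (x, y) := by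
  refine (H.E.cP (H.sub x hx) y (F := fun x t => z x t/2) (H.zc.continuousAt.div_const 2)).add (Continuous.continuousAt ?_)
  fun_prop

lemma FX.uYYc (H : FF) (fc : Continuous f) (hx : x ∈ Icc 0 X) (y : ℝ) :
    ContinuousAt (fun p : ℝ × ℝ => uYY w q f p.1 p.2) (x, y) := by
  refine (H.E.cP (H.sub x hx) y (F := fun x t => q x t/2) (H.E.qc.continuousAt.div_const 2)).add (Continuous.continuousAt ?_)
  fun_prop

lemma EX.qsc (E : EX a b c M K w q) (hx : x ∈ Ioo a b) (t : ℝ) :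
    ContinuousAt (fun p : ℝ × ℝ => q p.1 p.2/(2*√(w p.1 p.2))) (x, t) := by
  rcases eq_or_ne t 0 with rfl | ht
  · have c0 := E.c0
    have K0 := E.K0
    have h0 : q x 0/(2*√(w x 0)) = 0 := by rw [E.w0]; simp
    rw [ContinuousAt, h0]
    have : Continuous (fun p : ℝ × ℝ => K/(2*√c)*√(mu |p.2|)) := by unfold mu; fun_prop
    have := this.tendsto (x, 0)
    simp only [abs_zero, mu, min_eq_left zero_le_one, Real.sqrt_zero, mul_zero] at this
    refine squeeze_zero_norm' ?_ this
    have hev : ∀ᶠ p : ℝ × ℝ in 𝓝 (x, 0), p.1 ∈ Ioo a b := continuousAt_fst (Ioo_mem_nhds hx.1 hx.2)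
    filter_upwards [hev] with p hp
    show |_| ≤ K/(2*√c)*√(mu |p.2|)
    rcases eq_or_ne p.2 0 with h | ht
    · rw [h, E.w0]; simp; positivity
    have m0 := mu_pos (abs_pos.2 ht)
    have := E.wp hp ht
    rw [abs_div, abp (p! : 0 < 2*√(w p.1 p.2))]
    calc |q p.1 p.2|/(2*√(w p.1 p.2)) ≤ (K*mu |p.2|)/(2*√(c*mu |p.2|)) := by
          gcongr
          · exact E.qb _ _
          · exact E.lo _ hp _
      _ = _ := by
          rw [Real.sqrt_mul c0.le]
          have h1 := sqp m0
          have h2 := sqp c0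
          field_simp
          rw [sqs m0.le]
  · have := sqp (E.wp hx ht)
    exact E.qc.continuousAt.div (continuousAt_const.mul E.wc.continuousAt.sqrt) p!

lemma FX.uXc (H : FF) (hx : x ∈ Icc 0 X) (y : ℝ) :
    ContinuousAt (fun p : ℝ × ℝ => uX w q z p.1 p.2) (x, y) :=
  H.E.cP (H.sub x hx) y (F := rX w q z) ((H.E.qsc (H.sub x hx) _).sub
    ((H.zc.continuousAt.div_const 2).mul (H.E.YXc (H.sub x hx) _)))

lemma FX.vVc (H : FF) (hx : x ∈ Icc 0 X) (y : ℝ) :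
    ContinuousAt (fun p : ℝ × ℝ => vV w q p.1 p.2) (x, y) :=
  H.E.cP (H.sub x hx) y (F := fun x t => √(w x t)*YX w q x t) (H.E.wc.continuousAt.sqrt.mul (H.E.YXc (H.sub x hx) _))

lemma pPp {y : ℝ} (hy : 0 ≤ y) : pP w x y = PS w x y := by rw [pP, max_eq_left hy]
lemma EX.pPn (E : EX a b c M K w q) (hx : x ∈ Ioo a b) {y : ℝ} (hy : y ≤ 0) : pP w x y = 0 := by
  rw [pP, max_eq_right hy, E.PS0 hx]

lemma EX.pPy (E : EX a b c M K w q) (hx : x ∈ Ioo a b) {y : ℝ} (hy : 0 < y) :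
    HasDerivAt (pP w x) (√(w x (pP w x y))) y := by
  have := E.PSy hx hy.ne'
  rw [← pPp hy.le] at this
  refine this.congr_of_eventuallyEq ?_
  filter_upwards [lt_mem_nhds hy] with s hs using pPp hs.le

lemma FX.ps (H : FF) (hx : x ∈ Icc 0 X) {y : ℝ} (hy : 0 < y) :
    0 < pP w x y ∧ 0 < w x (pP w x y) ∧ 0 < √(w x (pP w x y)) := by
  have h1 : 0 < pP w x y := by rw [pPp hy.le]; exact H.E.PSp (H.sub x hx) hy
  have h2 := H.E.wp (H.sub x hx) h1.ne'
  exact ⟨h1, h2, sqp h2⟩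

lemma FX.duU (H : FF) (fc : Continuous f) (hx : x ∈ Icc 0 X) (y : ℝ) :
    HasDerivAt (uU w z f x) (uY w z f x y) y := by
  refine hasDerivAt_of_hasDerivAt_of_ne' (x := 0) (fun y hy => ?_) (sl (H.uUc fc hx 0)) (sl (H.uYc fc hx 0)) y
  rcases hy.lt_or_gt with hy | hy
  · have h := ((hasDerivAt_id y).const_mul (z x 0/2)).add (((hasDerivAt_id y).pow 2).const_mul (f x/2))
    refine (h.congr_of_eventuallyEq ?_).congr_deriv ?_
    · filter_upwards [gt_mem_nhds hy] with s hs
      rw [uU, H.E.pPn (H.sub x hx) hs.le, H.E.w0, min_eq_left hs.le]; simp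
    · rw [uY, H.E.pPn (H.sub x hx) hy.le, min_eq_left hy.le]; simp; ring
  · obtain ⟨h1, h2, h3⟩ := H.ps hx hy
    have h := ((H.wt x hx _ h1).comp y (H.E.pPy (H.sub x hx) hy)).sqrt h2.ne'
    refine (h.congr_of_eventuallyEq ?_).congr_deriv ?_
    · filter_upwards [lt_mem_nhds hy] with s hs
      rw [uU, min_eq_right hs.le]; simp
    · rw [uY, min_eq_right hy.le]; simp only [Function.comp]; field_simp; ring

lemma FX.duY (H : FF) (fc : Continuous f) (hx : x ∈ Icc 0 X) (y : ℝ) :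
    HasDerivAt (uY w z f x) (uYY w q f x y) y := by
  refine hasDerivAt_of_hasDerivAt_of_ne' (x := 0) (fun y hy => ?_) (sl (H.uYc fc hx 0)) (sl (H.uYYc fc hx 0)) y
  rcases hy.lt_or_gt with hy | hy
  · have h := ((hasDerivAt_id y).const_mul (f x)).const_add (z x 0/2)
    have q0 : q x 0 = 0 := by
      have := H.E.qb x 0
      rw [abs_zero, mu, min_eq_left zero_le_one, mul_zero] at this
      exact abs_eq_zero.1 (le_antisymm this (abs_nonneg _))
    refine (h.congr_of_eventuallyEq ?_).congr_deriv ?_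
    · filter_upwards [gt_mem_nhds hy] with s hs
      rw [uY, H.E.pPn (H.sub x hx) hs.le, min_eq_left hs.le]; simp
    · rw [uYY, H.E.pPn (H.sub x hx) hy.le, q0]; simp
  · obtain ⟨h1, h2, h3⟩ := H.ps hx hy
    have h := ((H.zt x hx _ h1).comp y (H.E.pPy (H.sub x hx) hy)).div_const 2
    refine (h.congr_of_eventuallyEq ?_).congr_deriv ?_
    · filter_upwards [lt_mem_nhds hy] with s hs
      rw [uY, min_eq_right hs.le]; simp
    · rw [uYY]; field_simp

lemma FX.dvV (H : FF) (hx : x ∈ Icc 0 X) (y : ℝ) :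
    HasDerivAt (vV w q x) (-uX w q z x y) y := by
  refine hasDerivAt_of_hasDerivAt_of_ne' (g := fun y => -uX w q z x y) (x := 0) (fun y hy => ?_) (sl (H.vVc hx 0)) (sl (H.uXc hx 0)).neg y
  rcases hy.lt_or_gt with hy | hy
  · refine ((hasDerivAt_const y (0:ℝ)).congr_of_eventuallyEq ?_).congr_deriv ?_
    · filter_upwards [gt_mem_nhds hy] with s hs
      rw [vV, H.E.pPn (H.sub x hx) hs.le, H.E.w0]; simp
    · rw [uX, H.E.pPn (H.sub x hx) hy.le, rX, H.E.w0, YX0]; simp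
  · obtain ⟨h1, h2, h3⟩ := H.ps hx hy
    have h4 := ((H.wt x hx _ h1).sqrt h2.ne').mul (H.E.YXt (H.sub x hx) h1.ne')
    refine (h4.comp y (H.E.pPy (H.sub x hx) hy)).congr_deriv ?_
    rw [uX, rX, gX]
    have e := sqs h2.le
    have e2 : w x (pP w x y) ≠ 0 := h2.ne'
    have h3 := h3.ne'
    generalize √(w x (pP w x y)) = r, w x (pP w x y) = W at *
    field_simp
    linear_combination (-(q x (pP w x y)))*e

lemma FX.dxU (H : FF) (hx : x ∈ Icc 0 X) {y : ℝ} (hy : 0 ≤ y) :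
    HasDerivAt (fun x => uU w z f x y) (uX w q z x y) x := by
  have hI := Ioo_mem_nhds (H.sub x hx).1 (H.sub x hx).2
  rcases hy.eq_or_lt with rfl | hy
  · refine ((hasDerivAt_const x (0:ℝ)).congr_of_eventuallyEq ?_).congr_deriv ?_
    · filter_upwards [hI] with s hs
      rw [uU, H.E.pPn hs le_rfl, H.E.w0]; simp
    · rw [uX, H.E.pPn (H.sub x hx) le_rfl, rX, H.E.w0, YX0]; simp
  · obtain ⟨h1, h2, h3⟩ := H.ps hx hy
    have h4 := H.wt x hx _ h1
    rw [pPp hy.le] at h4 h1 h2 h3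
    have h5 := (chain2 (F := w) (Fx := q) (g := fun x => PS w x y) (H.sub x hx) (fun x _ t => H.E.wx x t) H.E.qc.continuousAt
      (H.E.PSx (H.sub x hx) hy.ne') h4).sqrt h2.ne'
    refine (h5.congr_of_eventuallyEq ?_).congr_deriv ?_
    · refine Eventually.of_forall fun s => ?_
      simp [uU, pPp hy.le, min_eq_right hy.le]
    · rw [uX, rX, pPp hy.le]; field_simp; ring

lemma FX.init (H : FF) (X0 : 0 < X) {P : ℝ → ℝ} (P0 : P 0 = 0)
    (Pp : ∀ y > 0, 0 < P y) (Pc : ContinuousOn P (Ici 0)) (Pd : ∀ y > 0, HasDerivAt P (uo y) y)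
    (up : ∀ y > 0, 0 < uo y) (hw : ∀ y ≥ 0, wo (P y) = uo y^2) (u0 : uo 0 = 0) {y : ℝ} (hy : 0 ≤ y) :
    √(w 0 (PS w 0 y)) = uo y := by
  have m0 := H.sub 0 ⟨le_rfl, X0.le⟩
  rcases hy.eq_or_lt with rfl | hy'
  · rw [H.E.PS0 m0, H.E.w0, u0, Real.sqrt_zero]
  have ew : ∀ s > 0, w 0 (P s) = uo s^2 := fun s hs => by rw [H.ini _ (Pp s hs).le, hw s hs.le]
  obtain ⟨s, _, hs⟩ := exists_hasDerivAt_eq_slope (fun s => YY w 0 (P s)) (fun _ => 1) hy' (fun s hs =>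
    (sl (H.E.YYc m0 (P s))).comp_continuousWithinAt ((Pc s hs.1).mono Icc_subset_Ici_self)) (fun s hs => by
      refine ((H.E.YYt m0 (Pp s hs.1).ne').comp s (Pd s hs.1)).congr_deriv ?_
      have := up s hs.1
      rw [gY, ew s hs.1, Real.sqrt_sq this.le]; field_simp)
  rw [P0, YY0, eq_div_iff l!] at hs
  have e : PS w 0 y = P y := by
    rw [show y = YY w 0 (P y) by linarith, H.E.PSl m0, ← show y = YY w 0 (P y) by linarith]
  rw [e, ew y hy', Real.sqrt_sq (up y hy').le]

lemma FX.nondeg (H : FF) (X0 : 0 < X) :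
    ∃ yo > (0:ℝ), ∃ m > (0:ℝ), ∀ x ∈ Icc 0 X, ∀ y ∈ Icc 0 yo, m ≤ uY w z f x y := by
  have zc : Continuous (fun x => z x 0) := H.zc.comp (f := fun x : ℝ => (x, (0:ℝ))) (by fun_prop)
  obtain ⟨xi, h1, hm⟩ := isCompact_Icc.exists_isMinOn ⟨0, left_mem_Icc.2 X0.le⟩ (f := fun x => z x 0) (s := Icc 0 X) zc.continuousOn
  have m0 := H.zp xi h1
  obtain ⟨A, B, _, oB, hA, hB, hAB⟩ := generalized_tube_lemma (s := Icc 0 X) (t := {(0:ℝ)}) isCompact_Icc isCompact_singleton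
    (n := {p : ℝ × ℝ | z xi 0/2 < z p.1 p.2}) (isOpen_lt continuous_const H.zc) (by
      rintro ⟨x, t⟩ ⟨hx, ht⟩
      obtain rfl : t = 0 := ht
      have : z xi 0 ≤ z x 0 := hm hx
      show z xi 0/2 < z x 0
      linarith)
  obtain ⟨r, r0, hr⟩ := Metric.isOpen_iff.1 oB 0 (hB rfl)
  have M0 := H.E.M0 (H.sub 0 ⟨le_rfl, X0.le⟩)
  refine ⟨r/2*(1/√M), p!, z xi 0/4, p!, fun x hx y hy => ?_⟩
  have hI := H.sub x hx
  have h2 : PS w x y ≤ r/2 := by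
    rw [← H.E.PSl hI (r/2)]
    refine (H.E.PSm hI).monotone (hy.2.trans ?_)
    have := H.E.YYinc hI (p! : 0 ≤ r/2)
    rwa [YY0, sub_zero, sub_zero] at this
  have h3 := H.E.PSn hI hy.1
  have h4 : z xi 0/2 < z x (PS w x y) := @hAB (x, PS w x y) ⟨hA hx, hr (by
    rw [Metric.mem_ball, Real.dist_eq, sub_zero, abn h3]; linarith)⟩
  rw [uY, pPp hy.1, min_eq_right hy.1]; linarith

lemma lb {g : ℝ × ℝ → ℝ} {S : Set (ℝ × ℝ)} {a : ℝ × ℝ} (h : ContinuousWithinAt g S a) : ∀ᶠ b in 𝓝[S] a, |g b| ≤ |g a| + 1 :=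
  (h.abs.eventually_lt_const (l! : |g a| < |g a| + 1)).mono fun _ h => le_of_lt h

theorem FX.prandtl (H : FF) (X0 : 0 < X) (fc : Continuous f)
    (hp : ∀ x, deriv p x = f x) (hU : ∀ x ∈ Icc 0 X, 0 < U x ∧ U x^2 = U2 - 2*(p x - p 0))
    (hini : ∀ y ≥ 0, √(w 0 (PS w 0 y)) = uo y) : ∃ u v, PrandtlOnInterval U p uo X u v := by
  have sub : Ico 0 X ⊆ Icc 0 X := Ico_subset_Icc_self
  have uv : ∀ x, ∀ y ≥ 0, uU w z f x y = √(w x (PS w x y)) := fun x y hy => by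
    rw [uU, pPp hy, min_eq_right hy]; simp
  have e1 : ∀ x ∈ Icc 0 X, ∀ y, pd 0 1 (uU w z f) x y = uY w z f x y := fun x hx y => by
    simp only [pd, iteratedDeriv_zero, iteratedDeriv_one]; exact (H.duU fc hx y).deriv
  have e2 : ∀ x ∈ Icc 0 X, ∀ y, pd 0 2 (uU w z f) x y = uYY w q f x y := fun x hx y => by
    simp only [pd, iteratedDeriv_zero, iteratedDeriv_succ]
    rw [show deriv (uU w z f x) = uY w z f x from funext fun y => (H.duU fc hx y).deriv]
    exact (H.duY fc hx y).deriv
  have e3 : ∀ x ∈ Icc 0 X, ∀ y, pd 0 1 (vV w q) x y = -uX w q z x y := fun x hx y => by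
    simp only [pd, iteratedDeriv_zero, iteratedDeriv_one]; exact (H.dvV hx y).deriv
  have e4 : ∀ x ∈ Icc 0 X, ∀ y ≥ 0, pd 1 0 (uU w z f) x y = uX w q z x y := fun x hx y hy => by
    simp only [pd, iteratedDeriv_zero, iteratedDeriv_one]; exact (H.dxU hx hy).deriv
  have c1 : ContinuousOn (fun z : ℝ × ℝ => pd 0 1 (vV w q) z.1 z.2) (Ico 0 X ×ˢ Ici 0) :=
    ContinuousOn.congr (f := fun a : ℝ × ℝ => -uX w q z a.1 a.2)
      (fun a ha => (H.uXc (sub ha.1) a.2).neg.continuousWithinAt) fun a ha => e3 _ (sub ha.1) _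
  have c2 : ContinuousOn (fun a : ℝ × ℝ => pd 1 0 (uU w z f) a.1 a.2) (Ico 0 X ×ˢ Ici 0) :=
    ContinuousOn.congr (f := fun a : ℝ × ℝ => uX w q z a.1 a.2)
      (fun a ha => (H.uXc (sub ha.1) a.2).continuousWithinAt) fun a ha => e4 _ (sub ha.1) _ ha.2
  have c3 : ContinuousOn (fun z : ℝ × ℝ => vV w q z.1 z.2) (Ico 0 X ×ˢ Ici 0) :=
    fun a ha => (H.vVc (sub ha.1) a.2).continuousWithinAt
  obtain ⟨F, hF⟩ := isCompact_Icc.exists_bound_of_continuousOn (s := Icc 0 X) fc.continuousOn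
  refine ⟨uU w z f, vV w q, ⟨fun y hy => ?_, ?_, ⟨√M, fun x hx y hy => ?_⟩, ?_, ⟨Z/2, fun x hx y hy => ?_⟩, ?_,
    ⟨K/2+F, fun x hx y hy => ?_⟩, c3, c1, c2, fun a ha => ?_, fun x hx y hy => ?_, fun x hx y hy => ?_, fun x hx => ?_,
    fun x hx => ?_, fun x hx => ?_, fun x hx y hy => ?_, fun xb hb => ?_⟩⟩
  · rw [uv 0 y hy, hini y hy]
  · exact fun a ha => (H.uUc fc ha.1 a.2).continuousWithinAt
  · rw [uv x y hy, abn (Real.sqrt_nonneg _)]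
    exact sqm (H.E.hi x (H.sub x hx) _)
  · exact ContinuousOn.congr (f := fun a : ℝ × ℝ => uY w z f a.1 a.2)
      (fun a ha => (H.uYc fc (sub ha.1) a.2).continuousWithinAt) fun a ha => e1 _ (sub ha.1) _
  · rw [e1 x (sub hx), uY, min_eq_right hy, mul_zero, add_zero, abs_div, abs_two]
    have := H.zb x (pP w x y)
    linarith
  · exact ContinuousOn.congr (f := fun a : ℝ × ℝ => uYY w q f a.1 a.2)
      (fun a ha => (H.uYYc fc (sub ha.1) a.2).continuousWithinAt) fun a ha => e2 _ (sub ha.1) _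
  · rw [e2 x (sub hx), uYY]
    refine (aal _ _).trans (add_le_add ?_ (hF x (sub hx)))
    rw [abs_div, abs_two]
    have h1 := H.E.qb x (pP w x y)
    have h2 : mu |pP w x y| ≤ 1 := min_le_right _ _
    have h3 := mll h2 H.E.K0
    linarith
  · refine ⟨_, (lb (c3 a ha)).and ((lb (c1 a ha)).and (lb (c2 a ha))), max (|vV w q a.1 a.2|+1)
      (max (|pd 0 1 (vV w q) a.1 a.2|+1) (|pd 1 0 (uU w z f) a.1 a.2|+1)), fun b hb => ⟨?_, ?_, ?_⟩⟩
    · exact le_max_of_le_left hb.1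
    · exact le_max_of_le_right (le_max_of_le_left hb.2.1)
    · exact le_max_of_le_right (le_max_of_le_right hb.2.2)
  · have hx := Ioo_subset_Icc_self hx
    have hy : 0 < y := hy
    rw [e4 x hx y hy.le, e1 x hx, e2 x hx, hp, uv x y hy.le, vV, uX, rX, uY, uYY, min_eq_right hy.le]
    have h3 := (H.ps hx hy).2.2
    rw [← pPp hy.le]; field_simp; ring
  · have hx := Ioo_subset_Icc_self hx
    rw [e4 x hx y (le_of_lt hy), e3 x hx]; ring
  · rw [uv x 0 le_rfl, H.E.PS0 (H.sub x (sub hx)), H.E.w0, Real.sqrt_zero]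
  · rw [vV, H.E.pPn (H.sub x (sub hx)) le_rfl, H.E.w0]; simp
  · obtain ⟨h1, h2⟩ := hU x (sub hx)
    have hI := H.sub x (sub hx)
    have ht : Tendsto (PS w x) atTop atTop := (H.E.PSm hI).monotone.tendsto_atTop_atTop fun t => ⟨YY w x t, (H.E.PSl hI t).ge⟩
    have := ((H.inf x (sub hx)).comp ht).sqrt
    rw [← h2, Real.sqrt_sq h1.le] at this
    refine this.congr' ?_
    filter_upwards [eventually_ge_atTop 0] with y hy
    rw [uv x y hy]; rfl
  · have hy : 0 < y := hy
    rw [uv x y hy.le, ← pPp hy.le]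
    exact (H.ps (sub hx) hy).2.2
  · obtain ⟨yo, h0, m, m0, h⟩ := H.nondeg (f := f) X0
    refine ⟨yo, h0, m, m0, fun x hx y hy => ?_⟩
    have hx : x ∈ Icc 0 X := ⟨hx.1, hx.2.trans hb.2.le⟩
    rw [e1 x hx]; exact h x hx y hy

lemma FX.outU (H : FF) (hU : ContDiff ℝ (⊤ : ℕ∞) U) (hp : ∀ x, HasDerivAt p (f x) x)
    (hb : ∀ x, U x * deriv U x + f x = 0) (U0 : 0 < U 0) (hU2 : U2 = U 0^2) :
    ∀ x ∈ Icc 0 X, 0 < U x ∧ U x^2 = U2 - 2*(p x - p 0) := by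
  have d : ∀ x, HasDerivAt (fun x => U x^2 + 2*p x) 0 x := fun x => by
    refine ((((hU.differentiable (by simp)) x).hasDerivAt.pow 2).add ((hp x).const_mul 2)).congr_deriv ?_
    simp; linear_combination 2*hb x
  have e : ∀ x, U x^2 = U2 - 2*(p x - p 0) := fun x => by
    have := is_const_of_deriv_eq_zero (fun x => (d x).differentiableAt) (fun x => (d x).deriv) x 0
    rw [hU2]; linarith
  refine fun x hx => ⟨?_, e x⟩
  by_contra hn
  obtain ⟨s, hs, h0⟩ := intermediate_value_Icc' hx.1 hU.continuous.continuousOn (show (0:ℝ) ∈ Icc (U x) (U 0) from ⟨not_lt.1 hn, U0.le⟩)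
  have hs : s ∈ Icc 0 X := ⟨hs.1, hs.2.trans hx.2⟩
  have h1 := H.inf s hs
  rw [← e s, h0] at h1
  have h2 := ge_of_tendsto h1 (b := c) (by
    filter_upwards [eventually_ge_atTop 1] with t ht
    have := H.E.lo s (H.sub s hs) t
    rwa [mu, abn l!, min_eq_right ht, mul_one] at this)
  have := H.E.c0
  norm_num at h2; linarith
end

structure KF (uo ui uz : ℝ → ℝ) (f0 U0 K c s yi C α : ℝ) : Prop where
  K0 : 0 < K
  c0 : 0 < c
  s0 : 0 < s
  y0 : 0 < yi
  C0 : 0 < C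
  α0 : 0 < α
  Up : 0 < U0
  init : uo 0 = 0
  ct : ContinuousOn uo (Ici 0)
  d1 : ∀ y > 0, HasDerivAt uo (ui y) y
  d2 : ∀ y > 0, HasDerivAt ui (uz y) y
  b : ∀ y ≥ 0, |uo y| ≤ K ∧ |ui y| ≤ K ∧ |uz y| ≤ K
  ho : ∀ y ≥ 0, ∀ z ≥ 0, |uz y - uz z| ≤ K*|y-z|^α
  lo : ∀ y ≥ 0, c*mu y ≤ uo y
  sl : ∀ y > 0, y ≤ yi → s ≤ ui y
  cp : ∀ y ≥ 0, y ≤ yi → |uz y - f0| ≤ C*y^2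
  outer : Tendsto uo atTop (𝓝 U0)

theorem InClassK.kf {U0 f0 : ℝ} {uo : ℝ → ℝ} (H : InClassK U0 f0 uo) :
    ∃ K c s yi C α, KF uo (deriv uo) (iteratedDeriv 2 uo) f0 U0 K c s yi C α := by
  obtain ⟨α, α0, K, K0, cd, hb, hh⟩ := H.reg
  obtain ⟨C, C0, r, r0, hc⟩ := H.compat
  have s0 := H.slope
  have Up0 := H.hU0
  have ct := cd.continuousOn
  have ca : ∀ y > 0, ContDiffAt ℝ 2 uo y := fun y hy => cd.contDiffAt (Ici_mem_nhds hy)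
  have d1 : ∀ y > 0, HasDerivAt uo (deriv uo y) y := fun y hy => ((ca y hy).differentiableAt (by norm_num)).hasDerivAt
  have d2 : ∀ y > 0, HasDerivAt (deriv uo) (iteratedDeriv 2 uo y) y := fun y hy => by
    rw [iteratedDeriv_succ, iteratedDeriv_one]
    have h1 : ContDiffAt ℝ 1 (deriv uo) y := (ca y hy).derivWithin (m := 1) (by norm_num)
    exact (h1.differentiableAt (by norm_num)).hasDerivAt
  have c1 : ContinuousWithinAt (deriv uo) (Ici 0) 0 := by
    have h1 := (cd.continuousOn_derivWithin (uniqueDiffOn_Ici 0) (by norm_num)) 0 self_mem_Ici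
    have h2 : derivWithin uo (Ici 0) 0 = deriv uo 0 :=
      (differentiableAt_of_deriv_ne_zero s0.ne').derivWithin (uniqueDiffOn_Ici 0 0 self_mem_Ici)
    refine h1.congr (fun y hy => ?_) h2.symm
    rcases (mem_Ici.1 hy).eq_or_lt with rfl | hy
    · exact h2.symm
    · exact ((d1 y hy).differentiableAt.derivWithin (uniqueDiffOn_Ici 0 y hy.le)).symm
  have e1 : ∀ᶠ y in 𝓝[≥] (0:ℝ), deriv uo 0/2 < deriv uo y := c1.eventually_const_lt l!
  obtain ⟨y', hy', hs⟩ := mem_nhdsGE_iff_exists_Ico_subset.1 e1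
  have y0' : 0 < y' := hy'
  obtain ⟨yi, hy1⟩ := exr (min (y'/2) r)
  have y0 : 0 < yi := by rw [hy1]; positivity
  have l1 : yi ≤ y'/2 := by rw [hy1]; exact min_le_left _ _
  have l2 : yi ≤ r := by rw [hy1]; exact min_le_right _ _
  have sl : ∀ y > 0, y ≤ yi → deriv uo 0/2 ≤ deriv uo y := fun y h1 h2 => le_of_lt (hs ⟨h1.le, l!⟩)
  obtain ⟨Y, hY⟩ := eventually_atTop.1 (H.outer.eventually_const_lt (half_lt_self Up0))
  obtain ⟨xi, hx1, hm⟩ := isCompact_Icc.exists_isMinOn (s := Icc yi (max yi Y)) ⟨yi, left_mem_Icc.2 (le_max_left _ _)⟩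
    (ct.mono (fun y hy => y0.le.trans hy.1))
  have m0 := H.pos xi (y0.trans_le hx1.1)
  refine ⟨K, min (deriv uo 0/2) (min (uo xi) (U0/2)), deriv uo 0/2, yi, C, α, K0, p!, p!, y0, C0, α0, Up0, H.init, ct, d1, d2, hb, hh,
    fun y hy => ?_, sl, fun y h1 h2 => hc y ⟨h1, h2.trans l2⟩, H.outer⟩
  have n1 : mu y ≤ 1 := min_le_right _ _
  have n0 : 0 ≤ mu y := le_min hy zero_le_one
  rcases le_total y yi with h | h
  · rcases hy.eq_or_lt with rfl | hy
    · rw [H.init, mu, min_eq_left zero_le_one, mul_zero]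
    obtain ⟨ξ, hξ, e⟩ := exists_hasDerivAt_eq_slope uo (deriv uo) hy (ct.mono Icc_subset_Ici_self) (fun z hz => d1 z hz.1)
    rw [H.init, eq_div_iff l!] at e
    have := sl ξ hξ.1 (by linarith [hξ.2])
    calc _ ≤ deriv uo 0/2*y := by
          gcongr
          · exact min_le_left _ _
          · exact min_le_left _ _
      _ ≤ deriv uo ξ*y := by gcongr
      _ = uo y := l!
  · refine (ml1 p! n1).trans ?_
    rcases le_total y Y with h' | h'
    · exact ((min_le_right _ _).trans (min_le_left _ _)).trans (hm ⟨h, h'.trans (le_max_right _ _)⟩)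
    · exact ((min_le_right _ _).trans (min_le_right _ _)).trans (hY y h').le

section
variable {uo ui uz : ℝ → ℝ} {f0 U0 K c s yi C α : ℝ}
local notation "KK" => KF uo ui uz f0 U0 K c s yi C α

noncomputable def sP (uo : ℝ → ℝ) (y : ℝ) : ℝ := ∫ s in (0:ℝ)..y, uo |s|

lemma KF.ca (H : KK) : Continuous (fun y => uo |y|) :=
  H.ct.comp_continuous continuous_abs (fun y => abs_nonneg y)

lemma KF.Pd (H : KK) (y : ℝ) : HasDerivAt (sP uo) (uo |y|) y :=
  intervalIntegral.integral_hasDerivAt_right (H.ca.intervalIntegrable _ _) (H.ca.stronglyMeasurableAtFilter _ _) H.ca.continuousAt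

lemma KF.Pc (H : KK) : Continuous (sP uo) :=
  continuous_iff_continuousAt.2 fun y => (H.Pd y).continuousAt

lemma KF.up (H : KK) {y : ℝ} (hy : y ≠ 0) : 0 < uo |y| :=
  (mul_pos H.c0 (mu_pos (abs_pos.2 hy))).trans_le (H.lo _ (abs_nonneg y))

lemma sP0 : sP uo 0 = 0 := intervalIntegral.integral_same

lemma KF.Pm (H : KK) : StrictMono (sP uo) := by
  refine StrictMonoOn.Iic_union_Ici (a := 0) (strictMonoOn_of_deriv_pos (convex_Iic 0) H.Pc.continuousOn fun y hy => ?_)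
    (strictMonoOn_of_deriv_pos (convex_Ici 0) H.Pc.continuousOn fun y hy => ?_)
  · rw [interior_Iic] at hy
    rw [(H.Pd y).deriv]; exact H.up (ne_of_lt hy)
  · rw [interior_Ici] at hy
    rw [(H.Pd y).deriv]; exact H.up (ne_of_gt hy)

lemma KF.Pl (H : KK) {x y m : ℝ} (hxy : x ≤ y) (hm : ∀ z ∈ Ioo x y, m ≤ mu |z|) :
    c*m*(y-x) ≤ sP uo y - sP uo x := by
  rcases hxy.eq_or_lt with rfl | hxy
  · simp
  obtain ⟨ξ, hξ, e⟩ := exists_hasDerivAt_eq_slope (sP uo) (fun y => uo |y|) hxy H.Pc.continuousOn (fun z _ => H.Pd z)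
  rw [eq_div_iff l!] at e
  rw [← e]
  have h0 : 0 ≤ y - x := l!
  have h1 := H.lo |ξ| (abs_nonneg _)
  have h2 := mll (hm ξ hξ) H.c0.le
  exact mlr (h2.trans h1) h0

lemma KF.Ps (H : KK) : Function.Surjective (sP uo) := by
  refine H.Pc.surjective ?_ ?_
  · refine tendsto_atTop_mono' atTop (f₁ := fun y => c*1*(y-1) + sP uo 1) ?_
      (tendsto_atTop_add_const_right _ _ (Tendsto.const_mul_atTop (by linarith [H.c0]) (tendsto_atTop_add_const_right _ _ tendsto_id)))
    filter_upwards [eventually_ge_atTop 1] with y hy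
    have := H.Pl (m := 1) hy (fun z hz => le_min (by rw [abp (by linarith [hz.1])]; exact hz.1.le) le_rfl)
    linarith
  · refine tendsto_atBot_mono' atBot (f₁ := fun y => c*1*(y+1) + sP uo (-1)) ?_
      (tendsto_atBot_add_const_right _ _ (Tendsto.const_mul_atBot (by linarith [H.c0]) (tendsto_atBot_add_const_right _ _ tendsto_id)))
    filter_upwards [eventually_le_atBot (-1)] with y hy
    have := H.Pl (m := 1) hy (fun z hz => le_min (by rw [abs_of_neg (by linarith [hz.2])]; linarith [hz.2]) le_rfl)
    linarith

lemma KF.Pq (H : KK) {y η : ℝ} (hy : 0 ≤ y) (h0 : 0 < η) (h1 : η ≤ 1) :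
    c*η^2/4 ≤ sP uo (y+η) - sP uo y := by
  have a1 := H.Pl (x := y+η/2) (y := y+η) (m := η/2) l! (fun z hz =>
    le_min (by rw [abp (by linarith [hz.1])]; linarith [hz.1]) l!)
  have a2 := (H.Pm (l! : y < y+η/2)).le
  nlinarith only [a1, a2]

lemma KF.inv (H : KK) :
    ∃ Y : ℝ → ℝ, Continuous Y ∧ StrictMono Y ∧ (∀ t, sP uo (Y t) = t) ∧ ∀ y, Y (sP uo y) = y := by
  obtain ⟨e, he⟩ : ∃ e : ℝ ≃o ℝ, ∀ y, e y = sP uo y := ⟨H.Pm.orderIsoOfSurjective _ H.Ps, fun y => rfl⟩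
  exact ⟨e.symm, e.symm.continuous, e.symm.strictMono, fun t => by rw [← he, e.apply_symm_apply], fun y => by rw [← he, e.symm_apply_apply]⟩

lemma KF.data (H : KK) :
    ∃ wo w1 G cr Mo Mi Kq, Data wo w1 G f0 (U0^2) cr Mo Mi Kq ∧ ∀ y ≥ 0, wo (sP uo y) = uo y^2 := by
  obtain ⟨Y, Yc, Ym, PY, YP⟩ := H.inv
  have Y0 : Y 0 = 0 := by have := YP 0; rwa [sP0] at this
  have Yp : ∀ t > 0, 0 < Y t := fun t ht => Y0 ▸ Ym ht
  have Yn : ∀ t ≥ 0, 0 ≤ Y t := fun t ht => Y0 ▸ Ym.monotone ht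
  have hK := H.K0
  have hs := H.s0
  have hC := H.C0
  have hcc := H.c0
  obtain ⟨w, hw⟩ : ∃ w : ℝ → ℝ, ∀ t, w t = (uo |Y t|)^2 := ⟨_, fun t => rfl⟩
  have wc : Continuous w := by rw [funext hw]; exact (H.ca.comp Yc).pow 2
  have up : ∀ y > 0, 0 < uo y := fun y hy => by have := H.up hy.ne'; rwa [abp hy] at this
  have un : ∀ y ≥ 0, 0 ≤ uo y := fun y hy => (mul_nonneg H.c0.le (le_min hy zero_le_one)).trans (H.lo y hy)
  have hw' : ∀ t ≥ 0, w t = uo (Y t)^2 := fun t ht => by rw [hw, abn (Yn t ht)]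
  have Yd : ∀ t > 0, HasDerivAt Y (uo (Y t))⁻¹ t := fun t ht => by
    have h := H.Pd (Y t)
    rw [abp (Yp t ht)] at h
    exact h.of_local_left_inverse Yc.continuousAt (up _ (Yp t ht)).ne' (Eventually.of_forall PY)
  have d1 : ∀ t > 0, HasDerivAt w (2*ui (Y t)) t := fun t ht => by
    have h := ((H.d1 _ (Yp t ht)).comp t (Yd t ht)).pow 2
    have hu := (up _ (Yp t ht)).ne'
    refine (h.congr_deriv ?_).congr_of_eventuallyEq ?_
    · simp only [Function.comp]; field_simp; norm_num; ring
    · filter_upwards [Ioi_mem_nhds ht] with r hr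
      simpa using hw' r (le_of_lt hr)
  have d2 : ∀ t > 0, HasDerivAt (fun t => 2*ui (Y t)) (2*uz (Y t)/√(w t)) t := fun t ht => by
    have h := ((H.d2 _ (Yp t ht)).comp t (Yd t ht)).const_mul 2
    rw [hw' t ht.le, Real.sqrt_sq (un _ (Yn t ht.le))]
    exact h.congr_deriv (by ring)
  have slope : ∀ a ≥ 0, ∀ b > a, ∃ ξ ∈ Ioo a b, w b - w a = 2*ui (Y ξ)*(b-a) := fun a ha b hb => by
    obtain ⟨ξ, hξ, e⟩ := exists_hasDerivAt_eq_slope w _ hb wc.continuousOn (fun z hz => d1 z (ha.trans_lt hz.1))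
    exact ⟨ξ, hξ, by rw [eq_div_iff l!] at e; exact e.symm⟩
  have lipa : ∀ a ≥ 0, ∀ b > a, |w b - w a| ≤ 2*K*|b-a| := fun a ha b hb => by
    obtain ⟨ξ, hξ, e⟩ := slope a ha b hb
    rw [e, abs_mul, abs_mul, abs_two]
    have := (H.b _ (Yn ξ (ha.trans hξ.1.le))).2.1
    gcongr
  have lip : ∀ a ≥ 0, ∀ b ≥ 0, |w a - w b| ≤ 2*K*|a-b| := fun a ha b hb => by
    rcases lt_trichotomy a b with h | rfl | h
    · rw [abc, abc a]; exact lipa a ha b h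
    · simp
    · exact lipa b hb a h
  have wz : w 0 = 0 := by rw [hw, Y0, abs_zero, H.init]; norm_num
  have hi : ∀ t, w t ≤ K^2 := fun t => by
    rw [hw]; exact sq_le_sq' (by linarith [(abs_le.1 (H.b _ (abs_nonneg (Y t))).1).1]) (abs_le.1 (H.b _ (abs_nonneg (Y t))).1).2
  obtain ⟨t1, ht1⟩ := exr (sP uo yi)
  obtain ⟨c', hc'⟩ := exr ((c*mu yi)^2)
  have c'0 : 0 < c' := by have := mu_pos H.y0; rw [hc']; positivity
  have hbig : ∀ t ≥ t1, c' ≤ w t := fun t ht => by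
    have h1 : yi ≤ Y t := by rw [← YP yi, ← ht1]; exact Ym.monotone ht
    rw [hc', hw, abp (H.y0.trans_le h1)]
    have h2 := H.lo _ (H.y0.le.trans h1)
    have h3 : mu yi ≤ mu (Y t) := min_le_min_right _ h1
    have := mu_pos H.y0
    exact pow_le_pow_left₀ p! ((mll h3 H.c0.le).trans h2) 2
  obtain ⟨m, hm⟩ := exr (min (2*s) (c'/2))
  have m0 : 0 < m := by rw [hm]; positivity
  have inc : ∀ ε ≥ 0, ε < c'/(4*K) → ∀ y ≥ 0, w ε + m*mu y ≤ w (ε+y) := fun ε e0 e1 y hy => by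
    rcases le_total t1 (ε+y) with h | h
    · have a1 := hbig _ h
      have a2 := (abs_le.1 (lip ε e0 0 le_rfl)).2
      rw [wz, sub_zero, sub_zero, abn e0] at a2
      rw [lt_div_iff₀ p!] at e1
      have a3 : m*mu y ≤ c'/2*1 := by
        rw [hm]
        gcongr
        · exact le_min hy zero_le_one
        · exact min_le_right _ _
        · exact min_le_right _ _
      linarith
    · rcases hy.eq_or_lt with rfl | hy
      · simp [mu]
      obtain ⟨ξ, hξ, e⟩ := slope ε e0 (ε+y) l!
      have b1 := H.sl (Y ξ) (Yp ξ (e0.trans_lt hξ.1)) (by rw [← YP yi, ← ht1]; exact Ym.monotone (hξ.2.le.trans h))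
      have a3 : m*mu y ≤ 2*ui (Y ξ)*(ε+y-ε) := by
        rw [add_sub_cancel_left]
        have := min_le_left (2*s) (c'/2)
        rw [← hm] at this
        exact mul_le_mul l! (min_le_left _ _) (le_min hy.le zero_le_one) l!
      linarith
  have ε0 : 0 < c'/(4*K) := p!
  obtain ⟨y2, hy2⟩ := exr (min yi 1)
  have y20 : 0 < y2 := by have := H.y0; rw [hy2]; positivity
  obtain ⟨t2, ht2⟩ := exr (sP uo y2)
  have t20 : 0 < t2 := by rw [ht2, ← sP0 (uo := uo)]; exact H.Pm y20
  have mt2 := mu_pos t20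
  obtain ⟨Kq, hKq⟩ := exr (1 + 2*C*(4/c+1) + 2*(K+|f0|)/mu t2)
  have q1 : 0 ≤ 2*C*(4/c+1) := p!
  have q2 : 0 ≤ 2*(K+|f0|)/mu t2 := p!
  have Gb : ∀ t ≥ 0, |2*uz (Y t) - 2*f0| ≤ Kq*mu t := fun t ht => by
    have m00 : 0 ≤ mu t := le_min ht zero_le_one
    rw [← mul_sub, abs_mul, abs_two]
    rcases le_total (Y t) y2 with h | h
    · have g1 := H.cp _ (Yn t ht) (h.trans (by rw [hy2]; exact min_le_left _ _))
      have l1 : Y t ≤ 1 := h.trans (by rw [hy2]; exact min_le_right _ _)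
      have g2 : (Y t)^2 ≤ (4/c+1)*mu t := by
        rcases ht.eq_or_lt with rfl | ht
        · simp [Y0, mu]
        have p1 := H.Pq le_rfl (Yp t ht) l1
        rw [zero_add, PY, sP0, sub_zero] at p1
        have p2 : (Y t)^2 ≤ 4/c*t := by
          rw [div_mul_eq_mul_div, ldi hcc]; linarith
        have p3 : (Y t)^2 ≤ 1 := by have := Yp t ht; nlinarith only [this, l1]
        have c4 : 0 < 4/c := p!
        unfold mu
        rcases min_cases t 1 with ⟨e, _⟩ | ⟨e, _⟩ <;> rw [e] <;> linarith
      have g3 := mll g2 hC.le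
      rw [hKq]
      nlinarith only [g1, g3, mul_nonneg q2 m00, m00]
    · have g1 : t2 ≤ t := by rw [ht2, ← PY t]; exact H.Pm.monotone h
      have g2 : mu t2 ≤ mu t := min_le_min_right _ g1
      have g3 : |uz (Y t) - f0| ≤ K + |f0| := (abs_sub _ _).trans (by linarith [(H.b _ (Yn t ht)).2.2])
      have g4 : 2*(K+|f0|) ≤ 2*(K+|f0|)/mu t2*mu t := by
        rw [div_mul_eq_mul_div, ldi mt2]
        gcongr
      rw [hKq]
      nlinarith only [g3, g4, mul_nonneg q1 m00, m00]
  have Gm : ∀ δ > 0, ∃ N ≥ 0, ∀ a ≥ 0, ∀ b ≥ 0, |2*uz (Y a) - 2*uz (Y b)| ≤ δ + N*√|a-b| := fun δ hδ => by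
    have ht : Tendsto (fun η : ℝ => 2*(K*η^α)) (𝓝[>] 0) (𝓝 0) := by
      have h := ((Real.continuousAt_rpow_const 0 α (Or.inr H.α0.le)).tendsto.const_mul K).const_mul 2
      rw [Real.zero_rpow H.α0.ne', mul_zero, mul_zero] at h
      exact h.mono_left nhdsWithin_le_nhds
    obtain ⟨η, hη, η1, η0⟩ := ((ht.eventually_lt_const hδ).and (((eventually_lt_nhds zero_lt_one).filter_mono nhdsWithin_le_nhds).and self_mem_nhdsWithin)).exists
    have η0 : 0 < η := η0
    obtain ⟨θ, hθ⟩ := exr (c*η^2/4)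
    have θ0 : 0 < θ := by rw [hθ]; positivity
    have key : ∀ a ≥ 0, ∀ b ≥ a, |2*uz (Y a) - 2*uz (Y b)| ≤ δ + 4*K/√θ*√|a-b| := fun a ha b hb => by
      rw [← mul_sub, abs_mul, abs_two]
      have hY := Ym.monotone hb
      rcases lt_or_ge (Y b) (Y a + η) with h | h
      · have e1 := H.ho _ (Yn a ha) _ (Yn b (ha.trans hb))
        have e2 : |Y a - Y b|^α ≤ η^α := Real.rpow_le_rpow (abs_nonneg _) (by rw [abc, abn l!]; linarith) H.α0.le
        have e3 : 0 ≤ 4*K/√θ*√|a-b| := p!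
        have e4 := mll e2 hK.le
        linarith
      · have e1 := H.Pq (Yn a ha) η0 η1.le
        have e2 := H.Pm.monotone h
        rw [PY] at e1 e2
        have e3 : √θ ≤ √|a-b| := sqm (by rw [abc, abn l!]; linarith)
        have e4 : 4*K ≤ 4*K/√θ*√|a-b| := by
          rw [div_mul_eq_mul_div, ldi p!]
          gcongr
        have e5 : |uz (Y a) - uz (Y b)| ≤ K + K := (abs_sub _ _).trans (add_le_add (H.b _ (Yn a ha)).2.2 (H.b _ (Yn b (ha.trans hb))).2.2)
        linarith
    refine ⟨4*K/√θ, p!, fun a ha b hb => ?_⟩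
    rcases le_total a b with h | h
    · exact key a ha b h
    · rw [abc, abc a]; exact key b hb a h
  have Yt : Tendsto Y atTop atTop := by
    refine tendsto_atTop_atTop.2 fun b => ⟨sP uo b, fun t ht => ?_⟩
    rw [← YP b]; exact Ym.monotone ht
  have wt : Tendsto w atTop (𝓝 (U0^2)) := by
    refine ((H.outer.comp Yt).pow 2).congr' ?_
    filter_upwards [eventually_ge_atTop 0] with t ht
    exact (hw' t ht).symm
  have inf : ∀ δ > 0, ∃ N, ∀ t ≥ 0, |w t - U0^2| ≤ δ + N*exp (-t) := fun δ hδ => by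
    obtain ⟨T, hT⟩ := Metric.tendsto_atTop.1 wt δ hδ
    refine ⟨(K^2+U0^2)*exp T, fun t ht => ?_⟩
    rw [mul_assoc, ← Real.exp_add]
    rcases le_total T t with h | h
    · have := hT t h
      rw [Real.dist_eq] at this
      have h2 : 0 ≤ (K^2+U0^2)*exp (T + -t) := p!
      linarith
    · have h1 : 1 ≤ exp (T + -t) := Real.one_le_exp l!
      have h2 : (K^2+U0^2)*1 ≤ (K^2+U0^2)*exp (T + -t) := by gcongr
      have h3 := hi t
      have h4 : 0 ≤ w t := by rw [hw]; positivity
      rw [abs_le]; constructor <;> nlinarith only [h2, h3, h4, hδ, sq_nonneg U0, sq_nonneg K]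
  refine ⟨w, fun t => 2*ui (Y t), fun t => 2*uz (Y t), m, K^2, 2*K, Kq,
    { c0 := m0, Kq1 := by rw [hKq]; linarith, M1 := p!, lo := fun t ht => ?_, hi := fun t ht => hi t, z := wz, lip := lip, d1 := d1, d2 := d2,
      Gb := Gb, Gm := Gm, inf := inf, inc := ⟨m, m0, c'/(4*K), ε0, fun ε e0 e1 => inc ε e0.le e1⟩ }, fun y hy => ?_⟩
  · have := inc 0 le_rfl ε0 t ht
    rwa [wz, zero_add, zero_add] at this
  · rw [hw, YP, abn hy]
end

/-- Oleinik's existence theorem for the steady Prandtl system: for data `u₀ ∈ 𝒦`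
and smooth `p`, there exists `X > 0` and a solution on `[0,X) × [0,∞)` with the
stated properties; moreover, if `p' ≤ 0` then the solution is global, i.e. one
may take any `X > 0`. -/
theorem oleinik_existence (U p u₀ : ℝ → ℝ)
    (hU : ContDiff ℝ (⊤ : ℕ∞) U) (hp : ContDiff ℝ (⊤ : ℕ∞) p)
    (hbernoulli : ∀ x : ℝ, U x * deriv U x + deriv p x = 0)
    (hu₀ : InClassK (U 0) (deriv p 0) u₀) :
    (∃ X > (0 : ℝ), ∃ u v : ℝ → ℝ → ℝ, PrandtlOnInterval U p u₀ X u v) ∧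
    ((∀ x ∈ Set.Ici (0 : ℝ), deriv p x ≤ 0) →
      ∀ X > (0 : ℝ), ∃ u v : ℝ → ℝ → ℝ, PrandtlOnInterval U p u₀ X u v) := by
  obtain ⟨K, c, s, y₁, C, α, H⟩ := hu₀.kf
  obtain ⟨w₀, w1, G, c₀, M₀, M₁, Kq, D, hw⟩ := H.data
  have fC : ContDiff ℝ 1 (deriv p) := by
    have h : ContDiff ℝ (1+1) p := hp.of_le (by norm_cast)
    exact (contDiff_succ_iff_deriv.1 h).2.2
  have hd : ∀ x, HasDerivAt p (deriv p x) x := fun x => (hp.differentiable (by norm_num) x).hasDerivAt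
  have main : ∀ {X : ℝ}, 0 < X → (∃ c M K Z w q z, VMFlow w₀ (deriv p) p (U 0^2) X c M K Z w q z) →
      ∃ u v, PrandtlOnInterval U p u₀ X u v := fun {X} X0 ⟨c, M, K, Z, w, q, z, F⟩ => by
    obtain ⟨a, b, c', M', w', q', z', E⟩ := F.ext
    have Pd : ∀ y > 0, HasDerivAt (sP u₀) (u₀ y) y := fun y hy => by
      have := H.Pd y; rwa [abs_of_pos hy] at this
    refine E.prandtl X0 fC.continuous (fun x => rfl) (E.outU hU hd hbernoulli hu₀.hU0 rfl) fun y hy =>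
      E.init X0 sP0 (fun y hy => ?_) H.Pc.continuousOn Pd hu₀.pos hw hu₀.init hy
    rw [← sP0 (uo := u₀)]; exact H.Pm hy
  refine ⟨?_, fun fn X X0 => main X0 (glob_flow D rfl fC hd fn X0)⟩
  obtain ⟨X, X0, F⟩ := short_flow D rfl fC hd
  exact ⟨X, X0, main X0 F⟩
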